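/- arXiv:1508.04353 — 2 statements merged into one kernel-verified Lean document; each statement's English description precedes it below -/
import Mathlib

section
/- Let k be an algebraically closed field, A a spectroid over k, and M an indecomposable module in mod A which is not injective in mod A. Then there exists an almost split sequence 0 → M → E → N → 0 in mod A if and only if M is finitely co-presented. -/
open CategoryTheory CategoryTheory.Limits

namespace Paper

variable (k : Type) [Field k]

section General

variable (A : Type) [Category.{0} A] [Preadditive A] [CategoryTheory.Linear k A]

/-- A spectroid over `k`: a (small) Hom-finite `k`-linear category in which every object
has a local endomorphism ring and distinct objects are not isomorphic. -/
class Spectroid : Prop where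
  homFinite : ∀ a b : A, FiniteDimensional k (a ⟶ b)
  localEnd : ∀ a : A, IsLocalRing (End a)
  skeletal : ∀ a b : A, (a ≅ b) → a = b

variable {A}

/-- `M` is a module over `A`, i.e. the functor `M : A ⥤ ModuleCat k` is additive and
`k`-linear on morphisms. -/
def IsMod (M : A ⥤ ModuleCat.{0} k) : Prop :=
  (∀ {a b : A} (f g : a ⟶ b), M.map (f + g) = M.map f + M.map g) ∧
  (∀ {a b : A} (r : k) (f : a ⟶ b), M.map (r • f) = r • M.map f)

/-- `M` is a locally finite dimensional module over `A`, i.e. an object of `mod A`. -/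
def IsLfdMod (M : A ⥤ ModuleCat.{0} k) : Prop :=
  IsMod k M ∧ ∀ a : A, FiniteDimensional k (M.obj a)

/-- The projective module `P_a = Hom_A(a, -)` at an object `a`. -/
noncomputable def ProjAt (a : A) : A ⥤ ModuleCat.{0} k :=
  (linearCoyoneda k A).obj (Opposite.op a)

/-- The injective module `I_a = D Hom_A(-, a)` at an object `a`. -/
noncomputable def InjAt (a : A) : A ⥤ ModuleCat.{0} k where
  obj b := ModuleCat.of k (Module.Dual k (b ⟶ a))
  map {b c} f := ModuleCat.ofHom (LinearMap.dualMap (Linear.leftComp k a f))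
  map_id b := by
    have h : Linear.leftComp k a (𝟙 b) = LinearMap.id := by
      apply LinearMap.ext; intro g; simp
    rw [h, LinearMap.dualMap_id]; rfl
  map_comp {b c d} f g := by
    have h : Linear.leftComp k a (f ≫ g) =
        (Linear.leftComp k a f).comp (Linear.leftComp k a g) := by
      apply LinearMap.ext; intro h; simp
    rw [h]; rfl

instance : HasFiniteBiproducts (A ⥤ ModuleCat.{0} k) :=
  CategoryTheory.Abelian.hasFiniteBiproducts

/-- `M` is finitely generated: there is an epimorphism `⊕_{i=1}^r P_{a_i} → M`. -/
def IsFG (M : A ⥤ ModuleCat.{0} k) : Prop :=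
  ∃ (r : ℕ) (a : Fin r → A) (f : (⨁ fun i => ProjAt k (a i)) ⟶ M), Epi f

/-- `M` is finitely presented: there is an epimorphism `⊕_{i=1}^r P_{a_i} → M` with
finitely generated kernel. -/
def IsFP (M : A ⥤ ModuleCat.{0} k) : Prop :=
  ∃ (r : ℕ) (a : Fin r → A) (f : (⨁ fun i => ProjAt k (a i)) ⟶ M),
    Epi f ∧ IsFG k (kernel f)

/-- `M` is finitely co-generated: there is a monomorphism `M → ⊕_{j=1}^s I_{b_j}`. -/
def IsFCG (M : A ⥤ ModuleCat.{0} k) : Prop :=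
  ∃ (s : ℕ) (b : Fin s → A) (f : M ⟶ ⨁ fun j => InjAt k (b j)), Mono f

/-- `M` is finitely co-presented: there is a monomorphism `M → ⊕_{j=1}^s I_{b_j}` with
finitely co-generated cokernel. -/
def IsFCP (M : A ⥤ ModuleCat.{0} k) : Prop :=
  ∃ (s : ℕ) (b : Fin s → A) (f : M ⟶ ⨁ fun j => InjAt k (b j)),
    Mono f ∧ IsFCG k (cokernel f)

/-- `f` is an irreducible morphism in `mod A`: it is neither a split mono nor a split epi,
and in any factorization `f = g ≫ h` through an object of `mod A`, `g` is a split mono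
or `h` is a split epi. -/
def Irred {L M : A ⥤ ModuleCat.{0} k} (f : L ⟶ M) : Prop :=
  ¬ IsSplitMono f ∧ ¬ IsSplitEpi f ∧
    ∀ ⦃X : A ⥤ ModuleCat.{0} k⦄, IsLfdMod k X →
      ∀ (g : L ⟶ X) (h : X ⟶ M), g ≫ h = f → IsSplitMono g ∨ IsSplitEpi h

/-- `M` is an indecomposable object of `mod A`: it is nonzero, and whenever `M ≅ X ⊞ Y`
with `X`, `Y` in `mod A`, one of `X`, `Y` is zero. -/
def Indec (M : A ⥤ ModuleCat.{0} k) : Prop :=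
  ¬ IsZero M ∧ ∀ ⦃X Y : A ⥤ ModuleCat.{0} k⦄, IsLfdMod k X → IsLfdMod k Y →
    (M ≅ X ⊞ Y) → IsZero X ∨ IsZero Y

/-- `0 → L →f M →g N → 0` is an almost split sequence in `mod A`. -/
structure AlmostSplitSeq {L M N : A ⥤ ModuleCat.{0} k} (f : L ⟶ M) (g : M ⟶ N) : Prop where
  mono : Mono f
  epi : Epi g
  zero : f ≫ g = 0
  exact : (ShortComplex.mk f g zero).Exact
  not_splitMono : ¬ IsSplitMono f
  not_splitEpi : ¬ IsSplitEpi g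
  left_almost_split : ∀ ⦃X : A ⥤ ModuleCat.{0} k⦄, IsLfdMod k X →
    ∀ u : L ⟶ X, ¬ IsSplitMono u → ∃ v : M ⟶ X, f ≫ v = u
  right_almost_split : ∀ ⦃X : A ⥤ ModuleCat.{0} k⦄, IsLfdMod k X →
    ∀ u : X ⟶ N, ¬ IsSplitEpi u → ∃ v : X ⟶ M, v ≫ g = u

/-- `M` is projective as an object of `mod A`. -/
def ProjInMod (M : A ⥤ ModuleCat.{0} k) : Prop :=
  ∀ ⦃X Y : A ⥤ ModuleCat.{0} k⦄, IsLfdMod k X → IsLfdMod k Y →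
    ∀ (e : X ⟶ Y), Epi e → ∀ u : M ⟶ Y, ∃ t : M ⟶ X, t ≫ e = u

/-- `M` is injective as an object of `mod A`. -/
def InjInMod (M : A ⥤ ModuleCat.{0} k) : Prop :=
  ∀ ⦃X Y : A ⥤ ModuleCat.{0} k⦄, IsLfdMod k X → IsLfdMod k Y →
    ∀ (m : X ⟶ Y), Mono m → ∀ u : X ⟶ M, ∃ t : Y ⟶ M, m ≫ t = u

/-- `h` is a (nonempty) composition of irreducible morphisms between indecomposable
objects of `mod A`. -/
inductive IrredChain : ∀ {X Y : A ⥤ ModuleCat.{0} k}, (X ⟶ Y) → Prop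
  | single {X Y : A ⥤ ModuleCat.{0} k} (f : X ⟶ Y) :
      IsLfdMod k X → Indec k X → IsLfdMod k Y → Indec k Y → Irred k f → IrredChain f
  | comp {X Y Z : A ⥤ ModuleCat.{0} k} (f : X ⟶ Y) (g : Y ⟶ Z) :
      IsLfdMod k X → Indec k X → Irred k f → IrredChain g → IrredChain (f ≫ g)

end General

section QuiverSection

variable (Q : Type) [Quiver.{0} Q]

/-- `Q` is locally finite: every vertex is the source of finitely many arrows and the
target of finitely many arrows. -/
def LocallyFinite : Prop :=
  ∀ x : Q, Finite (Σ y : Q, x ⟶ y) ∧ Finite (Σ y : Q, y ⟶ x)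

/-- `Q` is interval finite: there are finitely many paths between any two vertices. -/
def IntervalFinite : Prop :=
  ∀ x y : Q, Finite (Quiver.Path x y)

/-- `Q` is strongly locally finite: locally finite and interval finite. -/
def StronglyLocallyFinite : Prop :=
  LocallyFinite Q ∧ IntervalFinite Q

/-- `Q` is connected: nonempty, and any two vertices are joined by a walk. -/
def QuiverConnected : Prop :=
  Nonempty Q ∧ ∀ x y : Q,
    Nonempty (Quiver.Path (Quiver.Symmetrify.of.obj x) (Quiver.Symmetrify.of.obj y))

/-- The path category `kQ` of the quiver `Q`: the free `k`-linear category on the free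
category on `Q`. -/
abbrev PathCat := CategoryTheory.Free k (Paths Q)

/-- A vertex of `Q`, seen as an object of the path category `kQ`. -/
noncomputable def vtx (x : Q) : PathCat k Q :=
  (Free.embedding k (Paths Q)).obj ((Paths.of Q).obj x)

/-- An arrow of `Q`, seen as a morphism of the path category `kQ`. -/
noncomputable def arrHom {x y : Q} (α : x ⟶ y) : vtx k Q x ⟶ vtx k Q y :=
  (Free.embedding k (Paths Q)).map ((Paths.of Q).map α)

/-- The degree of a vertex of `Q`: the total number of arrows incident to it. -/
noncomputable def degree (x : Q) : ℕ :=
  Nat.card ((Σ y : Q, x ⟶ y) ⊕ (Σ y : Q, y ⟶ x))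

/-- `M` belongs to `rrep(Q)`: it is the middle term of a short exact sequence
`0 → L → M → N → 0` with `L` finitely presented, `N` finitely co-presented, and only
finitely many arrows `α` of `Q` satisfy `M(α) ≠ 0`, `L(α) = 0` and `N(α) = 0`. -/
def InRrep (M : PathCat k Q ⥤ ModuleCat.{0} k) : Prop :=
  ∃ (L N : PathCat k Q ⥤ ModuleCat.{0} k) (f : L ⟶ M) (g : M ⟶ N) (zero : f ≫ g = 0),
    Mono f ∧ Epi g ∧ (ShortComplex.mk f g zero).Exact ∧ IsFP k L ∧ IsFCP k N ∧
    Set.Finite {p : Σ (x : Q) (y : Q), x ⟶ y |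
      M.map (arrHom k Q p.2.2) ≠ 0 ∧ L.map (arrHom k Q p.2.2) = 0 ∧
      N.map (arrHom k Q p.2.2) = 0}

variable {Q}

/-- The vertices occurring in a path. -/
def InPath {x : Q} : ∀ {y : Q}, Quiver.Path x y → Q → Prop
  | _, Quiver.Path.nil, v => v = x
  | _, @Quiver.Path.cons _ _ _ _ c p _, v => v = c ∨ InPath p v

variable (Q)

/-- `Q` is a star quiver: it is obtained from a finite full convex subquiver `Γ` by
attaching finitely many rays and co-rays with no common vertices. -/
def IsStarQuiver : Prop :=
  ∃ (Γ S₁ S₂ : Set Q) (v : Q → ℕ → Q),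
    Γ.Finite ∧ S₁ ⊆ Γ ∧ S₂ ⊆ Γ ∧ Disjoint S₁ S₂ ∧
    (∀ x y : Q, x ∈ Γ → y ∈ Γ → ∀ p : Quiver.Path x y, ∀ z : Q, InPath p z → z ∈ Γ) ∧
    (∀ s ∈ S₁ ∪ S₂, ∀ i : ℕ, v s i ∉ Γ) ∧
    (∀ s ∈ S₁ ∪ S₂, ∀ t ∈ S₁ ∪ S₂, ∀ i j : ℕ, v s i = v t j → s = t ∧ i = j) ∧
    (∀ x : Q, x ∉ Γ → ∃ s ∈ S₁ ∪ S₂, ∃ i : ℕ, x = v s i) ∧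
    (∀ s ∈ S₁, Nat.card (s ⟶ v s 0) = 1 ∧ ∀ i : ℕ, Nat.card (v s i ⟶ v s (i + 1)) = 1) ∧
    (∀ s ∈ S₂, Nat.card (v s 0 ⟶ s) = 1 ∧ ∀ i : ℕ, Nat.card (v s (i + 1) ⟶ v s i) = 1) ∧
    (∀ x y : Q, (x ⟶ y) → ¬(x ∈ Γ ∧ y ∈ Γ) →
      (∃ s ∈ S₁, (x = s ∧ y = v s 0) ∨ ∃ i : ℕ, x = v s i ∧ y = v s (i + 1)) ∨
      (∃ s ∈ S₂, (x = v s 0 ∧ y = s) ∨ ∃ i : ℕ, x = v s (i + 1) ∧ y = v s i))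

end QuiverSection

section Aux

variable {k}

section Pointwise

variable {A : Type} [Category.{0} A]

lemma app_injective_of_mono {X Y : A ⥤ ModuleCat.{0} k} (f : X ⟶ Y) [Mono f] (a : A) :
    Function.Injective (f.app a) :=
  (ModuleCat.mono_iff_injective _).1 inferInstance

lemma app_surjective_of_epi {X Y : A ⥤ ModuleCat.{0} k} (f : X ⟶ Y) [Epi f] (a : A) :
    Function.Surjective (f.app a) :=
  (ModuleCat.epi_iff_surjective _).1 inferInstance

lemma epi_of_app_surjective {X Y : A ⥤ ModuleCat.{0} k} (f : X ⟶ Y)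
    (h : ∀ a, Function.Surjective (f.app a)) : Epi f := by
  have : ∀ a, Epi (f.app a) := fun a => (ModuleCat.epi_iff_surjective _).2 (h a)
  exact NatTrans.epi_of_epi_app f

lemma mono_of_app_injective {X Y : A ⥤ ModuleCat.{0} k} (f : X ⟶ Y)
    (h : ∀ a, Function.Injective (f.app a)) : Mono f := by
  have : ∀ a, Mono (f.app a) := fun a => (ModuleCat.mono_iff_injective _).2 (h a)
  exact NatTrans.mono_of_mono_app f

lemma hom_ext_apply {X Y : A ⥤ ModuleCat.{0} k} {f g : X ⟶ Y}
    (h : ∀ a (x : X.obj a), f.app a x = g.app a x) : f = g := by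
  ext a x
  exact h a x

lemma naturality_apply' {X Y : A ⥤ ModuleCat.{0} k} (f : X ⟶ Y) {a b : A} (h : a ⟶ b)
    (x : X.obj a) : f.app b (X.map h x) = Y.map h (f.app a x) :=
  ConcreteCategory.congr_hom (f.naturality h) x

lemma app_sum_apply {ι : Type} [Fintype ι] {X Y : A ⥤ ModuleCat.{0} k} (f : ι → (X ⟶ Y)) (a : A)
    (x : X.obj a) : (∑ i, f i).app a x = ∑ i, (f i).app a x := by
  rw [NatTrans.app_sum]
  exact (congrArg (fun t : X.obj a →ₗ[k] Y.obj a => t x) (ModuleCat.hom_sum _ _)).trans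
    (LinearMap.sum_apply _ _ _)

lemma isIso_of_app_bijective {X Y : A ⥤ ModuleCat.{0} k} (f : X ⟶ Y)
    (h : ∀ a, Function.Bijective (f.app a)) : IsIso f := by
  have := mono_of_app_injective f fun a => (h a).1
  have := epi_of_app_surjective f fun a => (h a).2
  exact isIso_of_mono_of_epi f

end Pointwise

variable {A : Type} [Category.{0} A] [Preadditive A] [CategoryTheory.Linear k A]

lemma IsMod.map_add_apply {X : A ⥤ ModuleCat.{0} k} (hX : IsMod k X) {a b : A} (f g : a ⟶ b)
    (x : X.obj a) : X.map (f + g) x = X.map f x + X.map g x := by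
  rw [hX.1]; rfl

lemma IsMod.map_smul_apply {X : A ⥤ ModuleCat.{0} k} (hX : IsMod k X) {a b : A} (r : k)
    (f : a ⟶ b) (x : X.obj a) : X.map (r • f) x = r • X.map f x := by
  rw [hX.2]; rfl

/-- A functor which is jointly embedded in finitely many objects of `mod A` lies in `mod A`. -/
lemma IsLfdMod.of_jointly_injective {ι : Type} [Finite ι] {X : A ⥤ ModuleCat.{0} k}
    {Y : ι → (A ⥤ ModuleCat.{0} k)} (hY : ∀ i, IsLfdMod k (Y i)) (f : ∀ i, X ⟶ Y i)
    (hf : ∀ a (x y : X.obj a), (∀ i, (f i).app a x = (f i).app a y) → x = y) :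
    IsLfdMod k X := by
  refine ⟨⟨fun {a b} g h => ?_, fun {a b} r g => ?_⟩, fun a => ?_⟩
  · ext x
    refine hf _ _ _ fun i => ?_
    change (f i).app b (X.map (g + h) x) = (f i).app b (X.map g x + X.map h x)
    rw [map_add, naturality_apply', naturality_apply', naturality_apply',
      (hY i).1.map_add_apply]
  · ext x
    refine hf _ _ _ fun i => ?_
    change (f i).app b (X.map (r • g) x) = (f i).app b (r • X.map g x)
    rw [map_smul, naturality_apply', naturality_apply', (hY i).1.map_smul_apply]
  · have := fun i => (hY i).2 a
    refine FiniteDimensional.of_injective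
      (LinearMap.pi fun i => ((f i).app a).hom : X.obj a →ₗ[k] ∀ i, (Y i).obj a) ?_
    intro x y hxy
    exact hf _ _ _ fun i => congrFun hxy i

lemma IsLfdMod.of_mono {X Y : A ⥤ ModuleCat.{0} k} (hY : IsLfdMod k Y) (f : X ⟶ Y) [Mono f] :
    IsLfdMod k X :=
  IsLfdMod.of_jointly_injective (ι := Unit) (fun _ => hY) (fun _ => f)
    fun a _ _ h => app_injective_of_mono f a (h ())

lemma IsLfdMod.of_epi {X Y : A ⥤ ModuleCat.{0} k} (hX : IsLfdMod k X) (f : X ⟶ Y) [Epi f] :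
    IsLfdMod k Y := by
  refine ⟨⟨fun {a b} g h => ?_, fun {a b} r g => ?_⟩, fun a => ?_⟩
  · ext y
    obtain ⟨x, rfl⟩ := app_surjective_of_epi f a y
    change Y.map (g + h) (f.app a x) = Y.map g (f.app a x) + Y.map h (f.app a x)
    rw [← naturality_apply', ← naturality_apply', ← naturality_apply', ← map_add,
      hX.1.map_add_apply]
  · ext y
    obtain ⟨x, rfl⟩ := app_surjective_of_epi f a y
    change Y.map (r • g) (f.app a x) = r • Y.map g (f.app a x)
    rw [← naturality_apply', ← naturality_apply', ← map_smul, hX.1.map_smul_apply]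
  · have := hX.2 a
    exact Module.Finite.of_surjective (f.app a).hom (app_surjective_of_epi f a)

lemma IsLfdMod.biproduct {ι : Type} [Finite ι] {Y : ι → (A ⥤ ModuleCat.{0} k)}
    (hY : ∀ i, IsLfdMod k (Y i)) : IsLfdMod k (⨁ Y) := by
  have := Fintype.ofFinite ι
  refine IsLfdMod.of_jointly_injective hY (fun i => biproduct.π Y i) fun a x y h => ?_
  have key : ∀ z : (⨁ Y).obj a,
      z = ∑ i, (biproduct.ι Y i).app a ((biproduct.π Y i).app a z) := fun z => by
    have h1 : ∑ i, biproduct.π Y i ≫ biproduct.ι Y i = 𝟙 _ := biproduct.total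
    have h2 := congrArg (fun t : ⨁ Y ⟶ ⨁ Y => t.app a z) h1
    exact h2.symm.trans (app_sum_apply _ _ _)
  rw [key x, key y]
  exact Finset.sum_congr rfl fun i _ => by rw [h i]

lemma IsLfdMod.biprod {X Y : A ⥤ ModuleCat.{0} k} (hX : IsLfdMod k X) (hY : IsLfdMod k Y) :
    IsLfdMod k (X ⊞ Y) := by
  refine IsLfdMod.of_jointly_injective (ι := Bool) (Y := fun b => cond b X Y)
    (by rintro (_ | _) <;> assumption)
    (fun b => match b with | true => biprod.fst | false => biprod.snd) fun a x y h => ?_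
  have key : ∀ z : (X ⊞ Y).obj a,
      z = (biprod.inl : X ⟶ X ⊞ Y).app a ((biprod.fst : X ⊞ Y ⟶ X).app a z) +
        (biprod.inr : Y ⟶ X ⊞ Y).app a ((biprod.snd : X ⊞ Y ⟶ Y).app a z) := fun z => by
    have h1 : biprod.fst ≫ biprod.inl + biprod.snd ≫ biprod.inr = 𝟙 (X ⊞ Y) := biprod.total
    exact (congrArg (fun t : X ⊞ Y ⟶ X ⊞ Y => t.app a z) h1).symm
  rw [key x, key y]
  exact congrArg₂ _ (congrArg _ (h true)) (congrArg _ (h false))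

section Yoneda

/-- The morphism `P_c ⟶ X` given by an element of `X(c)`. -/
noncomputable def fromProj {X : A ⥤ ModuleCat.{0} k} (hX : IsMod k X) {c : A} (x : X.obj c) :
    ProjAt k c ⟶ X where
  app d := ModuleCat.ofHom (X := c ⟶ d)
    { toFun := fun h => X.map h x
      map_add' := fun f g => hX.map_add_apply f g x
      map_smul' := fun r f => hX.map_smul_apply r f x }
  naturality d e f := by
    ext (h : c ⟶ d)
    change X.map (h ≫ f) x = X.map f (X.map h x)
    simp

/-- The generator of `P_c`. -/
def projOne (k : Type) [Field k] {A : Type} [Category.{0} A] [Preadditive A]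
    [CategoryTheory.Linear k A] (c : A) : (ProjAt k c).obj c := (𝟙 c : c ⟶ c)

lemma fromProj_projOne {X : A ⥤ ModuleCat.{0} k} (hX : IsMod k X) {c : A} (x : X.obj c) :
    (fromProj hX x).app c (projOne k c) = x := by
  change X.map (𝟙 c) x = x
  simp

lemma fromProj_eq {X : A ⥤ ModuleCat.{0} k} (hX : IsMod k X) {c : A} (t : ProjAt k c ⟶ X) :
    fromProj hX (t.app c (projOne k c)) = t := by
  refine hom_ext_apply fun d h => ?_
  change X.map h (t.app c (projOne k c)) = t.app d h
  refine (naturality_apply' t (a := c) (h : c ⟶ d) (projOne k c)).symm.trans ?_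
  exact congrArg (t.app d) (Category.id_comp (h : c ⟶ d))

/-- The morphism `X ⟶ I_c` given by a linear form on `X(c)`. -/
noncomputable def toInj {X : A ⥤ ModuleCat.{0} k} (hX : IsMod k X) {c : A}
    (ξ : Module.Dual k (X.obj c)) : X ⟶ InjAt k c where
  app d := ModuleCat.ofHom (Y := Module.Dual k (d ⟶ c))
    { toFun := fun x =>
        { toFun := fun h => ξ (X.map h x)
          map_add' := fun f g => by rw [hX.map_add_apply, map_add]
          map_smul' := fun r f => by rw [hX.map_smul_apply, map_smul]; rfl }
      map_add' := fun x y => by ext h; simp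
      map_smul' := fun r x => by ext h; simp }
  naturality d e f := by
    ext x
    refine LinearMap.ext fun (h : e ⟶ c) => ?_
    change ξ (X.map h (X.map f x)) = ξ (X.map (f ≫ h) x)
    simp

/-- Evaluation at the identity, a linear form on `I_c(c)`. -/
def injEval (k : Type) [Field k] {A : Type} [Category.{0} A] [Preadditive A]
    [CategoryTheory.Linear k A] (c : A) : (InjAt k c).obj c →ₗ[k] k :=
  LinearMap.applyₗ (M := c ⟶ c) (𝟙 c)

lemma injEval_toInj {X : A ⥤ ModuleCat.{0} k} (hX : IsMod k X) {c : A}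
    (ξ : Module.Dual k (X.obj c)) (x : X.obj c) :
    injEval k c ((toInj hX ξ).app c x) = ξ x := by
  change ξ (X.map (𝟙 c) x) = ξ x
  simp

lemma injAt_ext {X : A ⥤ ModuleCat.{0} k} {c : A} {u v : X ⟶ InjAt k c}
    (h : ∀ x : X.obj c, injEval k c (u.app c x) = injEval k c (v.app c x)) : u = v := by
  have key : ∀ (w : X ⟶ InjAt k c) (d : A) (x : X.obj d) (g : d ⟶ c),
      (show Module.Dual k (d ⟶ c) from w.app d x) g = injEval k c (w.app c (X.map g x)) := by
    intro w d x g
    rw [naturality_apply']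
    change _ = (show Module.Dual k (d ⟶ c) from w.app d x) (g ≫ 𝟙 c)
    rw [Category.comp_id]
  refine hom_ext_apply fun d x => ?_
  refine LinearMap.ext fun (g : d ⟶ c) => ?_
  exact (key u d x g).trans ((h _).trans (key v d x g).symm)

lemma projAt_isLfdMod [Spectroid k A] (c : A) : IsLfdMod k (ProjAt k c) := by
  refine ⟨⟨fun {a b} f g => ?_, fun {a b} r f => ?_⟩, fun a => Spectroid.homFinite c a⟩
  · ext (h : c ⟶ a)
    exact Preadditive.comp_add _ _ _ h f g
  · ext (h : c ⟶ a)
    exact Linear.comp_smul _ _ _ h r f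

lemma injAt_isLfdMod [Spectroid k A] (c : A) : IsLfdMod k (InjAt k c) := by
  refine ⟨⟨fun {a b} f g => ?_, fun {a b} r f => ?_⟩, fun a => ?_⟩
  · ext (h : Module.Dual k (a ⟶ c))
    refine LinearMap.ext fun (x : b ⟶ c) => ?_
    change h ((f + g) ≫ x) = h (f ≫ x) + h (g ≫ x)
    rw [Preadditive.add_comp, map_add]
  · ext (h : Module.Dual k (a ⟶ c))
    refine LinearMap.ext fun (x : b ⟶ c) => ?_
    change h ((r • f) ≫ x) = r • h (f ≫ x)
    rw [Linear.smul_comp, map_smul]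
  · have : FiniteDimensional k (a ⟶ c) := Spectroid.homFinite a c
    exact inferInstanceAs (FiniteDimensional k (Module.Dual k (a ⟶ c)))

end Yoneda

section Duality

variable {ι : Type} [Fintype ι]

/-- The finitely generated projective module `⊕ P_{b_i}`. -/
noncomputable abbrev ProjSum (k : Type) [Field k] {A : Type} [Category.{0} A] [Preadditive A]
    [CategoryTheory.Linear k A] {ι : Type} [Fintype ι] (b : ι → A) : A ⥤ ModuleCat.{0} k :=
  ⨁ fun i => ProjAt k (b i)

/-- The finitely co-generated injective module `⊕ I_{b_i}`. -/
noncomputable abbrev InjSum (k : Type) [Field k] {A : Type} [Category.{0} A] [Preadditive A]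
    [CategoryTheory.Linear k A] {ι : Type} [Fintype ι] (b : ι → A) : A ⥤ ModuleCat.{0} k :=
  ⨁ fun i => InjAt k (b i)

lemma projSum_isLfdMod [Spectroid k A] (b : ι → A) : IsLfdMod k (ProjSum k b) :=
  IsLfdMod.biproduct fun _ => projAt_isLfdMod _

lemma injSum_isLfdMod [Spectroid k A] (b : ι → A) : IsLfdMod k (InjSum k b) :=
  IsLfdMod.biproduct fun _ => injAt_isLfdMod _

/-- The generators of `⊕ P_{b_i}`. -/
noncomputable def projSumOne (b : ι → A) (i : ι) : (ProjSum k b).obj (b i) :=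
  (biproduct.ι (fun i => ProjAt k (b i)) i).app (b i) (projOne k (b i))

/-- The trace form on `Hom(⊕ P_{b_i}, ⊕ I_{b_i})`. -/
noncomputable def traceForm (b : ι → A) : (ProjSum k b ⟶ InjSum k b) →ₗ[k] k where
  toFun T := ∑ i, injEval k (b i)
    ((biproduct.π (fun i => InjAt k (b i)) i).app (b i) (T.app (b i) (projSumOne b i)))
  map_add' S T := by
    rw [← Finset.sum_add_distrib]
    refine Finset.sum_congr rfl fun i _ => ?_
    rw [← map_add, ← map_add]
    rfl
  map_smul' r T := by
    rw [RingHom.id_apply, Finset.smul_sum]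
    refine Finset.sum_congr rfl fun i _ => ?_
    rw [← map_smul, ← map_smul]
    rfl

lemma projSum_hom_ext {b : ι → A} {X : A ⥤ ModuleCat.{0} k} (hX : IsMod k X)
    {s t : ProjSum k b ⟶ X}
    (h : ∀ i, s.app (b i) (projSumOne b i) = t.app (b i) (projSumOne b i)) : s = t := by
  refine biproduct.hom_ext' _ _ fun i => ?_
  rw [← fromProj_eq hX (biproduct.ι (fun i => ProjAt k (b i)) i ≫ s),
    ← fromProj_eq hX (biproduct.ι (fun i => ProjAt k (b i)) i ≫ t)]
  exact congrArg _ (h i)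

lemma finiteDimensional_projSum_hom (b : ι → A) {X : A ⥤ ModuleCat.{0} k} (hX : IsLfdMod k X) :
    FiniteDimensional k (ProjSum k b ⟶ X) := by
  have := fun i => hX.2 (b i)
  let ev : (ProjSum k b ⟶ X) →ₗ[k] ∀ i, X.obj (b i) :=
    { toFun := fun t i => t.app (b i) (projSumOne b i)
      map_add' := fun _ _ => rfl
      map_smul' := fun _ _ => rfl }
  exact FiniteDimensional.of_injective ev fun s t h => projSum_hom_ext hX.1 (congrFun h)

/-- The composite `⊕ P_{b_i} ⟶ P_{b_j} ⟶ X`, depending linearly on an element of `X(b_j)`. -/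
noncomputable def projSumSingle (b : ι → A) {X : A ⥤ ModuleCat.{0} k} (hX : IsMod k X) (i : ι) :
    X.obj (b i) →ₗ[k] (ProjSum k b ⟶ X) where
  toFun x := biproduct.π _ i ≫ fromProj hX x
  map_add' x y := by
    rw [← Preadditive.comp_add]
    congr 1
    refine hom_ext_apply fun d h => ?_
    exact map_add (X.map (X := b i) h).hom x y
  map_smul' r x := by
    rw [RingHom.id_apply, ← Linear.comp_smul]
    congr 1
    refine hom_ext_apply fun d h => ?_
    exact map_smul (X.map (X := b i) h).hom r x

lemma sum_projSumSingle (b : ι → A) {X : A ⥤ ModuleCat.{0} k} (hX : IsMod k X)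
    (t : ProjSum k b ⟶ X) :
    ∑ i, projSumSingle b hX i (t.app (b i) (projSumOne b i)) = t := by
  have h : ∀ i, projSumSingle b hX i (t.app (b i) (projSumOne b i)) =
      (biproduct.π (fun i => ProjAt k (b i)) i ≫ biproduct.ι (fun i => ProjAt k (b i)) i) ≫ t :=
    fun i => by
      rw [Category.assoc, ← fromProj_eq hX (biproduct.ι (fun i => ProjAt k (b i)) i ≫ t)]
      rfl
  rw [Finset.sum_congr rfl fun i _ => h i, ← Preadditive.sum_comp, biproduct.total,
    Category.id_comp]

lemma exists_traceForm_eq (b : ι → A) {X : A ⥤ ModuleCat.{0} k} (hX : IsMod k X)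
    (φ : Module.Dual k (ProjSum k b ⟶ X)) :
    ∃ ψ : X ⟶ InjSum k b, ∀ t : ProjSum k b ⟶ X, traceForm b (t ≫ ψ) = φ t := by
  refine ⟨biproduct.lift fun i => toInj hX (φ ∘ₗ projSumSingle b hX i), fun t => ?_⟩
  conv_rhs => rw [← sum_projSumSingle b hX t, map_sum]
  refine Finset.sum_congr rfl fun i _ => ?_
  rw [← LinearMap.comp_apply φ, ← injEval_toInj hX (φ ∘ₗ projSumSingle b hX i)]
  congr 1
  exact congrArg (fun u : X ⟶ InjAt k (b i) => u.app (b i) (t.app (b i) (projSumOne b i)))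
    (biproduct.lift_π (fun i => toInj hX (φ ∘ₗ projSumSingle b hX i)) i)

lemma eq_of_traceForm_eq (b : ι → A) {X : A ⥤ ModuleCat.{0} k} (hX : IsMod k X)
    {ψ χ : X ⟶ InjSum k b}
    (h : ∀ t : ProjSum k b ⟶ X, traceForm b (t ≫ ψ) = traceForm b (t ≫ χ)) : ψ = χ := by
  classical
  have key : ∀ (ψ : X ⟶ InjSum k b) (i : ι) (x : X.obj (b i)),
      traceForm b (projSumSingle b hX i x ≫ ψ) =
        injEval k (b i) ((ψ ≫ biproduct.π (fun i => InjAt k (b i)) i).app (b i) x) := by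
    intro ψ i x
    have h1 : ∀ j, (projSumSingle b hX i x).app (b j) (projSumOne b j) =
        ((biproduct.ι (fun i => ProjAt k (b i)) j ≫ biproduct.π (fun i => ProjAt k (b i)) i) ≫
          fromProj hX x).app (b j) (projOne k (b j)) := fun j => rfl
    refine (Finset.sum_eq_single i (fun j _ hj => ?_) (by simp)).trans ?_
    · have h2 : (projSumSingle b hX i x).app (b j) (projSumOne b j) = 0 := by
        rw [h1, biproduct.ι_π_ne _ hj, zero_comp]; rfl
      change injEval k (b j) ((biproduct.π (fun i => InjAt k (b i)) j).app (b j)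
        (ψ.app (b j) ((projSumSingle b hX i x).app (b j) (projSumOne b j)))) = 0
      rw [h2, map_zero, map_zero, map_zero]
    · have h2 : (projSumSingle b hX i x).app (b i) (projSumOne b i) = x := by
        rw [h1, biproduct.ι_π_self, Category.id_comp, fromProj_projOne]
      change injEval k (b i) ((biproduct.π (fun i => InjAt k (b i)) i).app (b i)
        (ψ.app (b i) ((projSumSingle b hX i x).app (b i) (projSumOne b i)))) = _
      rw [h2]; rfl
  refine biproduct.hom_ext _ _ fun i => injAt_ext fun x => ?_
  rw [← key, ← key, h]

lemma injInMod_injSum (b : ι → A) : InjInMod k (InjSum k b) := by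
  intro X Y hX hY m _ u
  obtain ⟨φ, hφ⟩ := LinearMap.exists_leftInverse_of_injective
    (Linear.rightComp k (ProjSum k b) m) (LinearMap.ker_eq_bot.2 fun s t h =>
      (cancel_mono m).1 h)
  obtain ⟨v, hv⟩ := exists_traceForm_eq b hY.1
    (traceForm b ∘ₗ Linear.rightComp k (ProjSum k b) u ∘ₗ φ)
  refine ⟨v, eq_of_traceForm_eq b hX.1 fun t => ?_⟩
  rw [← Category.assoc, hv]
  exact congrArg (fun s => traceForm b (s ≫ u)) (LinearMap.congr_fun hφ t)

lemma projInMod_projAt (c : A) : ProjInMod k (ProjAt k c) := by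
  intro X Y hX hY e _ u
  obtain ⟨x, hx⟩ := app_surjective_of_epi e c (u.app c (projOne k c))
  refine ⟨fromProj hX.1 x, ?_⟩
  rw [← fromProj_eq hY.1 (fromProj hX.1 x ≫ e), ← fromProj_eq hY.1 u, ← hx]
  exact congrArg (fun z => fromProj hY.1 (e.app c z)) (fromProj_projOne hX.1 x)

lemma projInMod_projSum (b : ι → A) : ProjInMod k (ProjSum k b) := by
  intro X Y hX hY e he u
  choose t ht using fun i => projInMod_projAt (b i) hX hY e he
    (biproduct.ι (fun i => ProjAt k (b i)) i ≫ u)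
  refine ⟨biproduct.desc t, biproduct.hom_ext' _ _ fun i => ?_⟩
  rw [← ht i, biproduct.ι_desc_assoc]

/-- The trace forms make the Nakayama correspondence between maps of projectives and maps
of injectives an adjunction formula. -/
lemma exists_transpose {κ : Type} [Fintype κ] [Spectroid k A] {a : κ → A} {b : ι → A}
    (d : InjSum k a ⟶ InjSum k b) : ∃ δ : ProjSum k a ⟶ ProjSum k b,
    ∀ T : ProjSum k b ⟶ InjSum k a, traceForm b (T ≫ d) = traceForm a (δ ≫ T) := by
  have := finiteDimensional_projSum_hom a (projSum_isLfdMod (k := k) b)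
  let Φ : (ProjSum k b ⟶ InjSum k a) →ₗ[k] Module.Dual k (ProjSum k a ⟶ ProjSum k b) :=
    { toFun := fun T => traceForm a ∘ₗ Linear.rightComp k _ T
      map_add' := fun S T => by ext t; simp
      map_smul' := fun r T => by ext t; simp }
  have hΦ : Function.Injective Φ := fun S T h =>
    eq_of_traceForm_eq a (projSum_isLfdMod b).1 fun t => LinearMap.congr_fun h t
  obtain ⟨Ψ, hΨ⟩ := LinearMap.exists_leftInverse_of_injective Φ (LinearMap.ker_eq_bot.2 hΦ)
  obtain ⟨δ, hδ⟩ := (Module.evalEquiv k (ProjSum k a ⟶ ProjSum k b)).surjective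
    (traceForm b ∘ₗ Linear.rightComp k _ d ∘ₗ Ψ)
  refine ⟨δ, fun T => ?_⟩
  have h := LinearMap.congr_fun hδ (Φ T)
  have h2 : Ψ (Φ T) = T := LinearMap.congr_fun hΨ T
  simp only [LinearMap.comp_apply, h2] at h
  exact h.symm

lemma exists_transpose' {κ : Type} [Fintype κ] [Spectroid k A] {a : κ → A} {b : ι → A}
    (ρ : ProjSum k b ⟶ ProjSum k a) : ∃ r : InjSum k b ⟶ InjSum k a,
    ∀ T : ProjSum k a ⟶ InjSum k b, traceForm a (T ≫ r) = traceForm b (ρ ≫ T) :=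
  exists_traceForm_eq a (injSum_isLfdMod b).1 (traceForm b ∘ₗ Linear.leftComp k _ ρ)

end Duality

section Idempotents

/-- The Fitting lemma for locally finite-dimensional modules. -/
lemma isIso_or_isIso_one_sub {X : A ⥤ ModuleCat.{0} k} (hX : IsLfdMod k X)
    (h : ∀ e : X ⟶ X, e ≫ e = e → e = 0 ∨ e = 𝟙 X) (φ : X ⟶ X) :
    IsIso φ ∨ IsIso (𝟙 X - φ) := by
  have := hX.2
  let F : ∀ a, X.obj a →ₗ[k] X.obj a := fun a => (φ.app a).hom
  let K : ∀ a, Submodule k (X.obj a) := fun a => ⨆ n, LinearMap.ker (F a ^ n)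
  let R : ∀ a, Submodule k (X.obj a) := fun a => ⨅ n, LinearMap.range (F a ^ n)
  have hc : ∀ a, IsCompl (R a) (K a) := fun a =>
    ((F a).isCompl_iSup_ker_pow_iInf_range_pow).symm
  have hnat : ∀ {a b : A} (f : a ⟶ b) (n : ℕ) (x : X.obj a),
      (F b ^ n) (X.map f x) = X.map f ((F a ^ n) x) := by
    intro a b f n
    induction n with
    | zero => intro x; rfl
    | succ n ih =>
      intro x
      rw [pow_succ, pow_succ, Module.End.mul_apply, Module.End.mul_apply, ← ih]
      exact congrArg _ (naturality_apply' φ f x)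
  have hmemK : ∀ a (x : X.obj a), x ∈ K a ↔ ∃ n, (F a ^ n) x = 0 := fun a x => by
    change x ∈ ⨆ n, LinearMap.ker (F a ^ n) ↔ _
    rw [Submodule.mem_iSup_of_directed]
    · rfl
    · refine Monotone.directed_le fun m n hmn y hy => ?_
      obtain ⟨l, rfl⟩ := Nat.exists_eq_add_of_le' hmn
      rw [LinearMap.mem_ker] at hy ⊢
      rw [pow_add, Module.End.mul_apply, hy, map_zero]
  have hK : ∀ {a b : A} (f : a ⟶ b) (x : X.obj a), x ∈ K a → X.map f x ∈ K b := by
    intro a b f x hx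
    obtain ⟨n, hn⟩ := (hmemK a x).1 hx
    exact (hmemK b _).2 ⟨n, by rw [hnat, hn, map_zero]⟩
  have hR : ∀ {a b : A} (f : a ⟶ b) (x : X.obj a), x ∈ R a → X.map f x ∈ R b := by
    intro a b f x hx
    refine (Submodule.mem_iInf _).2 fun n => ?_
    obtain ⟨y, rfl⟩ := (Submodule.mem_iInf _).1 hx n
    exact ⟨X.map f y, hnat f n y⟩
  let e : X ⟶ X :=
    { app := fun a => ModuleCat.ofHom ((R a).projection (K a) (hc a))
      naturality := fun a b f => by
        ext x
        change (R b).projection (K b) (hc b) (X.map f x) =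
          X.map f ((R a).projection (K a) (hc a) x)
        obtain ⟨u, v, rfl, -⟩ := Submodule.existsUnique_add_of_isCompl (hc a) x
        rw [map_add, map_add, map_add,
          Submodule.projection_apply_of_mem_left _ u.2,
          Submodule.projection_apply_of_mem_left _ (hR f _ u.2),
          (Submodule.projection_apply_eq_zero_iff _).2 v.2,
          (Submodule.projection_apply_eq_zero_iff _).2 (hK f _ v.2), map_add, map_zero] }
  have he : e ≫ e = e := hom_ext_apply fun a x =>
    LinearMap.congr_fun (Submodule.isIdempotentElem_projection (hc a)) x
  have hfd : ∀ (g : X ⟶ X), (∀ a (x : X.obj a), g.app a x = 0 → x = 0) → IsIso g := by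
    intro g hg
    refine isIso_of_app_bijective g fun a => ?_
    have hi : Function.Injective (g.app a).hom :=
      (injective_iff_map_eq_zero (g.app a).hom).2 (hg a)
    exact ⟨hi, LinearMap.injective_iff_surjective.1 hi⟩
  rcases h e he with h0 | h1
  · right
    refine hfd _ fun a x hx => ?_
    have hx' : F a x = x := (sub_eq_zero.1 hx).symm
    have hxK : x ∈ K a := (Submodule.projection_apply_eq_zero_iff (hc a)).1
      (congrArg (fun t : X ⟶ X => t.app a x) h0)
    obtain ⟨n, hn⟩ := (hmemK a x).1 hxK
    have : ∀ n, (F a ^ n) x = x := fun n => by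
      induction n with
      | zero => rfl
      | succ n ih => rw [pow_succ, Module.End.mul_apply, hx', ih]
    rw [← this n, hn]
  · left
    refine hfd _ fun a x hx => ?_
    have hxK : x ∈ K a := (hmemK a x).2 ⟨1, by rw [pow_one]; exact hx⟩
    have h2 : (R a).projection (K a) (hc a) x = x :=
      congrArg (fun t : X ⟶ X => t.app a x) h1
    rw [← h2]
    exact (Submodule.projection_apply_eq_zero_iff (hc a)).2 hxK

lemma Indec.eq_zero_or_eq_one {X : A ⥤ ModuleCat.{0} k} (hX : IsLfdMod k X) (h : Indec k X)
    (e : X ⟶ X) (he : e ≫ e = e) : e = 0 ∨ e = 𝟙 X := by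
  obtain ⟨Y, i, p, hip, hpi⟩ := IsIdempotentComplete.idempotents_split X e he
  obtain ⟨Z, j, q, hjq, hqj⟩ := IsIdempotentComplete.idempotents_split X (𝟙 X - e)
    (by simp [he])
  have hi : IsSplitMono i := ⟨⟨⟨p, hip⟩⟩⟩
  have hj : IsSplitMono j := ⟨⟨⟨q, hjq⟩⟩⟩
  have hq : IsSplitEpi q := ⟨⟨⟨j, hjq⟩⟩⟩
  have hp : IsSplitEpi p := ⟨⟨⟨i, hip⟩⟩⟩
  have h1 : i ≫ q = 0 := by
    rw [← cancel_mono j, Category.assoc, hqj, ← hpi, Preadditive.comp_sub, ← Category.assoc i p,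
      hip]
    simp
  have h2 : j ≫ p = 0 := by
    rw [← cancel_mono i, Category.assoc, hpi, ← sub_sub_cancel (𝟙 X) e, ← hqj,
      Preadditive.comp_sub, ← Category.assoc j q, hjq]
    simp
  let c : BinaryBicone Y Z :=
    { pt := X, fst := p, snd := q, inl := i, inr := j
      inl_fst := hip, inl_snd := h1, inr_fst := h2, inr_snd := hjq }
  have hc : c.IsBilimit := isBinaryBilimitOfTotal c (by
    change p ≫ i + q ≫ j = 𝟙 X
    rw [hpi, hqj]; abel)
  rcases h.2 (hX.of_mono i) (hX.of_mono j) (biprod.uniqueUpToIso Y Z hc) with hz | hz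
  · left
    rw [← hpi, hz.eq_of_tgt p 0, zero_comp]
  · right
    have := hqj
    rw [hz.eq_of_tgt q 0, zero_comp] at this
    exact (sub_eq_zero.1 this.symm).symm

lemma ProjInMod.retract {X Y : A ⥤ ModuleCat.{0} k} (hY : ProjInMod k Y) (s : X ⟶ Y) (r : Y ⟶ X)
    (h : s ≫ r = 𝟙 X) : ProjInMod k X := by
  intro V W hV hW e he u
  obtain ⟨t, ht⟩ := hY hV hW e he (r ≫ u)
  exact ⟨s ≫ t, by rw [Category.assoc, ht, ← Category.assoc, h, Category.id_comp]⟩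

lemma InjInMod.retract {X Y : A ⥤ ModuleCat.{0} k} (hY : InjInMod k Y) (s : X ⟶ Y) (r : Y ⟶ X)
    (h : s ≫ r = 𝟙 X) : InjInMod k X := by
  intro V W hV hW e he u
  obtain ⟨t, ht⟩ := hY hV hW e he (u ≫ s)
  exact ⟨t ≫ r, by rw [← Category.assoc, ht, Category.assoc, h, Category.comp_id]⟩

/-- A finitely generated module which is not projective has a non-projective direct summand
with only trivial idempotent endomorphisms. -/
lemma exists_nonproj_summand {ι : Type} [Fintype ι] (b : ι → A) {N : A ⥤ ModuleCat.{0} k}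
    (hN : IsLfdMod k N) (p : ProjSum k b ⟶ N) [Epi p] (hproj : ¬ ProjInMod k N) :
    ∃ (X : A ⥤ ModuleCat.{0} k) (s : X ⟶ N) (r : N ⟶ X), s ≫ r = 𝟙 X ∧ ¬ ProjInMod k X ∧
      ∀ e : X ⟶ X, e ≫ e = e → e = 0 ∨ e = 𝟙 X := by
  suffices H : ∀ (n : ℕ) (X : A ⥤ ModuleCat.{0} k) (s : X ⟶ N) (r : N ⟶ X), s ≫ r = 𝟙 X →
      ¬ ProjInMod k X → Module.finrank k (ProjSum k b ⟶ X) = n →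
      ∃ (X : A ⥤ ModuleCat.{0} k) (s : X ⟶ N) (r : N ⟶ X), s ≫ r = 𝟙 X ∧ ¬ ProjInMod k X ∧
        ∀ e : X ⟶ X, e ≫ e = e → e = 0 ∨ e = 𝟙 X from
    H _ N (𝟙 N) (𝟙 N) (Category.comp_id _) hproj rfl
  intro n
  induction n using Nat.strong_induction_on with
  | h n ih =>
    intro X s r hsr hX hn
    by_cases hid : ∀ e : X ⟶ X, e ≫ e = e → e = 0 ∨ e = 𝟙 X
    · exact ⟨X, s, r, hsr, hX, hid⟩
    have hr : IsSplitEpi r := ⟨⟨⟨s, hsr⟩⟩⟩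
    have hXl : IsLfdMod k X := hN.of_epi r
    have key : ∀ e : X ⟶ X, e ≠ 𝟙 X → ∀ (Y : A ⥤ ModuleCat.{0} k) (i : Y ⟶ X) (q : X ⟶ Y),
        i ≫ q = 𝟙 Y → q ≫ i = e → ¬ ProjInMod k Y →
        ∃ (X : A ⥤ ModuleCat.{0} k) (s : X ⟶ N) (r : N ⟶ X), s ≫ r = 𝟙 X ∧ ¬ ProjInMod k X ∧
          ∀ e : X ⟶ X, e ≫ e = e → e = 0 ∨ e = 𝟙 X := by
      intro e he Y i q hiq hqi hY
      have hi : IsSplitMono i := ⟨⟨⟨q, hiq⟩⟩⟩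
      refine ih (Module.finrank k (ProjSum k b ⟶ Y)) ?_ Y (i ≫ s) (r ≫ q) ?_ hY rfl
      · have := finiteDimensional_projSum_hom b hXl
        rw [← hn, ← LinearMap.finrank_range_of_inj (f := Linear.rightComp k (ProjSum k b) i)
          fun u v h => (cancel_mono i).1 h]
        refine Submodule.finrank_lt fun htop => he ?_
        obtain ⟨t, ht⟩ := LinearMap.range_eq_top.1 htop (p ≫ r)
        have ht' : t ≫ i = p ≫ r := ht
        rw [← cancel_epi r, ← cancel_epi p, ← hqi, Category.comp_id]
        rw [← Category.assoc, ← Category.assoc, ← ht', Category.assoc t, Category.assoc,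
          hiq, Category.id_comp]
      · rw [Category.assoc, ← Category.assoc s, hsr, Category.id_comp, hiq]
    push Not at hid
    obtain ⟨e, he, he0, he1⟩ := hid
    obtain ⟨Y, i, q, hiq, hqi⟩ := IsIdempotentComplete.idempotents_split X e he
    obtain ⟨Z, j, q', hjq, hqj⟩ := IsIdempotentComplete.idempotents_split X (𝟙 X - e)
      (by simp [he])
    by_cases hY : ProjInMod k Y
    · by_cases hZ : ProjInMod k Z
      · refine absurd (fun V W hV hW f hf u => ?_) hX
        obtain ⟨t, ht⟩ := hY hV hW f hf (i ≫ u)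
        obtain ⟨t', ht'⟩ := hZ hV hW f hf (j ≫ u)
        refine ⟨q ≫ t + q' ≫ t', ?_⟩
        rw [Preadditive.add_comp, Category.assoc, Category.assoc, ht, ht', ← Category.assoc,
          ← Category.assoc, hqi, hqj, ← Preadditive.add_comp]
        simp
      · exact key (𝟙 X - e) (fun h => he0 (sub_eq_self.1 h)) Z j q' hjq hqj hZ
    · exact key e he1 Y i q hiq hqi hY

end Idempotents

section Existence

/-- A non-split extension of modules by a module with local endomorphism ring is almost split
as soon as it is almost split on the right. -/
lemma AlmostSplitSeq.of_right {L M N : A ⥤ ModuleCat.{0} k} (hM : IsLfdMod k M)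
    (hL : ∀ θ : L ⟶ L, IsIso θ ∨ IsIso (𝟙 L - θ)) (f : L ⟶ M) (g : M ⟶ N) (zero : f ≫ g = 0)
    [Mono f] [Epi g] (exact : (ShortComplex.mk f g zero).Exact) (hg : ¬ IsSplitEpi g)
    (hright : ∀ ⦃X : A ⥤ ModuleCat.{0} k⦄, IsLfdMod k X →
      ∀ u : X ⟶ N, ¬ IsSplitEpi u → ∃ v : X ⟶ M, v ≫ g = u) :
    AlmostSplitSeq k f g := by
  have : Mono (ShortComplex.mk f g zero).f := ‹Mono f›
  have : Epi (ShortComplex.mk f g zero).g := ‹Epi g›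
  have lift : ∀ {X : A ⥤ ModuleCat.{0} k} (u : X ⟶ M), u ≫ g = 0 → ∃ v : X ⟶ L, v ≫ f = u :=
    fun u hu => ⟨exact.lift u hu, exact.lift_f u hu⟩
  have desc : ∀ {X : A ⥤ ModuleCat.{0} k} (u : M ⟶ X), f ≫ u = 0 → ∃ v : N ⟶ X, g ≫ v = u :=
    fun u hu => ⟨exact.desc u hu, exact.g_desc u hu⟩
  have hf : ¬ IsSplitMono f := by
    rintro ⟨⟨⟨r, hr⟩⟩⟩
    obtain ⟨σ, hσ⟩ := desc (𝟙 M - r ≫ f) (by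
      rw [Preadditive.comp_sub, ← Category.assoc, hr, Category.comp_id, Category.id_comp,
        sub_self])
    refine hg ⟨⟨⟨σ, ?_⟩⟩⟩
    rw [← cancel_epi g, ← Category.assoc, hσ, Preadditive.sub_comp, Category.assoc, zero,
      comp_zero, sub_zero, Category.id_comp, Category.comp_id]
  refine ⟨‹_›, ‹_›, zero, exact, hf, hg, fun X hX u hu => ?_, hright⟩
  let inl : M ⟶ pushout f u := pushout.inl f u
  let inr : X ⟶ pushout f u := pushout.inr f u
  have hcond : f ≫ inl = u ≫ inr := pushout.condition
  have hmono : Mono inr := inferInstance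
  let h : pushout f u ⟶ N := pushout.desc g 0 (by rw [zero, comp_zero])
  have hl : inl ≫ h = g := pushout.inl_desc _ _ _
  have hr : inr ≫ h = 0 := pushout.inr_desc _ _ _
  have hpush : ∀ {Z : A ⥤ ModuleCat.{0} k} (v w : pushout f u ⟶ Z), inl ≫ v = inl ≫ w →
      inr ≫ v = inr ≫ w → v = w := fun v w h1 h2 => pushout.hom_ext h1 h2
  have hepi : Epi (biprod.desc inl inr) := ⟨fun v w hvw => by
    refine hpush v w ?_ ?_
    · simpa using congrArg (fun t => biprod.inl ≫ t) hvw
    · simpa using congrArg (fun t => biprod.inr ≫ t) hvw⟩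
  have hY : IsLfdMod k (pushout f u) := (hM.biprod hX).of_epi (biprod.desc inl inr)
  by_cases hs : IsSplitEpi h
  · obtain ⟨⟨⟨σ, hσ⟩⟩⟩ := hs
    have hepi : Epi h := epi_of_epi_fac hl
    have hcok : IsColimit (CokernelCofork.ofπ h hr) :=
      CokernelCofork.IsColimit.ofπ' h hr fun {Z} v hv => by
        have h1 : f ≫ inl ≫ v = 0 := by
          rw [← Category.assoc, hcond, Category.assoc, hv, comp_zero]
        refine ⟨exact.desc (inl ≫ v) h1, hpush _ _ ?_ ?_⟩
        · rw [← Category.assoc, hl]; exact exact.g_desc _ h1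
        · rw [← Category.assoc, hr, hv, zero_comp]
    have hker := Abelian.monoIsKernelOfCokernel _ hcok
    obtain ⟨κ, hκ⟩ := KernelFork.IsLimit.lift' hker (𝟙 _ - h ≫ σ) (by
      change (𝟙 _ - h ≫ σ) ≫ h = 0
      rw [Preadditive.sub_comp, Category.assoc, hσ, Category.comp_id, Category.id_comp, sub_self])
    have hκ' : κ ≫ inr = 𝟙 _ - h ≫ σ := hκ
    have h1 : inr ≫ κ = 𝟙 X := by
      rw [← cancel_mono inr, Category.assoc, hκ', Preadditive.comp_sub, ← Category.assoc, hr,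
        zero_comp, sub_zero, Category.comp_id, Category.id_comp]
    exact ⟨inl ≫ κ, by rw [← Category.assoc, hcond, Category.assoc, h1, Category.comp_id]⟩
  · exfalso
    obtain ⟨v, hv⟩ := hright hY h hs
    obtain ⟨w, hw⟩ := lift (inr ≫ v) (by rw [Category.assoc, hv, hr])
    have h1 : f ≫ inl ≫ v = (u ≫ w) ≫ f := by
      rw [← Category.assoc, hcond, Category.assoc, ← hw, Category.assoc]
    rcases hL (u ≫ w) with hi | hi
    · exact hu ⟨⟨⟨w ≫ inv (u ≫ w), by rw [← Category.assoc, IsIso.hom_inv_id]⟩⟩⟩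
    · obtain ⟨κ, hκ⟩ := lift (𝟙 M - inl ≫ v) (by
        rw [Preadditive.sub_comp, Category.assoc, hv, hl, Category.id_comp, sub_self])
      have h2 : f ≫ κ = 𝟙 L - u ≫ w := by
        rw [← cancel_mono f, Category.assoc, hκ, Preadditive.comp_sub, h1, Preadditive.sub_comp,
          Category.comp_id, Category.id_comp]
      exact hf ⟨⟨⟨κ ≫ inv (𝟙 L - u ≫ w), by
        rw [← Category.assoc, h2, IsIso.hom_inv_id]⟩⟩⟩

lemma exists_dual_comp_eq {V W : Type} [AddCommGroup V] [Module k V] [AddCommGroup W] [Module k W]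
    (f : V →ₗ[k] W) (φ : V →ₗ[k] k) (h : LinearMap.ker f ≤ LinearMap.ker φ) :
    ∃ χ : W →ₗ[k] k, χ ∘ₗ f = φ := by
  have h1 : φ ∈ (LinearMap.ker f).dualAnnihilator :=
    (Submodule.mem_dualAnnihilator _).2 fun v hv => h hv
  rw [← LinearMap.range_dualMap_eq_dualAnnihilator_ker] at h1
  exact h1

variable {ι κ : Type} [Fintype ι] [Fintype κ]

/-- A map into `⊕ I_{b_j}` factors through `d` if and only if it is orthogonal to the maps
factoring through the cokernel of the transpose of `d`. -/
lemma exists_lift_iff {a : κ → A} {b : ι → A} (d : InjSum k a ⟶ InjSum k b)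
    (δ : ProjSum k a ⟶ ProjSum k b)
    (hδ : ∀ T : ProjSum k b ⟶ InjSum k a, traceForm b (T ≫ d) = traceForm a (δ ≫ T))
    {X : A ⥤ ModuleCat.{0} k} (hX : IsMod k X) (ψ : X ⟶ InjSum k b) :
    (∃ χ : X ⟶ InjSum k a, χ ≫ d = ψ) ↔
      ∀ t : cokernel δ ⟶ X, traceForm b (cokernel.π δ ≫ t ≫ ψ) = 0 := by
  constructor
  · rintro ⟨χ, rfl⟩ t
    rw [← Category.assoc t, ← Category.assoc, hδ, cokernel.condition_assoc,
      zero_comp, map_zero]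
  · intro h
    obtain ⟨φ, hφ⟩ := exists_dual_comp_eq (Linear.leftComp k X δ)
      (traceForm b ∘ₗ Linear.rightComp k _ ψ) fun t ht => by
        have ht' : δ ≫ t = 0 := ht
        have := h (cokernel.desc δ t ht')
        rw [cokernel.π_desc_assoc] at this
        exact this
    obtain ⟨χ, hχ⟩ := exists_traceForm_eq a hX φ
    refine ⟨χ, eq_of_traceForm_eq b hX fun t => ?_⟩
    rw [← Category.assoc, hδ, ← Category.assoc, hχ]
    exact LinearMap.congr_fun hφ t

/-- If the cokernel of the transpose of `d` is projective, the kernel of `d` is injective. -/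
lemma injInMod_of_projInMod [Spectroid k A] {a : κ → A} {b : ι → A}
    (d : InjSum k a ⟶ InjSum k b) (δ : ProjSum k a ⟶ ProjSum k b)
    (hδ : ∀ T : ProjSum k b ⟶ InjSum k a, traceForm b (T ≫ d) = traceForm a (δ ≫ T))
    (hN : ProjInMod k (cokernel δ)) {M : A ⥤ ModuleCat.{0} k} (i : M ⟶ InjSum k a) [Mono i]
    (hid : i ≫ d = 0)
    (hker : ∀ {X : A ⥤ ModuleCat.{0} k} (u : X ⟶ InjSum k a), u ≫ d = 0 → ∃ v, v ≫ i = u) :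
    InjInMod k M := by
  have hPb := projSum_isLfdMod (k := k) b
  obtain ⟨σ, hσ⟩ := hN hPb (hPb.of_epi (cokernel.π δ)) (cokernel.π δ) inferInstance (𝟙 _)
  have himg : (𝟙 _ - cokernel.π δ ≫ σ) ≫ cokernel.π δ = 0 := by
    rw [Preadditive.sub_comp, Category.assoc, hσ, Category.comp_id, Category.id_comp, sub_self]
  obtain ⟨ρ, hρ⟩ := projInMod_projSum b (projSum_isLfdMod a)
    (hPb.of_mono (Abelian.image.ι δ)) (Abelian.factorThruImage δ) inferInstance
    (kernel.lift (cokernel.π δ) (𝟙 _ - cokernel.π δ ≫ σ) himg)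
  have hρδ : ρ ≫ δ = 𝟙 _ - cokernel.π δ ≫ σ := by
    have h1 := congrArg (fun t => t ≫ kernel.ι (cokernel.π δ)) hρ
    simp only [kernel.lift_ι, Category.assoc] at h1
    rw [← h1]
  have hreg : δ ≫ ρ ≫ δ = δ := by
    rw [hρδ, Preadditive.comp_sub, cokernel.condition_assoc, zero_comp, sub_zero, Category.comp_id]
  obtain ⟨r, hr⟩ := exists_transpose' ρ
  have hd : d ≫ r ≫ d = d := by
    refine eq_of_traceForm_eq b (injSum_isLfdMod a).1 fun T => ?_
    rw [← Category.assoc d, ← Category.assoc T, hδ, ← Category.assoc T, ← Category.assoc δ, hr,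
      ← Category.assoc δ, ← Category.assoc ρ, hδ, hδ, ← Category.assoc ρ, ← Category.assoc δ, hreg]
  obtain ⟨v, hv⟩ := hker (𝟙 _ - d ≫ r) (by
    rw [Preadditive.sub_comp, Category.assoc, hd, Category.id_comp, sub_self])
  refine (injInMod_injSum a).retract i v ?_
  rw [← cancel_mono i, Category.assoc, hv, Preadditive.comp_sub, ← Category.assoc i d, hid,
    zero_comp, sub_zero, Category.comp_id, Category.id_comp]

lemma exists_almostSplitSeq [Spectroid k A] {M : A ⥤ ModuleCat.{0} k} (hM : IsLfdMod k M)
    (hind : Indec k M) (hni : ¬ InjInMod k M) {a : κ → A} {b : ι → A}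
    (d : InjSum k a ⟶ InjSum k b) (i : M ⟶ InjSum k a) [Mono i] (hid : i ≫ d = 0)
    (hker : ∀ {X : A ⥤ ModuleCat.{0} k} (u : X ⟶ InjSum k a), u ≫ d = 0 → ∃ v, v ≫ i = u) :
    ∃ (E N : A ⥤ ModuleCat.{0} k) (_ : IsLfdMod k E) (_ : IsLfdMod k N)
      (f : M ⟶ E) (g : E ⟶ N), AlmostSplitSeq k f g := by
  obtain ⟨δ, hδ⟩ := exists_transpose d
  have hNl : IsLfdMod k (cokernel δ) := (projSum_isLfdMod b).of_epi (cokernel.π δ)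
  obtain ⟨X, s, r, hsr, hXproj, hXid⟩ := exists_nonproj_summand b hNl (cokernel.π δ)
    fun h => hni (injInMod_of_projInMod d δ hδ h i hid hker)
  have hr : IsSplitEpi r := ⟨⟨⟨s, hsr⟩⟩⟩
  have hX : IsLfdMod k X := hNl.of_epi r
  have hXloc := isIso_or_isIso_one_sub hX hXid
  have hX0 : ∀ σ : X ⟶ cokernel δ, σ ≫ (0 : cokernel δ ⟶ X) ≠ 𝟙 X := fun σ hσ => by
    rw [comp_zero] at hσ
    refine hXproj fun V W _ _ e _ u => ⟨0, ?_⟩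
    rw [← Category.id_comp u, ← hσ, zero_comp, zero_comp]
  let W : Submodule k (cokernel δ ⟶ X) :=
    { carrier := {t | ¬ IsSplitEpi t}
      zero_mem' := fun ⟨⟨⟨σ, hσ⟩⟩⟩ => hX0 σ hσ
      add_mem' := by
        rintro t t' ht ht' ⟨⟨⟨σ, hσ⟩⟩⟩
        rw [Preadditive.comp_add] at hσ
        rcases hXloc (σ ≫ t) with h | h
        · exact ht ⟨⟨⟨inv (σ ≫ t) ≫ σ, by rw [Category.assoc, IsIso.inv_hom_id]⟩⟩⟩
        · rw [← hσ, add_sub_cancel_left] at h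
          exact ht' ⟨⟨⟨inv (σ ≫ t') ≫ σ, by rw [Category.assoc, IsIso.inv_hom_id]⟩⟩⟩
      smul_mem' := by
        rintro c t ht ⟨⟨⟨σ, hσ⟩⟩⟩
        exact ht ⟨⟨⟨c • σ, by rw [← hσ, Linear.smul_comp, Linear.comp_smul]⟩⟩⟩ }
  have hrW : r ∉ W := fun h => h hr
  obtain ⟨φ, hφr, hφW⟩ := Submodule.exists_le_ker_of_notMem hrW
  obtain ⟨φ', hφ'⟩ := exists_dual_comp_eq (Linear.leftComp k X (cokernel.π δ)) φ fun t ht => by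
    have : t = 0 := (cancel_epi (cokernel.π δ)).1 (ht.trans comp_zero.symm)
    rw [this]; exact Submodule.zero_mem _
  obtain ⟨ψ, hψ'⟩ := exists_traceForm_eq b hX.1 φ'
  have hψ : ∀ t : cokernel δ ⟶ X, traceForm b (cokernel.π δ ≫ t ≫ ψ) = φ t := fun t => by
    rw [← Category.assoc, hψ']; exact LinearMap.congr_fun hφ' t
  have hfac : ∀ {Y : A ⥤ ModuleCat.{0} k}, IsLfdMod k Y → ∀ u : Y ⟶ X, ¬ IsSplitEpi u →
      ∃ χ : Y ⟶ InjSum k a, χ ≫ d = u ≫ ψ := by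
    intro Y hY u hu
    refine (exists_lift_iff d δ hδ hY.1 _).2 fun t => ?_
    rw [← Category.assoc t, hψ]
    exact hφW fun ⟨⟨⟨σ, hσ⟩⟩⟩ => hu ⟨⟨⟨σ ≫ t, by rw [Category.assoc, hσ]⟩⟩⟩
  have hlift : ∀ {Y : A ⥤ ModuleCat.{0} k}, IsLfdMod k Y → ∀ u : Y ⟶ X, ¬ IsSplitEpi u →
      ∃ v : Y ⟶ pullback ψ d, v ≫ pullback.fst ψ d = u := by
    intro Y hY u hu
    obtain ⟨χ, hχ⟩ := hfac hY u hu
    exact ⟨pullback.lift u χ hχ.symm, pullback.lift_fst _ _ _⟩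
  have hg : Epi (pullback.fst ψ d) := by
    refine epi_of_app_surjective _ fun c x => ?_
    obtain ⟨v, hv⟩ := hlift (projAt_isLfdMod c) (fromProj hX.1 x) fun ⟨⟨⟨σ, hσ⟩⟩⟩ =>
      hXproj ((projInMod_projAt c).retract σ _ hσ)
    refine ⟨v.app c (projOne k c), ?_⟩
    exact (congrArg (fun t : ProjAt k c ⟶ X => t.app c (projOne k c)) hv).trans
      (fromProj_projOne hX.1 x)
  have hgs : ¬ IsSplitEpi (pullback.fst ψ d) := by
    rintro ⟨⟨⟨σ, hσ⟩⟩⟩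
    have h1 := (exists_lift_iff d δ hδ hX.1 ψ).1 ⟨σ ≫ pullback.snd ψ d, by
      rw [Category.assoc, ← pullback.condition, ← Category.assoc, hσ, Category.id_comp]⟩ r
    exact hφr ((hψ r).symm.trans h1)
  let f : M ⟶ pullback ψ d := pullback.lift 0 i (by rw [hid, zero_comp])
  have hf1 : f ≫ pullback.fst ψ d = 0 := pullback.lift_fst _ _ _
  have hf2 : f ≫ pullback.snd ψ d = i := pullback.lift_snd _ _ _
  have hf : Mono f := mono_of_mono_fac hf2
  have hexact : (ShortComplex.mk f (pullback.fst ψ d) hf1).Exact := by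
    refine ShortComplex.exact_of_f_is_kernel _ (KernelFork.IsLimit.ofι' f hf1 fun {Z} u hu => ?_)
    have h1 : (u ≫ pullback.snd ψ d) ≫ d = 0 := by
      rw [Category.assoc, ← pullback.condition, ← Category.assoc, hu, zero_comp]
    refine ⟨(hker _ h1).choose, pullback.hom_ext ?_ ?_⟩
    · rw [Category.assoc, hf1, hu, comp_zero]
    · rw [Category.assoc, hf2, (hker _ h1).choose_spec]
  have hE : IsLfdMod k (pullback ψ d) := by
    have : Mono (biprod.lift (pullback.fst ψ d) (pullback.snd ψ d)) := ⟨fun v w hvw => by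
      refine pullback.hom_ext ?_ ?_
      · simpa using congrArg (fun t => t ≫ biprod.fst) hvw
      · simpa using congrArg (fun t => t ≫ biprod.snd) hvw⟩
    exact (hX.biprod (injSum_isLfdMod a)).of_mono
      (biprod.lift (pullback.fst ψ d) (pullback.snd ψ d))
  exact ⟨_, X, hE, hX, f, pullback.fst ψ d, AlmostSplitSeq.of_right hE
    (isIso_or_isIso_one_sub hM (hind.eq_zero_or_eq_one hM)) f _ hf1 hexact hgs
    fun Y hY u hu => hlift hY u hu⟩

end Existence

section Copresented

variable {ι κ : Type} [Fintype ι] [Fintype κ]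

lemma exists_lift_of_cokernel {C : Type*} [Category C] [Abelian C] {M I J X : C} (i : M ⟶ I) [Mono i]
    (g : cokernel i ⟶ J) [Mono g] (u : X ⟶ I) (hu : u ≫ cokernel.π i ≫ g = 0) :
    ∃ v, v ≫ i = u := by
  rw [← Category.assoc, ← zero_comp (f := g), cancel_mono] at hu
  exact ⟨_, (KernelFork.IsLimit.lift' (Abelian.monoIsKernelOfCokernel _
    (cokernelIsCokernel i)) u hu).2⟩

lemma mono_cokernel_desc {C : Type*} [Category C] [Abelian C] {M I J : C} (i : M ⟶ I) [Mono i]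
    (d : I ⟶ J) (hid : i ≫ d = 0) (hker : ∀ {X : C} (u : X ⟶ I), u ≫ d = 0 → ∃ v, v ≫ i = u) :
    Mono (cokernel.desc i d hid) := by
  choose l hl using @hker
  exact (ShortComplex.exact_of_f_is_kernel (ShortComplex.mk i d hid)
    (KernelFork.IsLimit.ofι' i hid fun u hu => ⟨l u hu, hl u hu⟩)).mono_cokernelDesc

lemma IsFCG.of_mono_injSum {M : A ⥤ ModuleCat.{0} k} {a : ι → A} (i : M ⟶ InjSum k a) [Mono i] :
    IsFCG k M :=
  ⟨Fintype.card ι, fun j => a ((Fintype.equivFin ι).symm j),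
    i ≫ (biproduct.whiskerEquiv (f := fun i => InjAt k (a i))
      (g := fun j => InjAt k (a ((Fintype.equivFin ι).symm j))) (Fintype.equivFin ι)
        fun j => eqToIso (by simp)).hom, inferInstance⟩

lemma IsFCP.of_kernel {M : A ⥤ ModuleCat.{0} k} {a : ι → A} {b : κ → A}
    (d : InjSum k a ⟶ InjSum k b) (i : M ⟶ InjSum k a) [Mono i] (hid : i ≫ d = 0)
    (hker : ∀ {X : A ⥤ ModuleCat.{0} k} (u : X ⟶ InjSum k a), u ≫ d = 0 → ∃ v, v ≫ i = u) :
    IsFCP k M := by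
  let e := biproduct.whiskerEquiv (f := fun i => InjAt k (a i))
      (g := fun j => InjAt k (a ((Fintype.equivFin ι).symm j))) (Fintype.equivFin ι)
        fun j => eqToIso (by simp)
  have hd : (i ≫ e.hom) ≫ e.inv ≫ d = 0 := by simp [hid]
  have := mono_cokernel_desc (i ≫ e.hom) (e.inv ≫ d) hd fun u hu => by
    obtain ⟨v, hv⟩ := hker (u ≫ e.inv) (by simpa using hu)
    exact ⟨v, by rw [← Category.assoc, hv]; simp⟩
  exact ⟨Fintype.card ι, fun j => a ((Fintype.equivFin ι).symm j), i ≫ e.hom, inferInstance,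
    IsFCG.of_mono_injSum (cokernel.desc (i ≫ e.hom) (e.inv ≫ d) hd)⟩

lemma exists_sumMap_comp_eq_zero_iff {W : A ⥤ ModuleCat.{0} k} {c : ι ⊕ κ → A}
    (p : W ⟶ InjSum k fun i => c (Sum.inl i)) (q : W ⟶ InjSum k fun i => c (Sum.inr i)) :
    ∃ D : W ⟶ InjSum k c, ∀ {X : A ⥤ ModuleCat.{0} k} (u : X ⟶ W),
      u ≫ D = 0 ↔ u ≫ p = 0 ∧ u ≫ q = 0 := by
  let D : ∀ x, W ⟶ InjAt k (c x) := fun x => match x with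
    | Sum.inl j => p ≫ biproduct.π (fun i => InjAt k (c (Sum.inl i))) j
    | Sum.inr j => q ≫ biproduct.π (fun i => InjAt k (c (Sum.inr i))) j
  have key : ∀ {X : A ⥤ ModuleCat.{0} k} (u : X ⟶ W),
      u ≫ biproduct.lift D = 0 ↔ ∀ x, u ≫ D x = 0 := fun u =>
    ⟨fun h x => by rw [← biproduct.lift_π D x, ← Category.assoc, h, zero_comp],
      fun h => biproduct.hom_ext _ _ fun x => by
        rw [Category.assoc, biproduct.lift_π, h, zero_comp]⟩
  refine ⟨biproduct.lift D, fun u => (key u).trans ⟨fun h => ⟨?_, ?_⟩, fun h x => ?_⟩⟩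
  · exact biproduct.hom_ext _ _ fun j => by
      rw [Category.assoc, zero_comp]
      exact h (Sum.inl j)
  · exact biproduct.hom_ext _ _ fun j => by
      rw [Category.assoc, zero_comp]
      exact h (Sum.inr j)
  · rcases x with j | j
    · change u ≫ p ≫ _ = 0
      rw [← Category.assoc, h.1, zero_comp]
    · change u ≫ q ≫ _ = 0
      rw [← Category.assoc, h.2, zero_comp]

/-- A retract of the kernel of a map between finitely co-generated injectives is finitely
co-presented. -/
lemma IsFCP.of_retract [Spectroid k A] {M K : A ⥤ ModuleCat.{0} k} {a : ι → A} {b : κ → A}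
    (d : InjSum k a ⟶ InjSum k b) (i : K ⟶ InjSum k a) [Mono i] (hid : i ≫ d = 0)
    (hker : ∀ {X : A ⥤ ModuleCat.{0} k} (u : X ⟶ InjSum k a), u ≫ d = 0 → ∃ v, v ≫ i = u)
    (s : M ⟶ K) (r : K ⟶ M) (hsr : s ≫ r = 𝟙 M) : IsFCP k M := by
  have : Mono s := (SplitMono.mk r hsr).mono
  obtain ⟨q, hq⟩ := injInMod_injSum a ((injSum_isLfdMod a).of_mono i) (injSum_isLfdMod a) i
    inferInstance (i - r ≫ s ≫ i)
  obtain ⟨D, hD⟩ : ∃ D : InjSum k a ⟶ InjSum k (Sum.elim a b),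
      ∀ {X : A ⥤ ModuleCat.{0} k} (u : X ⟶ InjSum k a), u ≫ D = 0 ↔ u ≫ q = 0 ∧ u ≫ d = 0 :=
    exists_sumMap_comp_eq_zero_iff (c := Sum.elim a b) q d
  refine IsFCP.of_kernel D (s ≫ i) ((hD _).2 ⟨?_, ?_⟩) fun u hu => ?_
  · rw [Category.assoc, hq, Preadditive.comp_sub, ← Category.assoc s r, hsr, Category.id_comp,
      sub_self]
  · rw [Category.assoc, hid, comp_zero]
  · obtain ⟨h1, h2⟩ := (hD u).1 hu
    obtain ⟨v, rfl⟩ := hker u h2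
    refine ⟨v ≫ r, ?_⟩
    rw [Category.assoc, hq, Preadditive.comp_sub, sub_eq_zero] at h1
    rw [h1, Category.assoc]

/-- Every object of `mod A` embeds, on finitely many given objects of `A`, into a finitely
co-generated injective. -/
lemma exists_injSum_app_injective {X : A ⥤ ModuleCat.{0} k} (hX : IsLfdMod k X) (S : Finset A) :
    ∃ (ι : Type) (_ : Fintype ι) (b : ι → A) (ψ : X ⟶ InjSum k b),
      ∀ c ∈ S, Function.Injective (ψ.app c) := by
  have := hX.2
  refine ⟨Σ c : S, Fin (Module.finrank k (X.obj c)), inferInstance, fun j => j.1,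
    biproduct.lift fun j => toInj hX.1 ((Module.finBasis k (X.obj j.1)).coord j.2), ?_⟩
  intro c hc x y hxy
  refine (Module.finBasis k (X.obj c)).ext_elem fun j => ?_
  set F : (Σ c : S, Fin (Module.finrank k (X.obj c))) → (A ⥤ ModuleCat.{0} k) :=
    fun j => InjAt k j.1.1
  set ψ : X ⟶ ⨁ F :=
    biproduct.lift fun j => toInj hX.1 ((Module.finBasis k (X.obj j.1)).coord j.2)
  have h : ∀ z : X.obj c, (Module.finBasis k (X.obj c)).coord j z =
      injEval k c ((biproduct.π F ⟨⟨c, hc⟩, j⟩).app c (ψ.app c z)) := fun z => by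
    rw [← injEval_toInj hX.1]
    have h1 : ψ ≫ biproduct.π F ⟨⟨c, hc⟩, j⟩ = _ := biproduct.lift_π _ _
    exact (congrArg (fun t : X ⟶ InjAt k c => injEval k c (t.app c z)) h1).symm
  exact (h x).trans ((congrArg _ (congrArg _ hxy)).trans (h y).symm)

/-- Every object of `mod A` can be approximated, on finitely many given objects of `A`, by the
kernel of a map between finitely co-generated injectives. -/
lemma exists_copresented_approx {X : A ⥤ ModuleCat.{0} k} (hX : IsLfdMod k X) (S : Finset A)
    [Spectroid k A] :
    ∃ (ι κ : Type) (_ : Fintype ι) (_ : Fintype κ) (a : ι → A) (b : κ → A)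
      (d : InjSum k a ⟶ InjSum k b) (u : X ⟶ kernel d),
      ∀ c ∈ S, Function.Bijective (u.app c) := by
  obtain ⟨ι, _, a, ψ, hψ⟩ := exists_injSum_app_injective hX S
  obtain ⟨κ, _, b, χ, hχ⟩ := exists_injSum_app_injective
    ((injSum_isLfdMod a).of_epi (cokernel.π ψ)) S
  have h0 : ψ ≫ cokernel.π ψ ≫ χ = 0 := by rw [← Category.assoc, cokernel.condition, zero_comp]
  have hu : kernel.lift (cokernel.π ψ ≫ χ) ψ h0 ≫ kernel.ι _ = ψ := kernel.lift_ι _ _ _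
  have hu' : ∀ c x, (kernel.ι (cokernel.π ψ ≫ χ)).app c
      ((kernel.lift (cokernel.π ψ ≫ χ) ψ h0).app c x) = ψ.app c x :=
    fun c x => congrArg (fun t : X ⟶ InjSum k a => t.app c x) hu
  refine ⟨ι, κ, inferInstance, inferInstance, a, b, cokernel.π ψ ≫ χ, kernel.lift _ ψ h0,
    fun c hc => ⟨fun x y h => hψ c hc ?_, fun z => ?_⟩⟩
  · rw [← hu', h, hu']
  · set w := (kernel.ι (cokernel.π ψ ≫ χ)).app c z
    have hw : χ.app c ((cokernel.π ψ).app c w) = 0 :=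
      congrArg (fun t : kernel (cokernel.π ψ ≫ χ) ⟶ InjSum k b => t.app c z)
        (kernel.condition (cokernel.π ψ ≫ χ))
    have hw' : (cokernel.π ψ).app c w = 0 := hχ c hc (hw.trans (map_zero _).symm)
    have hex : ((ShortComplex.mk ψ (cokernel.π ψ) (cokernel.condition ψ)).map
        ((evaluation A (ModuleCat.{0} k)).obj c)).Exact :=
      (ShortComplex.exact_cokernel ψ).map _
    obtain ⟨x, hx⟩ := (ShortComplex.moduleCat_exact_iff _).1 hex w hw'
    exact ⟨x, app_injective_of_mono (kernel.ι (cokernel.π ψ ≫ χ)) c ((hu' c x).trans hx)⟩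

end Copresented

section Compactness

/-- Finite-dimensional vector spaces are linearly compact: a system of linear equations in the
elements of a family of finite-dimensional spaces is solvable if it is finitely solvable. -/
lemma exists_forall_of_finset {C I : Type} [DecidableEq C] (H : C → Type)
    [∀ c, AddCommGroup (H c)] [∀ c, Module k (H c)] [∀ c, FiniteDimensional k (H c)]
    (v : I → DirectSum C fun c => Module.Dual k (H c)) (w : I → k)
    (h : ∀ T : Finset I, ∃ r : ∀ c, H c, ∀ i ∈ T,
      DirectSum.toModule k C k (fun c => Module.Dual.eval k (H c) (r c)) (v i) = w i) :
    ∃ r : ∀ c, H c, ∀ i,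
      DirectSum.toModule k C k (fun c => Module.Dual.eval k (H c) (r c)) (v i) = w i := by
  obtain ⟨L, hL⟩ := exists_dual_comp_eq (Finsupp.linearCombination k v)
    (Finsupp.linearCombination k w) fun l hl => by
      obtain ⟨r, hr⟩ := h l.support
      rw [LinearMap.mem_ker, Finsupp.linearCombination_apply] at hl ⊢
      have := congrArg (DirectSum.toModule k C k fun c => Module.Dual.eval k (H c) (r c)) hl
      rw [Finsupp.sum, map_sum, map_zero] at this
      rw [← this]
      refine Finset.sum_congr rfl fun i hi => ?_
      rw [map_smul, hr i hi]
  refine ⟨fun c => (Module.evalEquiv k (H c)).symm (L ∘ₗ DirectSum.lof k C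
    (fun c => Module.Dual k (H c)) c), fun i => ?_⟩
  have h1 : DirectSum.toModule k C k (fun c => Module.Dual.eval k (H c)
      ((Module.evalEquiv k (H c)).symm (L ∘ₗ DirectSum.lof k C
    (fun c => Module.Dual k (H c)) c))) = L := by
    refine DirectSum.linearMap_ext _ fun c => ?_
    ext ξ
    rw [LinearMap.comp_apply, DirectSum.toModule_lof]
    exact LinearMap.congr_fun ((Module.evalEquiv k (H c)).apply_symm_apply _) ξ
  rw [h1]
  have := LinearMap.congr_fun hL (Finsupp.single i 1)
  simpa using this

lemma isSplitMono_of_finset {M E : A ⥤ ModuleCat.{0} k} (hM : IsLfdMod k M) (hE : IsLfdMod k E)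
    (f : M ⟶ E)
    (h : ∀ S : Finset A, ∃ r : ∀ c, E.obj c →ₗ[k] M.obj c,
      (∀ c ∈ S, r c ∘ₗ (f.app c).hom = LinearMap.id) ∧
      ∀ c ∈ S, ∀ c' ∈ S, ∀ α : c ⟶ c', r c' ∘ₗ (E.map α).hom = (M.map α).hom ∘ₗ r c) :
    IsSplitMono f := by
  classical
  have := hM.2
  have := hE.2
  let H : A → Type := fun c => E.obj c →ₗ[k] M.obj c
  let I := (Σ c, Module.Dual k (M.obj c →ₗ[k] M.obj c)) ⊕
    (Σ (c c' : A) (_ : c ⟶ c'), Module.Dual k (E.obj c →ₗ[k] M.obj c'))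
  let V : I → DirectSum A fun c => Module.Dual k (H c) := fun
    | Sum.inl ⟨c, ζ⟩ => DirectSum.lof k A _ c (ζ ∘ₗ LinearMap.lcomp k _ (f.app c).hom)
    | Sum.inr ⟨c, c', α, ζ⟩ => DirectSum.lof k A _ c' (ζ ∘ₗ LinearMap.lcomp k _ (E.map α).hom) -
        DirectSum.lof k A _ c (ζ ∘ₗ LinearMap.compRight k (M.map α).hom)
  let w : I → k := fun
    | Sum.inl ⟨_, ζ⟩ => ζ LinearMap.id
    | Sum.inr _ => 0
  let S : I → Finset A := fun
    | Sum.inl ⟨c, _⟩ => {c}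
    | Sum.inr ⟨c, c', _, _⟩ => {c, c'}
  have hl : ∀ (r : ∀ c, H c) c ζ, DirectSum.toModule k A k
      (fun c => Module.Dual.eval k (H c) (r c)) (V (Sum.inl ⟨c, ζ⟩)) =
        ζ (r c ∘ₗ (f.app c).hom) := fun r c ζ => by
    simp only [V, DirectSum.toModule_lof]
    rfl
  have hr : ∀ (r : ∀ c, H c) c c' (α : c ⟶ c') ζ, DirectSum.toModule k A k
      (fun c => Module.Dual.eval k (H c) (r c)) (V (Sum.inr ⟨c, c', α, ζ⟩)) =
        ζ (r c' ∘ₗ (E.map α).hom) - ζ ((M.map α).hom ∘ₗ r c) := fun r c c' α ζ => by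
    simp only [V, map_sub, DirectSum.toModule_lof]
    rfl
  obtain ⟨r, hsol⟩ := exists_forall_of_finset H V w fun T => by
    obtain ⟨r, h1, h2⟩ := h (T.biUnion S)
    refine ⟨r, ?_⟩
    rintro (⟨c, ζ⟩ | ⟨c, c', α, ζ⟩) hi
    · rw [hl, h1 c (Finset.mem_biUnion.2 ⟨_, hi, Finset.mem_singleton_self c⟩)]
    · rw [hr, h2 c (Finset.mem_biUnion.2 ⟨_, hi, by simp [S]⟩) c'
        (Finset.mem_biUnion.2 ⟨_, hi, by simp [S]⟩) α, sub_self]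
  have sep : ∀ {V : Type} [AddCommGroup V] [Module k V] {x y : V},
      (∀ ζ : Module.Dual k V, ζ x = ζ y) → x = y := fun {V} _ _ {x y} hxy =>
    sub_eq_zero.1 ((Module.forall_dual_apply_eq_zero_iff k _).1 fun ζ => by
      rw [map_sub, hxy, sub_self])
  have e1 : ∀ c, r c ∘ₗ (f.app c).hom = LinearMap.id := fun c => sep fun ζ =>
    (hl r c ζ).symm.trans (hsol (Sum.inl ⟨c, ζ⟩))
  have e2 : ∀ {c c'} (α : c ⟶ c'), r c' ∘ₗ (E.map α).hom = (M.map α).hom ∘ₗ r c :=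
    fun {c c'} α => sep fun ζ =>
      sub_eq_zero.1 ((hr r c c' α ζ).symm.trans (hsol (Sum.inr ⟨c, c', α, ζ⟩)))
  refine ⟨⟨⟨{ app := fun c => ModuleCat.ofHom (r c), naturality := fun c c' α => ?_ }, ?_⟩⟩⟩
  · ext x
    exact LinearMap.congr_fun (e2 α) x
  · exact hom_ext_apply fun c x => LinearMap.congr_fun (e1 c) x

lemma IsFCP.of_leftAlmostSplit [Spectroid k A] {M E : A ⥤ ModuleCat.{0} k} (hM : IsLfdMod k M)
    (hE : IsLfdMod k E) (f : M ⟶ E) (hf : ¬ IsSplitMono f)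
    (hlas : ∀ ⦃X : A ⥤ ModuleCat.{0} k⦄, IsLfdMod k X →
      ∀ u : M ⟶ X, ¬ IsSplitMono u → ∃ v : E ⟶ X, f ≫ v = u) : IsFCP k M := by
  classical
  by_contra hfcp
  refine hf (isSplitMono_of_finset hM hE f fun S => ?_)
  obtain ⟨ι, κ, _, _, a, b, d, u, hu⟩ := exists_copresented_approx hM S
  obtain ⟨v, hv⟩ := hlas ((injSum_isLfdMod a).of_mono (kernel.ι d)) u fun ⟨⟨s⟩⟩ => hfcp <|
    IsFCP.of_retract d (kernel.ι d) (kernel.condition d)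
      (fun t ht => ⟨kernel.lift d t ht, kernel.lift_ι d t ht⟩) u s.retraction s.id
  have hv' : ∀ c x, v.app c (f.app c x) = u.app c x :=
    fun c x => congrArg (fun t : M ⟶ kernel d => t.app c x) hv
  let e : ∀ c, c ∈ S → (M.obj c ≃ₗ[k] (kernel d).obj c) := fun c hc =>
    LinearEquiv.ofBijective (u.app c).hom (hu c hc)
  have he : ∀ c hc x, u.app c ((e c hc).symm x) = x := fun c hc x => (e c hc).apply_symm_apply x
  refine ⟨fun c => if hc : c ∈ S then (e c hc).symm.toLinearMap ∘ₗ (v.app c).hom else 0,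
    fun c hc => ?_, fun c hc c' hc' α => ?_⟩
  · simp only [dif_pos hc]
    refine LinearMap.ext fun x => (hu c hc).1 ((he c hc _).trans (hv' c x))
  · simp only [dif_pos hc, dif_pos hc']
    refine LinearMap.ext fun x => (hu c' hc').1 ((he c' hc' _).trans ?_)
    refine (naturality_apply' v α x).trans ?_
    refine Eq.trans ?_ (naturality_apply' u α ((e c hc).symm (v.app c x))).symm
    rw [he c hc]

end Compactness

end Aux

variable (k : Type) [Field k] [IsAlgClosed k]
variable (A : Type) [Category.{0} A] [Preadditive A] [CategoryTheory.Linear k A]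

/-- For an indecomposable non-injective `M` in `mod A`, there is an almost split
sequence starting in `M` if and only if `M` is finitely co-presented. -/
theorem statement_12 [Spectroid k A] (M : A ⥤ ModuleCat.{0} k)
    (hM : IsLfdMod k M) (hind : Indec k M) (hni : ¬ InjInMod k M) :
    (∃ (E N : A ⥤ ModuleCat.{0} k) (_ : IsLfdMod k E) (_ : IsLfdMod k N)
        (f : M ⟶ E) (g : E ⟶ N), AlmostSplitSeq k f g) ↔ IsFCP k M := by
  constructor
  · rintro ⟨E, N, hE, -, f, g, h⟩
    exact IsFCP.of_leftAlmostSplit hM hE f h.not_splitMono h.left_almost_split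
  · rintro ⟨s, a, i, _, t, b, g, _⟩
    exact exists_almostSplitSeq hM hind hni (cokernel.π i ≫ g) i
      (by rw [← Category.assoc, cokernel.condition, zero_comp])
      fun u hu => exists_lift_of_cokernel i g u hu

end Paper
end

section
/- Let k be an algebraically closed field, Q a strongly locally finite quiver and rep(Q) the category of locally finite dimensional representations of Q. Let f : L → M be an irreducible morphism in rep(Q). If f is a monomorphism and L is indecomposable, then coker(f) is finitely presented. If f is an epimorphism and M is indecomposable, then ker(f) is finitely co-presented. -/
open CategoryTheory CategoryTheory.Limits

namespace Paper

variable (k : Type) [Field k]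

section LinearAlgebra

variable {k}

theorem exists_comp_eq_of_ker_le {W V U : Type*} [AddCommGroup W] [Module k W]
    [AddCommGroup V] [Module k V] [AddCommGroup U] [Module k U]
    (f : W →ₗ[k] V) (g : W →ₗ[k] U) (h : LinearMap.ker f ≤ LinearMap.ker g) :
    ∃ d : V →ₗ[k] U, d ∘ₗ f = g := by
  obtain ⟨d, hd⟩ := LinearMap.exists_extend
    (((LinearMap.ker f).liftQ g h) ∘ₗ f.quotKerEquivRange.symm.toLinearMap)
  refine ⟨d, LinearMap.ext fun w => ?_⟩
  have h₁ := LinearMap.congr_fun hd (f.rangeRestrict w)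
  have h₂ : f.quotKerEquivRange.symm (f.rangeRestrict w) = (LinearMap.ker f).mkQ w := by
    rw [LinearEquiv.symm_apply_eq]
    rfl
  simp only [LinearMap.comp_apply, LinearEquiv.coe_coe, h₂] at h₁
  exact h₁

/-- A system of affine equations on linear functionals is solvable as soon as each of its finite
subsystems is. -/
theorem exists_functional_of_finite {W J : Type*} [AddCommGroup W] [Module k W]
    (l : J → W) (c : J → k)
    (h : ∀ S : Finset J, ∃ φ : W →ₗ[k] k, ∀ j ∈ S, φ (l j) = c j) :
    ∃ φ : W →ₗ[k] k, ∀ j, φ (l j) = c j := by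
  obtain ⟨d, hd⟩ := exists_comp_eq_of_ker_le (Finsupp.linearCombination k l)
    (Finsupp.linearCombination k c) (fun u hu => by
      obtain ⟨φ, hφ⟩ := h u.support
      rw [LinearMap.mem_ker] at hu ⊢
      rw [← map_zero φ, ← hu, Finsupp.linearCombination_apply, Finsupp.linearCombination_apply,
        Finsupp.sum, Finsupp.sum, map_sum]
      refine Finset.sum_congr rfl fun j hj => ?_
      rw [map_smul, hφ j hj])
  refine ⟨d, fun j => ?_⟩
  have := LinearMap.congr_fun hd (Finsupp.single j 1)
  simpa using this

theorem exists_eval_of_ker_le {H V : Type*} [AddCommGroup H] [Module k H] [AddCommGroup V]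
    [Module k V] [FiniteDimensional k V] (f : H →ₗ[k] Module.Dual k V) (θ : H →ₗ[k] k)
    (h : LinearMap.ker f ≤ LinearMap.ker θ) : ∃ v : V, ∀ x, θ x = f x v := by
  obtain ⟨d, hd⟩ := exists_comp_eq_of_ker_le f θ h
  refine ⟨(Module.evalEquiv k V).symm d, fun x => ?_⟩
  rw [← hd, LinearMap.comp_apply]
  have := LinearMap.congr_fun ((Module.evalEquiv k V).apply_symm_apply d) (f x)
  rw [← this]
  rfl

end LinearAlgebra

section Functors

variable {k} {A : Type} [Category.{0} A]

/-- The action of a morphism on a functor to vector spaces, as a linear map. -/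
noncomputable def act (X : A ⥤ ModuleCat.{0} k) {a b : A} (φ : a ⟶ b) : X.obj a →ₗ[k] X.obj b :=
  (X.map φ).hom

/-- The component of a natural transformation, as a linear map. -/
noncomputable def comp {X Y : A ⥤ ModuleCat.{0} k} (f : X ⟶ Y) (a : A) : X.obj a →ₗ[k] Y.obj a :=
  (f.app a).hom

variable {X Y Z : A ⥤ ModuleCat.{0} k}

theorem act_id (a : A) (v : X.obj a) : act X (𝟙 a) v = v := by
  simp [act]

theorem act_comp {a b c : A} (φ : a ⟶ b) (ψ : b ⟶ c) (v : X.obj a) :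
    act X (φ ≫ ψ) v = act X ψ (act X φ v) := by
  simp [act]

theorem comp_act (f : X ⟶ Y) {a b : A} (φ : a ⟶ b) (v : X.obj a) :
    comp f b (act X φ v) = act Y φ (comp f a v) :=
  congrArg (fun g => g.hom v) (f.naturality φ)

theorem comp_comp (f : X ⟶ Y) (g : Y ⟶ Z) (a : A) (v : X.obj a) :
    comp (f ≫ g) a v = comp g a (comp f a v) := by
  simp [comp]

theorem comp_id (a : A) (v : X.obj a) : comp (𝟙 X) a v = v := by
  simp [comp]

theorem comp_zero (a : A) (v : X.obj a) : comp (0 : X ⟶ Y) a v = 0 := by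
  simp [comp]

theorem hom_ext_comp {f g : X ⟶ Y} (h : ∀ a v, comp f a v = comp g a v) : f = g := by
  ext a v
  exact h a v

/-- A natural transformation from a natural family of linear maps. -/
noncomputable def homMk (t : ∀ a, X.obj a →ₗ[k] Y.obj a)
    (h : ∀ {a b : A} (φ : a ⟶ b) v, t b (act X φ v) = act Y φ (t a v)) : X ⟶ Y where
  app a := ModuleCat.ofHom (t a)
  naturality a b φ := by
    ext v
    exact h φ v

theorem comp_homMk (t : ∀ a, X.obj a →ₗ[k] Y.obj a)
    (h : ∀ {a b : A} (φ : a ⟶ b) v, t b (act X φ v) = act Y φ (t a v)) (a : A) (v : X.obj a) :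
    comp (homMk t h) a v = t a v := rfl

theorem injective_of_mono (f : X ⟶ Y) [Mono f] (a : A) : Function.Injective (comp f a) :=
  (ModuleCat.mono_iff_injective (f.app a)).1 inferInstance

theorem surjective_of_epi (f : X ⟶ Y) [Epi f] (a : A) : Function.Surjective (comp f a) :=
  (ModuleCat.epi_iff_surjective (f.app a)).1 inferInstance

theorem mono_of_injective (f : X ⟶ Y) (h : ∀ a, Function.Injective (comp f a)) : Mono f := by
  have : ∀ a, Mono (f.app a) := fun a => (ModuleCat.mono_iff_injective (f.app a)).2 (h a)
  exact NatTrans.mono_of_mono_app f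

theorem epi_of_surjective (f : X ⟶ Y) (h : ∀ a, Function.Surjective (comp f a)) : Epi f := by
  have : ∀ a, Epi (f.app a) := fun a => (ModuleCat.epi_iff_surjective (f.app a)).2 (h a)
  exact NatTrans.epi_of_epi_app f

section Constructions

/-- A stable family of subspaces of `X`. -/
def Stable (S : ∀ a, Submodule k (X.obj a)) : Prop :=
  ∀ ⦃a b : A⦄ (φ : a ⟶ b) ⦃v : X.obj a⦄, v ∈ S a → act X φ v ∈ S b

/-- The subfunctor given by a stable family of subspaces. -/
noncomputable def subF (S : ∀ a, Submodule k (X.obj a)) (hS : Stable S) :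
    A ⥤ ModuleCat.{0} k where
  obj a := ModuleCat.of k (S a)
  map φ := ModuleCat.ofHom ((act X φ).restrict (hS φ))
  map_id a := ModuleCat.hom_ext (LinearMap.ext fun v => Subtype.ext (act_id a v.1))
  map_comp φ ψ := ModuleCat.hom_ext (LinearMap.ext fun v => Subtype.ext (act_comp φ ψ v.1))

/-- The quotient of a functor by a stable family of subspaces. -/
noncomputable def quotF (S : ∀ a, Submodule k (X.obj a)) (hS : Stable S) :
    A ⥤ ModuleCat.{0} k where
  obj a := ModuleCat.of k (X.obj a ⧸ S a)
  map {a b} φ := ModuleCat.ofHom ((S a).mapQ (S b) (act X φ) (hS φ))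
  map_id a := by
    ext v
    exact congrArg (S a).mkQ (act_id a v)
  map_comp {a b c} φ ψ := by
    ext v
    exact congrArg (S c).mkQ (act_comp φ ψ v)

/-- The inclusion of a subfunctor. -/
noncomputable def subι (S : ∀ a, Submodule k (X.obj a)) (hS : Stable S) : subF S hS ⟶ X :=
  homMk (X := subF S hS) (fun a => (S a).subtype) (fun _ _ => rfl)

/-- The projection to a quotient functor. -/
noncomputable def quotπ (S : ∀ a, Submodule k (X.obj a)) (hS : Stable S) : X ⟶ quotF S hS :=
  homMk (Y := quotF S hS) (fun a => (S a).mkQ) (fun _ _ => rfl)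

theorem comp_quotπ_surjective (S : ∀ a, Submodule k (X.obj a)) (hS : Stable S) (a : A) :
    Function.Surjective (comp (quotπ S hS) a) :=
  (S a).mkQ_surjective

theorem comp_quotπ_eq_zero (S : ∀ a, Submodule k (X.obj a)) (hS : Stable S) (a : A)
    (v : X.obj a) : comp (quotπ S hS) a v = 0 ↔ v ∈ S a :=
  Submodule.Quotient.mk_eq_zero (S a)

theorem exists_quotF_desc (S : ∀ a, Submodule k (X.obj a)) (hS : Stable S) (f : X ⟶ Y)
    (h : ∀ a, ∀ v ∈ S a, comp f a v = 0) : ∃ g : quotF S hS ⟶ Y, quotπ S hS ≫ g = f := by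
  refine ⟨homMk (X := quotF S hS) (fun a => (S a).liftQ (comp f a) (h a)) ?_, ?_⟩
  · intro a b φ v
    obtain ⟨v, rfl⟩ := comp_quotπ_surjective S hS a v
    exact comp_act f φ v
  · ext a v
    rfl

theorem exists_subF_lift (S : ∀ a, Submodule k (X.obj a)) (hS : Stable S) (f : Y ⟶ X)
    (h : ∀ a, ∀ v, comp f a v ∈ S a) : ∃ g : Y ⟶ subF S hS, g ≫ subι S hS = f := by
  refine ⟨homMk (Y := subF S hS) (fun a => (comp f a).codRestrict (S a) (h a)) ?_, ?_⟩
  · intro a b φ v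
    exact Subtype.ext (comp_act f φ v)
  · ext a v
    rfl

/-- The product of two functors. -/
noncomputable def prodF (X Y : A ⥤ ModuleCat.{0} k) : A ⥤ ModuleCat.{0} k where
  obj a := ModuleCat.of k (X.obj a × Y.obj a)
  map φ := ModuleCat.ofHom ((act X φ).prodMap (act Y φ))
  map_id a := ModuleCat.hom_ext (LinearMap.ext fun v =>
    Prod.ext (act_id a v.1) (act_id a v.2))
  map_comp φ ψ := ModuleCat.hom_ext (LinearMap.ext fun v =>
    Prod.ext (act_comp φ ψ v.1) (act_comp φ ψ v.2))

/-- The first inclusion in a product. -/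
noncomputable def prodInl (X Y : A ⥤ ModuleCat.{0} k) : X ⟶ prodF X Y :=
  homMk (Y := prodF X Y) (fun a => LinearMap.inl k (X.obj a) (Y.obj a))
    (fun φ _ => Prod.ext rfl (map_zero (act Y φ)).symm)

/-- The second inclusion in a product. -/
noncomputable def prodInr (X Y : A ⥤ ModuleCat.{0} k) : Y ⟶ prodF X Y :=
  homMk (Y := prodF X Y) (fun a => LinearMap.inr k (X.obj a) (Y.obj a))
    (fun φ _ => Prod.ext (map_zero (act X φ)).symm rfl)

/-- The second projection of a product. -/
noncomputable def prodSnd (X Y : A ⥤ ModuleCat.{0} k) : prodF X Y ⟶ Y :=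
  homMk (X := prodF X Y) (fun a => LinearMap.snd k (X.obj a) (Y.obj a)) (fun _ _ => rfl)

/-- The morphism out of a product induced by two morphisms. -/
noncomputable def prodDesc (f : X ⟶ Z) (g : Y ⟶ Z) : prodF X Y ⟶ Z :=
  homMk (X := prodF X Y) (fun a => (comp f a).coprod (comp g a)) (fun {a b} φ v => by
    change comp f b (act X φ v.1) + comp g b (act Y φ v.2) =
      act Z φ (comp f a v.1 + comp g a v.2)
    rw [map_add, comp_act, comp_act])

/-- The subspaces generated by the values of the family `S` at the objects of `F`. -/
def genSub (S : ∀ a, Submodule k (X.obj a)) (F : Finset A) (b : A) : Submodule k (X.obj b) :=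
  Submodule.span k {m | ∃ a ∈ F, ∃ φ : a ⟶ b, ∃ v ∈ S a, m = act X φ v}

theorem genSub_stable (S : ∀ a, Submodule k (X.obj a)) (F : Finset A) : Stable (genSub S F) := by
  intro a b φ v hv
  induction hv using Submodule.span_induction with
  | mem v h =>
    obtain ⟨c, hc, ψ, w, hw, rfl⟩ := h
    exact Submodule.subset_span ⟨c, hc, ψ ≫ φ, w, hw, (act_comp ψ φ w).symm⟩
  | zero => rw [map_zero]; exact zero_mem _
  | add v w _ _ hv hw => rw [map_add]; exact add_mem hv hw
  | smul c v _ hv => rw [map_smul]; exact Submodule.smul_mem _ _ hv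

theorem le_genSub (S : ∀ a, Submodule k (X.obj a)) {F : Finset A} {b : A} (hb : b ∈ F) :
    S b ≤ genSub S F b := fun v hv =>
  Submodule.subset_span ⟨b, hb, 𝟙 b, v, hv, (act_id b v).symm⟩

theorem genSub_mono (S : ∀ a, Submodule k (X.obj a)) {F G : Finset A} (h : F ⊆ G) (b : A) :
    genSub S F b ≤ genSub S G b := by
  refine Submodule.span_mono ?_
  rintro _ ⟨a, ha, r⟩
  exact ⟨a, h ha, r⟩

end Constructions

section Linear

variable [Preadditive A] [CategoryTheory.Linear k A]

theorem act_add (hX : IsMod k X) {a b : A} (φ ψ : a ⟶ b) (v : X.obj a) :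
    act X (φ + ψ) v = act X φ v + act X ψ v := by
  simp [act, hX.1]

theorem act_smul (hX : IsMod k X) {a b : A} (c : k) (φ : a ⟶ b) (v : X.obj a) :
    act X (c • φ) v = c • act X φ v := by
  simp [act, hX.2]

theorem act_zero (hX : IsMod k X) {a b : A} (v : X.obj a) :
    act X (0 : a ⟶ b) v = 0 := by
  have := act_smul hX (0 : k) (0 : a ⟶ b) v
  simpa using this

theorem isMod_of_act
    (h₁ : ∀ {a b : A} (φ ψ : a ⟶ b) (v : X.obj a), act X (φ + ψ) v = act X φ v + act X ψ v)
    (h₂ : ∀ {a b : A} (c : k) (φ : a ⟶ b) (v : X.obj a), act X (c • φ) v = c • act X φ v) :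
    IsMod k X := by
  refine ⟨fun f g => ?_, fun r f => ?_⟩
  · ext v
    exact h₁ f g v
  · ext v
    exact h₂ r f v

theorem act_sum (hX : IsMod k X) {a b : A} {ι : Type*} (s : Finset ι) (φ : ι → (a ⟶ b))
    (v : X.obj a) : act X (∑ i ∈ s, φ i) v = ∑ i ∈ s, act X (φ i) v := by
  classical
  induction s using Finset.induction_on with
  | empty => simp [act_zero hX]
  | insert i s hi ih => rw [Finset.sum_insert hi, Finset.sum_insert hi, act_add hX, ih]

theorem IsLfdMod.subF (hX : IsLfdMod k X) (S : ∀ a, Submodule k (X.obj a)) (hS : Stable S) :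
    IsLfdMod k (subF S hS) := by
  have := hX.2
  refine ⟨isMod_of_act ?_ ?_, fun a => ?_⟩
  · intro a b φ ψ v
    exact Subtype.ext (act_add hX.1 φ ψ v.1)
  · intro a b c φ v
    exact Subtype.ext (act_smul hX.1 c φ v.1)
  · exact inferInstanceAs (FiniteDimensional k (S a))

theorem IsLfdMod.quotF (hX : IsLfdMod k X) (S : ∀ a, Submodule k (X.obj a)) (hS : Stable S) :
    IsLfdMod k (quotF S hS) := by
  have := hX.2
  refine ⟨isMod_of_act ?_ ?_, fun a => ?_⟩
  · intro a b φ ψ v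
    obtain ⟨v, rfl⟩ := comp_quotπ_surjective S hS a v
    exact congrArg (S b).mkQ (act_add hX.1 φ ψ v)
  · intro a b c φ v
    obtain ⟨v, rfl⟩ := comp_quotπ_surjective S hS a v
    exact congrArg (S b).mkQ (act_smul hX.1 c φ v)
  · exact inferInstanceAs (FiniteDimensional k (X.obj a ⧸ S a))

theorem IsLfdMod.prodF (hX : IsLfdMod k X) (hY : IsLfdMod k Y) : IsLfdMod k (prodF X Y) := by
  have := hX.2
  have := hY.2
  refine ⟨isMod_of_act ?_ ?_, fun a => ?_⟩
  · intro a b φ ψ v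
    exact Prod.ext (act_add hX.1 φ ψ v.1) (act_add hY.1 φ ψ v.2)
  · intro a b c φ v
    exact Prod.ext (act_smul hX.1 c φ v.1) (act_smul hY.1 c φ v.2)
  · exact inferInstanceAs (FiniteDimensional k (X.obj a × Y.obj a))

end Linear

end Functors

section Compactness

variable {k} {A : Type} [Category.{0} A] {X Y : A ⥤ ModuleCat.{0} k}

/-- A natural transformation into a locally finite dimensional functor with prescribed values
exists as soon as it exists on each finite set of objects. -/
theorem exists_hom_of_finite (hX : ∀ a, FiniteDimensional k (X.obj a))
    (C : ∀ a, Y.obj a → X.obj a → Prop)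
    (h : ∀ F : Finset A, ∃ t : ∀ a, Y.obj a →ₗ[k] X.obj a,
      (∀ a ∈ F, ∀ b ∈ F, ∀ (φ : a ⟶ b) v, t b (act Y φ v) = act X φ (t a v)) ∧
      ∀ a ∈ F, ∀ v w, C a v w → t a v = w) :
    ∃ f : Y ⟶ X, ∀ a v w, C a v w → comp f a v = w := by
  classical
  let ι (a : A) := DirectSum.lof k A
    (fun a => TensorProduct k (Y.obj a) (Module.Dual k (X.obj a))) a
  let J₁ := Σ (a b : A) (_ : a ⟶ b), Y.obj a × Module.Dual k (X.obj b)
  let J₂ := Σ a : A, {p : Y.obj a × X.obj a // C a p.1 p.2} × Module.Dual k (X.obj a)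
  let l : J₁ ⊕ J₂ → DirectSum A
      (fun a => TensorProduct k (Y.obj a) (Module.Dual k (X.obj a))) := Sum.elim
    (fun j => ι j.2.1 (act Y j.2.2.1 j.2.2.2.1 ⊗ₜ j.2.2.2.2) -
      ι j.1 (j.2.2.2.1 ⊗ₜ (j.2.2.2.2 ∘ₗ act X j.2.2.1)))
    (fun j => ι j.1 (j.2.1.1.1 ⊗ₜ j.2.2))
  let c : J₁ ⊕ J₂ → k := Sum.elim (fun _ => 0) (fun j => j.2.2 j.2.1.1.2)
  obtain ⟨Φ, hΦ⟩ := exists_functional_of_finite l c (by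
    intro S
    let supp : J₁ ⊕ J₂ → Finset A := Sum.elim (fun j => {j.1, j.2.1}) (fun j => {j.1})
    obtain ⟨t, h₁, h₂⟩ := h (S.biUnion supp)
    refine ⟨DirectSum.toModule k A k (fun a => TensorProduct.lift
      ((Module.Dual.eval k (X.obj a)) ∘ₗ t a)), ?_⟩
    rintro (⟨a, b, φ, v, ξ⟩ | ⟨a, ⟨⟨v, w⟩, hvw⟩, ξ⟩) hj
    · have ha : a ∈ S.biUnion supp := Finset.mem_biUnion.2 ⟨_, hj, by simp [supp]⟩
      have hb : b ∈ S.biUnion supp := Finset.mem_biUnion.2 ⟨_, hj, by simp [supp]⟩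
      simp [l, c, ι, h₁ a ha b hb φ v]
    · have ha : a ∈ S.biUnion supp := Finset.mem_biUnion.2 ⟨_, hj, by simp [supp]⟩
      simp [l, c, ι, h₂ a ha v w hvw])
  let t (a : A) : Y.obj a →ₗ[k] X.obj a := (Module.evalEquiv k (X.obj a)).symm.toLinearMap ∘ₗ
    TensorProduct.curry (Φ ∘ₗ ι a)
  have ht : ∀ a v (ξ : Module.Dual k (X.obj a)), ξ (t a v) = Φ (ι a (v ⊗ₜ ξ)) := by
    intro a v ξ
    exact LinearMap.congr_fun ((Module.evalEquiv k (X.obj a)).apply_symm_apply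
      (TensorProduct.curry (Φ ∘ₗ ι a) v)) ξ
  refine ⟨homMk t ?_, ?_⟩
  · intro a b φ v
    refine (Module.forall_dual_apply_eq_zero_iff k _).1 (fun ξ => ?_) |> sub_eq_zero.1
    have := hΦ (Sum.inl ⟨a, b, φ, v, ξ⟩)
    have h' := ht a v (ξ ∘ₗ act X φ)
    rw [LinearMap.comp_apply] at h'
    rw [map_sub, ht, h', ← map_sub]
    exact this
  · intro a v w hvw
    refine (Module.forall_dual_apply_eq_zero_iff k _).1 (fun ξ => ?_) |> sub_eq_zero.1
    have := hΦ (Sum.inr ⟨a, ⟨⟨v, w⟩, hvw⟩, ξ⟩)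
    rw [map_sub, comp_homMk, ht, sub_eq_zero]
    exact this

end Compactness

section Generation

variable {k} {A : Type} [Category.{0} A] [Preadditive A] [CategoryTheory.Linear k A]
  {X : A ⥤ ModuleCat.{0} k}

theorem exists_generators (hX : IsLfdMod k X) (S : ∀ a, Submodule k (X.obj a)) (F : Finset A) :
    ∃ (r : ℕ) (a : Fin r → A) (v : ∀ i, X.obj (a i)), (∀ i, v i ∈ S (a i)) ∧
      ∀ b, ∀ w ∈ genSub S F b, ∃ φ : ∀ i, a i ⟶ b, w = ∑ i, act X (φ i) (v i) := by
  classical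
  have := hX.2
  have hfg : ∀ a, ∃ (n : ℕ) (s : Fin n → X.obj a), Submodule.span k (Set.range s) = S a :=
    fun a => Submodule.fg_iff_exists_fin_generating_family.1 (IsNoetherian.noetherian (S a))
  choose n s hs using hfg
  let e := Fintype.equivFin (Σ a : F, Fin (n a))
  refine ⟨_, fun i => (e.symm i).1, fun i => s _ (e.symm i).2, fun i => ?_, ?_⟩
  · rw [← hs]
    exact Submodule.subset_span ⟨_, rfl⟩
  intro b w hw
  have hw' : w ∈ Submodule.span k {m | ∃ i, ∃ φ : ((e.symm i).1 : A) ⟶ b,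
      m = act X φ (s _ (e.symm i).2)} := by
    refine Submodule.span_le.2 ?_ hw
    rintro _ ⟨a, ha, φ, v, hv, rfl⟩
    rw [← hs] at hv
    induction hv using Submodule.span_induction with
    | mem v h =>
      obtain ⟨j, rfl⟩ := h
      refine Submodule.subset_span ?_
      have : ∀ p : Σ a : F, Fin (n a), ∀ φ : (p.1 : A) ⟶ b, ∃ i, ∃ ψ : ((e.symm i).1 : A) ⟶ b,
          act X φ (s _ p.2) = act X ψ (s _ (e.symm i).2) := by
        intro p
        obtain ⟨i, rfl⟩ := e.symm.surjective p
        exact fun φ => ⟨i, φ, rfl⟩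
      exact this ⟨⟨a, ha⟩, j⟩ φ
    | zero => rw [map_zero]; exact zero_mem _
    | add v w _ _ hv hw => rw [map_add]; exact add_mem hv hw
    | smul c v _ hv => rw [map_smul]; exact Submodule.smul_mem _ _ hv
  clear hw
  induction hw' using Submodule.span_induction with
  | mem v h =>
    obtain ⟨i, φ, rfl⟩ := h
    refine ⟨Pi.single i φ, ?_⟩
    rw [Finset.sum_eq_single i, Pi.single_eq_same]
    · intro j _ hj
      rw [Pi.single_eq_of_ne hj, act_zero hX.1]
    · simp
  | zero => exact ⟨fun _ => 0, by simp [act_zero hX.1]⟩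
  | add v w _ _ hv hw =>
    obtain ⟨φ, rfl⟩ := hv
    obtain ⟨ψ, rfl⟩ := hw
    exact ⟨φ + ψ, by simp [act_add hX.1, Finset.sum_add_distrib]⟩
  | smul c v _ hv =>
    obtain ⟨φ, rfl⟩ := hv
    exact ⟨c • φ, by simp [act_smul hX.1, Finset.smul_sum]⟩

/-- The direct sum of the representable functors at a finite family of objects. -/
noncomputable def piProj (k : Type) [Field k] {A : Type} [Category.{0} A] [Preadditive A]
    [CategoryTheory.Linear k A] {r : ℕ} (a : Fin r → A) : A ⥤ ModuleCat.{0} k where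
  obj x := ModuleCat.of k (∀ i, a i ⟶ x)
  map φ := ModuleCat.ofHom (LinearMap.pi fun i => Linear.rightComp k (a i) φ ∘ₗ LinearMap.proj i)
  map_id _ := ModuleCat.hom_ext (LinearMap.ext fun v => funext fun i => Category.comp_id (v i))
  map_comp φ ψ := ModuleCat.hom_ext (LinearMap.ext fun v => funext fun i =>
    (Category.assoc (v i) φ ψ).symm)

/-- A vector of morphisms, as an element of `piProj`. -/
def piProj.mk {r : ℕ} {a : Fin r → A} {x : A} (v : ∀ i, a i ⟶ x) : (piProj k a).obj x := v

/-- The components of an element of `piProj`. -/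
def piProj.coord {r : ℕ} {a : Fin r → A} {x : A} (v : (piProj k a).obj x) (i : Fin r) :
    a i ⟶ x := v i

theorem piProj.ext {r : ℕ} {a : Fin r → A} {x : A} {v w : (piProj k a).obj x}
    (h : ∀ i, piProj.coord v i = piProj.coord w i) : v = w := funext h

theorem piProj.coord_act {r : ℕ} {a : Fin r → A} {x y : A} (φ : x ⟶ y) (v : (piProj k a).obj x)
    (i : Fin r) : piProj.coord (act (piProj k a) φ v) i = piProj.coord v i ≫ φ := rfl

theorem piProj.coord_sum {r : ℕ} {a : Fin r → A} {x : A} {ι : Type*} (s : Finset ι)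
    (v : ι → (piProj k a).obj x) (i : Fin r) :
    piProj.coord (∑ j ∈ s, v j) i = ∑ j ∈ s, piProj.coord (v j) i :=
  Finset.sum_apply i s v

theorem isLfdMod_piProj (hfin : ∀ a b : A, FiniteDimensional k (a ⟶ b)) {r : ℕ} (a : Fin r → A) :
    IsLfdMod k (piProj k a) := by
  refine ⟨isMod_of_act ?_ ?_, fun x => ?_⟩
  · intro x y φ ψ v
    exact funext fun i => Preadditive.comp_add _ _ _ _ φ ψ
  · intro x y c φ v
    exact funext fun i => Linear.comp_smul _ _ _ _ c φ
  · exact inferInstanceAs (FiniteDimensional k (∀ i, a i ⟶ x))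

/-- The morphism out of `piProj` given by a family of elements. -/
noncomputable def piProjDesc (hX : IsMod k X) {r : ℕ} (a : Fin r → A) (m : ∀ i, X.obj (a i)) :
    piProj k a ⟶ X :=
  homMk (X := piProj k a)
    (fun x =>
      { toFun := fun v => ∑ i, act X (piProj.coord v i) (m i)
        map_add' := fun v w => by
          rw [← Finset.sum_add_distrib]
          exact Finset.sum_congr rfl fun i _ => act_add hX _ _ _
        map_smul' := fun c v => by
          rw [RingHom.id_apply, Finset.smul_sum]
          exact Finset.sum_congr rfl fun i _ => act_smul hX _ _ _ })
    (fun φ v => by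
      change ∑ i, act X _ (m i) = act X φ (∑ i, act X _ (m i))
      rw [map_sum]
      exact Finset.sum_congr rfl fun i _ => act_comp _ _ _)

theorem comp_piProjDesc (hX : IsMod k X) {r : ℕ} (a : Fin r → A) (m : ∀ i, X.obj (a i)) (x : A)
    (v : (piProj k a).obj x) :
    comp (piProjDesc hX a m) x v = ∑ i, act X (piProj.coord v i) (m i) := rfl

/-- The canonical generators of `piProj`. -/
noncomputable def piProj.gen {r : ℕ} (a : Fin r → A) (i : Fin r) : (piProj k a).obj (a i) :=
  piProj.mk (Pi.single i (𝟙 (a i)) : ∀ j, a j ⟶ a i)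

theorem piProj.eq_sum_gen {r : ℕ} {a : Fin r → A} {x : A} (v : (piProj k a).obj x) :
    v = ∑ i, act (piProj k a) (piProj.coord v i) (piProj.gen a i) := by
  refine piProj.ext fun j => ?_
  rw [piProj.coord_sum, Finset.sum_eq_single j]
  · rw [piProj.coord_act]
    change _ = (Pi.single j (𝟙 (a j)) : ∀ i, a i ⟶ a j) j ≫ _
    rw [Pi.single_eq_same, Category.id_comp]
  · intro i _ hi
    rw [piProj.coord_act]
    change (Pi.single i (𝟙 (a i)) : ∀ j, a j ⟶ a i) j ≫ _ = 0
    rw [Pi.single_eq_of_ne hi.symm, Limits.zero_comp]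
  · simp

end Generation

section IncomingArrows

variable (A : Type) [Category.{0} A] [Preadditive A] [CategoryTheory.Linear k A]

/-- A system of arrows freely generating a linear category, indexed by their targets, together
with a measure of the length of the paths they form. -/
structure IncomingArrows where
  In : A → Type
  fintype : ∀ x, Fintype (In x)
  src : ∀ {x}, In x → A
  hom : ∀ {x} (α : In x), src α ⟶ x
  homFinite : ∀ a b : A, FiniteDimensional k (a ⟶ b)
  indep : ∀ {a x} (g : ∀ α : In x, a ⟶ src α), ∑ α, g α ≫ hom α = 0 → ∀ α, g α = 0
  decomp : ∀ {a x} (φ : a ⟶ x), a ≠ x → ∃ g : ∀ α : In x, a ⟶ src α, φ = ∑ α, g α ≫ hom α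
  ind : ∀ C : ∀ {a x : A}, (a ⟶ x) → Prop, (∀ a, C (𝟙 a)) → (∀ {x} (α : In x), C (hom α)) →
    (∀ {a b c} (φ : a ⟶ b) (ψ : b ⟶ c), C φ → C ψ → C (φ ≫ ψ)) →
    (∀ {a b}, C (0 : a ⟶ b)) → (∀ {a b} (φ ψ : a ⟶ b), C φ → C ψ → C (φ + ψ)) →
    (∀ {a b} (c : k) (φ : a ⟶ b), C φ → C (c • φ)) → ∀ {a x} (φ : a ⟶ x), C φ
  rank : A → A → ℕ
  rank_le : ∀ a {x} (α : In x), rank a (src α) ≤ rank a x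
  rank_lt : ∀ {a x} (α : In x) (g : a ⟶ src α), g ≠ 0 → rank a (src α) < rank a x

attribute [instance] IncomingArrows.fintype

variable {k A}

namespace IncomingArrows

variable (I : IncomingArrows k A)

/-- The objects receiving a nonzero morphism from a member of the family `a`. -/
def Reach {r : ℕ} (_ : IncomingArrows k A) (a : Fin r → A) (x : A) : Prop :=
  ∃ (i : Fin r) (g : a i ⟶ x), g ≠ 0

/-- The total rank of an object with respect to a finite family. -/
def totalRank {r : ℕ} (a : Fin r → A) (x : A) : ℕ := ∑ i, I.rank (a i) x

theorem totalRank_lt {r : ℕ} {a : Fin r → A} {x : A} (α : I.In x) (h : I.Reach a (I.src α)) :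
    I.totalRank a (I.src α) < I.totalRank a x := by
  obtain ⟨i, g, hg⟩ := h
  exact Finset.sum_lt_sum (fun j _ => I.rank_le _ α) ⟨i, Finset.mem_univ i, I.rank_lt α g hg⟩

theorem eq_zero_of_not_reach {r : ℕ} {a : Fin r → A} {x : A} (h : ¬ I.Reach a x)
    (v : (piProj k a).obj x) : v = 0 :=
  piProj.ext fun i => by
    by_contra hi
    exact h ⟨i, _, hi⟩

/-- A set of objects is predecessor closed if it contains the sources of all arrows from
reachable objects to its members. -/
def Closed {r : ℕ} (a : Fin r → A) (F : Finset A) : Prop :=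
  ∀ x ∈ F, ∀ α : I.In x, I.Reach a (I.src α) → I.src α ∈ F

theorem exists_closed_mem {r : ℕ} (a : Fin r → A) (n : ℕ) :
    ∀ x, I.totalRank a x < n → ∃ F, I.Closed a F ∧ x ∈ F := by
  classical
  induction n with
  | zero => simp
  | succ n ih =>
    intro x hx
    have : ∀ α : I.In x, ∃ F, I.Closed a F ∧ (I.Reach a (I.src α) → I.src α ∈ F) := by
      intro α
      by_cases h : I.Reach a (I.src α)
      · obtain ⟨F, hF, hα⟩ := ih (I.src α) (by have := I.totalRank_lt α h; omega)
        exact ⟨F, hF, fun _ => hα⟩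
      · exact ⟨∅, by simp [Closed], fun h' => (h h').elim⟩
    choose F hF hα using this
    refine ⟨insert x (Finset.univ.biUnion F), ?_, Finset.mem_insert_self _ _⟩
    intro y hy β hβ
    rw [Finset.mem_insert] at hy
    refine Finset.mem_insert_of_mem (Finset.mem_biUnion.2 ?_)
    obtain rfl | hy := hy
    · exact ⟨β, Finset.mem_univ β, hα β hβ⟩
    · obtain ⟨α, -, hy⟩ := Finset.mem_biUnion.1 hy
      exact ⟨α, Finset.mem_univ α, hF α y hy β hβ⟩

theorem exists_closed_superset {r : ℕ} (a : Fin r → A) (F₀ : Finset A) :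
    ∃ F, I.Closed a F ∧ F₀ ⊆ F := by
  classical
  choose F hF hx using fun x => I.exists_closed_mem a _ x (Nat.lt_succ_self _)
  refine ⟨F₀.biUnion F, ?_, fun x hx₀ => Finset.mem_biUnion.2 ⟨x, hx₀, hx x⟩⟩
  intro y hy α hα
  obtain ⟨x, hx₀, hy⟩ := Finset.mem_biUnion.1 hy
  exact Finset.mem_biUnion.2 ⟨x, hx₀, hF x y hy α hα⟩

theorem natural {X Y : A ⥤ ModuleCat.{0} k} (hX : IsMod k X) (hY : IsMod k Y)
    (t : ∀ a, X.obj a →ₗ[k] Y.obj a)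
    (h : ∀ {x} (α : I.In x) v, t x (act X (I.hom α) v) = act Y (I.hom α) (t _ v))
    {a b : A} (φ : a ⟶ b) (v : X.obj a) : t b (act X φ v) = act Y φ (t a v) := by
  revert v
  refine I.ind (fun {a b} φ => ∀ v : X.obj a, t b (act X φ v) = act Y φ (t a v))
    ?_ h ?_ ?_ ?_ ?_ φ
  · intro a v
    rw [act_id, act_id]
  · intro a b c φ ψ h₁ h₂ v
    rw [act_comp, act_comp, h₂, h₁]
  · intro a b v
    rw [act_zero hX, act_zero hY, map_zero]
  · intro a b φ ψ h₁ h₂ v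
    rw [act_add hX, act_add hY, map_add, h₁, h₂]
  · intro a b c φ h₁ v
    rw [act_smul hX, act_smul hY, map_smul, h₁]

section Idempotent

variable {X Y : A ⥤ ModuleCat.{0} k} (e : X ⟶ Y)

/-- Endomorphisms of `X.obj x` compatible with `e` and vanishing on its kernel. -/
abbrev LocalSplitting (x : A) : Type :=
  {t : X.obj x →ₗ[k] X.obj x //
    (∀ v, comp e x (t v) = comp e x v) ∧ ∀ v, comp e x v = 0 → t v = 0}

theorem exists_localSplitting {x : A} (p : I.In x → Prop)
    (h₀ : ∀ α : I.In x, ¬ p α → ∀ v, comp e (I.src α) v = 0)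
    (hindep : ∀ l : ∀ α : I.In x, X.obj (I.src α),
      ∑ α, act Y (I.hom α) (comp e _ (l α)) = 0 → ∀ α, comp e _ (l α) = 0)
    (s : ∀ α : I.In x, p α → LocalSplitting e (I.src α)) :
    ∃ t : LocalSplitting e x, ∀ α (h : p α) v,
      t.1 (act X (I.hom α) v) = act X (I.hom α) ((s α h).1 v) := by
  classical
  let b (α : I.In x) : X.obj (I.src α) →ₗ[k] X.obj x :=
    if h : p α then act X (I.hom α) ∘ₗ (s α h).1 else 0
  have hb : ∀ α v, comp e x (b α v) = act Y (I.hom α) (comp e _ v) := by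
    intro α v
    by_cases h : p α
    · simp only [b, dif_pos h, LinearMap.comp_apply]
      rw [comp_act, (s α h).2.1]
    · simp only [b, dif_neg h, LinearMap.zero_apply, map_zero]
      rw [h₀ α h, map_zero]
  have hb₀ : ∀ α v, comp e _ v = 0 → b α v = 0 := by
    intro α v hv
    by_cases h : p α
    · simp only [b, dif_pos h, LinearMap.comp_apply]
      rw [(s α h).2.2 v hv, map_zero]
    · simp only [b, dif_neg h, LinearMap.zero_apply]
  let K := LinearMap.ker (comp e x)
  let f : ((∀ α : I.In x, X.obj (I.src α)) × K) →ₗ[k] X.obj x :=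
    (∑ α, act X (I.hom α) ∘ₗ LinearMap.proj α).coprod K.subtype
  let g : ((∀ α : I.In x, X.obj (I.src α)) × K) →ₗ[k] X.obj x :=
    (∑ α, b α ∘ₗ LinearMap.proj α).coprod 0
  have hf : ∀ l κ, f (l, κ) = ∑ α, act X (I.hom α) (l α) + κ := by
    intro l κ
    simp [f]
  have hg : ∀ l κ, g (l, κ) = ∑ α, b α (l α) := by
    intro l κ
    simp [g]
  have hfe : ∀ l κ, comp e x (f (l, κ)) = ∑ α, act Y (I.hom α) (comp e _ (l α)) := by
    intro l κ
    rw [hf, map_add, map_sum, LinearMap.mem_ker.1 κ.2, add_zero]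
    exact Finset.sum_congr rfl fun α _ => comp_act e _ _
  have hge : ∀ u, (g - f) u ∈ K := by
    rintro ⟨l, κ⟩
    rw [LinearMap.mem_ker, LinearMap.sub_apply, map_sub, hfe, hg, map_sum, sub_eq_zero]
    exact Finset.sum_congr rfl fun α _ => hb α _
  obtain ⟨d, hd⟩ := exists_comp_eq_of_ker_le f ((g - f).codRestrict K hge) (by
    rintro ⟨l, κ⟩ hu
    rw [LinearMap.mem_ker] at hu ⊢
    have h := hindep l (by rw [← hfe l κ, hu, map_zero])
    refine Subtype.ext ?_
    change g (l, κ) - f (l, κ) = 0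
    rw [hu, hg, sub_zero]
    exact Finset.sum_eq_zero fun α _ => hb₀ α _ (h α))
  have hd' : ∀ u, f u + d (f u) = g u := by
    intro u
    have := congrArg Subtype.val (LinearMap.congr_fun hd u)
    change ((d (f u) : K) : X.obj x) = g u - f u at this
    rw [this, add_sub_cancel]
  refine ⟨⟨LinearMap.id + K.subtype ∘ₗ d, fun v => ?_, fun v hv => ?_⟩, fun α h v => ?_⟩
  · change comp e x (v + d v) = _
    rw [map_add, LinearMap.mem_ker.1 (d v).2, add_zero]
  · have h₁ := hd' (0, ⟨v, hv⟩)
    rw [hf, hg] at h₁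
    simpa using h₁
  · have h₁ := hd' (Pi.single α v, 0)
    rw [hf, hg, Finset.sum_eq_single α, Finset.sum_eq_single α, Pi.single_eq_same] at h₁
    · simp only [ZeroMemClass.coe_zero, add_zero] at h₁
      refine h₁.trans ?_
      simp only [b, dif_pos h]
      rfl
    · intro β _ hβ
      rw [Pi.single_eq_of_ne hβ, map_zero]
    · simp
    · intro β _ hβ
      rw [Pi.single_eq_of_ne hβ, map_zero]
    · simp

/-- A morphism whose image is free on its arrows, and supported on objects where lengths of paths
are bounded, has a kernel which is a direct summand. -/
theorem exists_projection (hX : IsMod k X) (R : A → Prop) (rk : A → ℕ)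
    (hlt : ∀ {x} (α : I.In x), R (I.src α) → rk (I.src α) < rk x)
    (h₀ : ∀ x, ¬ R x → ∀ v, comp e x v = 0)
    (hindep : ∀ {x} (l : ∀ α : I.In x, X.obj (I.src α)),
      ∑ α, act Y (I.hom α) (comp e _ (l α)) = 0 → ∀ α, comp e _ (l α) = 0) :
    ∃ π : X ⟶ X, π ≫ e = e ∧ ∀ x v, comp e x v = 0 → comp π x v = 0 := by
  have step : ∀ x (s : ∀ y, rk y < rk x → LocalSplitting e y), ∃ t : LocalSplitting e x,
      ∀ (α : I.In x) (h : rk (I.src α) < rk x) v,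
        t.1 (act X (I.hom α) v) = act X (I.hom α) ((s _ h).1 v) := fun x s =>
    I.exists_localSplitting e (fun α => rk (I.src α) < rk x)
      (fun α hα => h₀ _ fun hR => hα (hlt α hR)) hindep (fun α h => s _ h)
  choose T hT using step
  let t : ∀ x, LocalSplitting e x := (measure rk).wf.fix T
  have ht : ∀ x, t x = T x (fun y _ => t y) := fun x => (measure rk).wf.fix_eq T x
  refine ⟨homMk (fun x => (t x).1) (fun φ v => I.natural hX hX (fun x => (t x).1) ?_ φ v), ?_, ?_⟩
  · intro x α v
    by_cases h : rk (I.src α) < rk x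
    · rw [ht x]
      exact hT x _ α h v
    · have hv : ∀ v, comp e _ v = 0 := h₀ _ fun hR => h (hlt α hR)
      rw [(t _).2.2 v (hv v), map_zero]
      exact (t x).2.2 _ (by rw [comp_act, hv, map_zero])
  · exact hom_ext_comp fun x v => (comp_comp _ _ _ _).trans ((t x).2.1 v)
  · exact fun x v hv => (t x).2.2 v hv

end Idempotent

end IncomingArrows

end IncomingArrows

section Relations

variable {k} {A : Type} [Category.{0} A] {L M : A ⥤ ModuleCat.{0} k}

/-- If `f` and `p` are jointly surjective and `f` extends over the relations between them,
then `f` is a split monomorphism. -/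
theorem isSplitMono_of_extension {P : A ⥤ ModuleCat.{0} k} (f : L ⟶ M) (p : P ⟶ M) (ρ : P ⟶ L)
    (hsurj : ∀ x (v : M.obj x), ∃ u l, v = comp p x u + comp f x l)
    (hρ : ∀ x u l, comp p x u = comp f x l → comp ρ x u = l) : IsSplitMono f := by
  have key : ∀ x, ∃ d : M.obj x →ₗ[k] L.obj x,
      d ∘ₗ (comp p x).coprod (comp f x) = (comp ρ x).coprod LinearMap.id := by
    intro x
    refine exists_comp_eq_of_ker_le _ _ ?_
    rintro ⟨u, l⟩ h
    rw [LinearMap.mem_ker, LinearMap.coprod_apply] at h ⊢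
    rw [hρ x u (-l) (by rw [map_neg]; exact eq_neg_of_add_eq_zero_left h)]
    simp
  choose d hd using key
  have hd' : ∀ x u l, d x (comp p x u + comp f x l) = comp ρ x u + l := by
    intro x u l
    exact LinearMap.congr_fun (hd x) (u, l)
  refine ⟨⟨homMk d ?_, hom_ext_comp fun x l => ?_⟩⟩
  · intro x y φ v
    obtain ⟨u, l, rfl⟩ := hsurj x v
    rw [hd', map_add (act M φ), ← comp_act, ← comp_act, hd', map_add, comp_act]
  · have := hd' x 0 l
    simp only [map_zero, zero_add] at this
    rw [comp_comp, comp_id]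
    exact this

/-- The relations modulo the image of a monomorphism `f` between elements of `M`. -/
noncomputable def relations (f : L ⟶ M) {P : A ⥤ ModuleCat.{0} k} (p : P ⟶ M) (x : A) :
    Submodule k (P.obj x) :=
  (LinearMap.range (comp f x)).comap (comp p x)

end Relations

section Cokernel

variable {k} {A : Type} [Category.{0} A] [Preadditive A] [CategoryTheory.Linear k A]
  {L M : A ⥤ ModuleCat.{0} k}

/-- The cokernel of `f` is finitely presented, in terms of elements: `m` is a finite generating
family modulo the image of `f`, and `κ` is a finite generating family of its relations. -/
def CokernelFP (f : L ⟶ M) : Prop :=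
  ∃ (r : ℕ) (a : Fin r → A) (m : ∀ i, M.obj (a i)),
    (∀ x (v : M.obj x), ∃ (φ : ∀ i, a i ⟶ x) (l : L.obj x),
      v = ∑ i, act M (φ i) (m i) + comp f x l) ∧
    ∃ (s : ℕ) (c : Fin s → A) (κ : ∀ j i, a i ⟶ c j),
      (∀ j, ∃ l, ∑ i, act M (κ j i) (m i) = comp f (c j) l) ∧
      ∀ x (φ : ∀ i, a i ⟶ x) (l : L.obj x), ∑ i, act M (φ i) (m i) = comp f x l →
        ∃ ψ : ∀ j, c j ⟶ x, ∀ i, φ i = ∑ j, κ j i ≫ ψ j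

/-- The cokernel of an irreducible monomorphism is finitely generated. -/
theorem Irred.exists_generating_finset (hL : IsLfdMod k L) (hM : IsLfdMod k M) {f : L ⟶ M}
    (hirr : Irred k f) :
    ∃ F : Finset A, ∀ x, LinearMap.range (comp f x) ⊔ genSub (fun _ => ⊤) F x = ⊤ := by
  by_contra hcon
  push Not at hcon
  refine hirr.1 ?_
  obtain ⟨ρ, hρ⟩ := exists_hom_of_finite (Y := M) hL.2 (fun a v w => v = comp f a w) (by
    intro F
    let S (x : A) : Submodule k (M.obj x) := LinearMap.range (comp f x) ⊔ genSub (fun _ => ⊤) F x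
    have hS : Stable S := by
      intro a b φ v hv
      obtain ⟨_, ⟨l, rfl⟩, w, hw, rfl⟩ := Submodule.mem_sup.1 hv
      rw [map_add]
      refine add_mem (Submodule.mem_sup_left ⟨act L φ l, comp_act f φ l⟩)
        (Submodule.mem_sup_right (genSub_stable _ F φ hw))
    obtain ⟨g, hg⟩ := exists_subF_lift S hS f fun a v => Submodule.mem_sup_left ⟨v, rfl⟩
    obtain h | h := hirr.2.2 (hM.subF S hS) g (subι S hS) hg
    · obtain ⟨⟨r, hr⟩⟩ := h
      choose t ht using fun a => LinearMap.exists_extend (p := S a) (comp r a)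
      have ht' : ∀ a (v : (subF S hS).obj a), t a (comp (subι S hS) a v) = comp r a v :=
        fun a v => LinearMap.congr_fun (ht a) v
      refine ⟨t, ?_, ?_⟩
      · intro a ha b hb φ v
        have hv : v ∈ S a :=
          Submodule.mem_sup_right (le_genSub (X := M) (fun _ => ⊤) ha Submodule.mem_top)
        obtain ⟨u, rfl⟩ : ∃ u, comp (subι S hS) a u = v := ⟨⟨v, hv⟩, rfl⟩
        rw [← comp_act, ht', ht', comp_act]
      · rintro a - v w rfl
        rw [← hg, comp_comp, ht', ← comp_comp, hr, comp_id]
    · obtain ⟨x, hx⟩ := hcon F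
      refine (hx (eq_top_iff.2 fun v _ => ?_)).elim
      obtain ⟨u, rfl⟩ := surjective_of_epi (subι S hS) x v
      exact u.2)
  exact ⟨⟨ρ, hom_ext_comp fun a v => by rw [comp_comp, comp_id, hρ a _ v rfl]⟩⟩

/-- The quotient of a subfunctor `S` of a direct sum of representables by the subfunctor generated
by its values on a predecessor closed finite set satisfies the freeness condition on arrows. -/
theorem IncomingArrows.mem_genSub_of_sum_mem (I : IncomingArrows k A) {r : ℕ} {a : Fin r → A}
    {S : ∀ x, Submodule k ((piProj k a).obj x)} {F : Finset A} (hF : I.Closed a F)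
    {x : A} (u : ∀ α : I.In x, (piProj k a).obj (I.src α)) (hu : ∀ α, u α ∈ S (I.src α))
    (h : ∑ α, act (piProj k a) (I.hom α) (u α) ∈ genSub S F x) (α : I.In x) :
    u α ∈ genSub S F (I.src α) := by
  classical
  have hP := isLfdMod_piProj (k := k) I.homFinite a
  by_cases hx : x ∈ F
  · by_cases hα : I.Reach a (I.src α)
    · exact le_genSub S (hF x hx α hα) (hu α)
    · rw [I.eq_zero_of_not_reach hα (u α)]
      exact zero_mem _
  · obtain ⟨w, hw, hsum⟩ : ∃ w : ∀ α : I.In x, (piProj k a).obj (I.src α),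
        (∀ α, w α ∈ genSub S F (I.src α)) ∧
        ∑ α, act (piProj k a) (I.hom α) (u α) = ∑ α, act (piProj k a) (I.hom α) (w α) := by
      generalize ∑ α, act (piProj k a) (I.hom α) (u α) = v at h
      induction h using Submodule.span_induction with
      | mem v h =>
        obtain ⟨y, hy, φ, v, hv, rfl⟩ := h
        obtain ⟨g, rfl⟩ := I.decomp φ (fun e => hx (e ▸ hy))
        refine ⟨fun α => act (piProj k a) (g α) v,
          fun α => genSub_stable S F _ (le_genSub S hy hv), ?_⟩
        rw [act_sum hP.1]
        exact Finset.sum_congr rfl fun α _ => act_comp _ _ _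
      | zero => exact ⟨fun _ => 0, fun _ => zero_mem _, by simp⟩
      | add v v' _ _ h h' =>
        obtain ⟨w, hw, rfl⟩ := h
        obtain ⟨w', hw', rfl⟩ := h'
        exact ⟨fun α => w α + w' α, fun α => add_mem (hw α) (hw' α),
          by simp only [map_add, Finset.sum_add_distrib]⟩
      | smul c v _ h =>
        obtain ⟨w, hw, rfl⟩ := h
        exact ⟨fun α => c • w α, fun α => Submodule.smul_mem _ _ (hw α),
          by simp only [map_smul, Finset.smul_sum]⟩
    have : u α = w α := piProj.ext fun i => by
      refine sub_eq_zero.1 (I.indep (fun α => piProj.coord (u α) i - piProj.coord (w α) i) ?_ α)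
      have := congrArg (fun v => piProj.coord v i) hsum
      simp only [piProj.coord_sum, piProj.coord_act] at this
      simp only [Preadditive.sub_comp, Finset.sum_sub_distrib, this, sub_self]
    rw [this]
    exact hw α

/-- For an irreducible monomorphism, some finitely generated subfunctor `R` of relations admits
a lift of the projection to the cokernel along the quotient by `R`. -/
theorem Irred.exists_lift (hL : IsLfdMod k L) {f : L ⟶ M} (hirr : Irred k f)
    {P : A ⥤ ModuleCat.{0} k} (hP : IsLfdMod k P) (p : P ⟶ M)
    (hsurj : ∀ x (v : M.obj x), ∃ u l, v = comp p x u + comp f x l)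
    (good : Finset A → Prop) (hgood : ∀ F, ∃ G, good G ∧ F ⊆ G) :
    ∃ F, good F ∧ ∃ t : M ⟶ quotF _ (genSub_stable (relations f p) F),
      ∀ x v, ∃ u l, comp t x v = comp (quotπ _ (genSub_stable (relations f p) F)) x u ∧
        v = comp p x u + comp f x l := by
  by_contra hcon
  push Not at hcon
  obtain ⟨ρ, hρ⟩ := exists_hom_of_finite (Y := P) hL.2
    (fun x u l => comp p x u = comp f x l) (by
    intro F₀
    obtain ⟨F, hFgood, hF⟩ := hgood F₀
    have hG := genSub_stable (relations f p) F
    let R (x : A) : Submodule k ((prodF L P).obj x) :=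
      LinearMap.ker (comp (prodDesc f p) x) ⊓
        (genSub (relations f p) F x).comap (comp (prodSnd L P) x)
    have hR : Stable R := by
      rintro x y φ u ⟨h₁, h₂⟩
      refine ⟨?_, ?_⟩
      · change comp (prodDesc f p) y _ = 0
        rw [comp_act, LinearMap.mem_ker.1 h₁, map_zero]
      · change comp (prodSnd L P) y _ ∈ genSub (relations f p) F y
        rw [comp_act]
        exact hG φ h₂
    obtain ⟨h, hh⟩ := exists_quotF_desc R hR (prodDesc f p) fun x v hv => hv.1
    have hker : ∀ x, ∀ v ∈ R x, comp (prodSnd L P ≫ quotπ (X := P) _ hG) x v = 0 := by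
      rintro x v ⟨-, hv⟩
      rw [comp_comp]
      exact (comp_quotπ_eq_zero _ hG x _).2 hv
    obtain ⟨τ, hτ⟩ := exists_quotF_desc R hR (prodSnd L P ≫ quotπ (X := P) _ hG) hker
    have hinl : (prodInl L P ≫ quotπ R hR) ≫ h = f := by
      rw [Category.assoc, hh]
      refine hom_ext_comp fun x l => ?_
      rw [comp_comp]
      change comp f x l + comp p x 0 = _
      rw [map_zero, add_zero]
    obtain ⟨⟨r, hr⟩⟩ | ⟨⟨s, hs⟩⟩ := hirr.2.2 ((hL.prodF hP).quotF R hR) _ h hinl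
    · refine ⟨comp (prodInr L P ≫ quotπ R hR ≫ r), fun a _ b _ φ v => comp_act _ φ v, ?_⟩
      intro a ha u l hul
      have hl : comp ((prodInl L P ≫ quotπ R hR) ≫ r) a l = l := by rw [hr, comp_id]
      rw [← hl]
      simp only [comp_comp]
      refine congrArg (comp r a) (sub_eq_zero.1 ?_)
      rw [← map_sub]
      refine (comp_quotπ_eq_zero R hR a _).2 ⟨LinearMap.mem_ker.2 ?_, ?_⟩
      · rw [map_sub]
        change (comp f a 0 + comp p a u) - (comp f a l + comp p a 0) = 0
        rw [map_zero, map_zero, hul, zero_add, add_zero, sub_self]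
      · change u - 0 ∈ genSub (relations f p) F a
        rw [sub_zero]
        exact le_genSub _ (hF ha) ⟨l, hul.symm⟩
    · obtain ⟨x, v, hxv⟩ := hcon F hFgood (s ≫ τ)
      obtain ⟨z, hz⟩ := comp_quotπ_surjective R hR x (comp s x v)
      refine (hxv (comp (prodSnd L P) x z) z.1 ?_ ?_).elim
      · rw [comp_comp, ← hz, ← comp_comp, hτ, comp_comp]
      · have h₁ : comp (s ≫ h) x v = v := by rw [hs, comp_id]
        rw [comp_comp, ← hz, ← comp_comp, hh] at h₁
        rw [← h₁, add_comm]
        rfl)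
  exact hirr.1 (isSplitMono_of_extension f p ρ hsurj hρ)

theorem Irred.cokernelFP (I : IncomingArrows k A) (hL : IsLfdMod k L) (hM : IsLfdMod k M) {f : L ⟶ M}
    (hirr : Irred k f)
    (hind : ∀ π : L ⟶ L, π ≫ π = π → π = 0 ∨ π = 𝟙 L)
    {a₀ : A} {v₀ : L.obj a₀} (hv₀ : v₀ ≠ 0) : CokernelFP f := by
  classical
  obtain ⟨F₁, hF₁⟩ := hirr.exists_generating_finset hL hM
  obtain ⟨r, a, m, -, hm⟩ := exists_generators hM (fun _ => ⊤) F₁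
  have hP := isLfdMod_piProj (k := k) I.homFinite a
  let p := piProjDesc hM.1 a m
  have hsurj : ∀ x (v : M.obj x), ∃ u l, v = comp p x u + comp f x l := by
    intro x v
    have hv : v ∈ LinearMap.range (comp f x) ⊔ genSub (fun _ => ⊤) F₁ x := by
      rw [hF₁]
      exact Submodule.mem_top
    obtain ⟨_, ⟨l, rfl⟩, w, hw, rfl⟩ := Submodule.mem_sup.1 hv
    obtain ⟨φ, rfl⟩ := hm x w hw
    exact ⟨piProj.mk φ, l, add_comm _ _⟩
  obtain ⟨F, ⟨hF, ha₀⟩, t, ht⟩ := hirr.exists_lift hL hP p hsurj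
    (fun F => I.Closed a F ∧ a₀ ∈ F) (fun F => by
      obtain ⟨G, hG, hFG⟩ := I.exists_closed_superset a (insert a₀ F)
      exact ⟨G, ⟨hG, hFG (Finset.mem_insert_self _ _)⟩,
        (Finset.subset_insert _ _).trans hFG⟩)
  let K := relations f p
  have hK := genSub_stable K F
  let q := quotπ _ hK
  have hq : ∀ x u, comp q x u = 0 ↔ u ∈ genSub K F x := comp_quotπ_eq_zero _ hK
  have ht' : ∀ x l, ∃ u ∈ K x, comp (f ≫ t) x l = comp q x u := by
    intro x l
    obtain ⟨u, l', h₁, h₂⟩ := ht x (comp f x l)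
    refine ⟨u, ⟨l - l', ?_⟩, (comp_comp f t x l).trans h₁⟩
    rw [map_sub, h₂, add_sub_cancel_right]
  obtain ⟨π, hπ, hπ₀⟩ := I.exists_projection (f ≫ t) hL.1 (I.Reach a) (I.totalRank a)
    (fun α h => I.totalRank_lt α h) (by
      intro x hx v
      obtain ⟨u, -, hu⟩ := ht' x v
      rw [hu, I.eq_zero_of_not_reach hx u, map_zero]) (by
      intro x l hl α
      choose u hu hul using fun α => ht' _ (l α)
      rw [hul, hq]
      refine I.mem_genSub_of_sum_mem hF u hu ?_ α
      rw [← hq, map_sum, ← hl]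
      exact Finset.sum_congr rfl fun β _ => by rw [comp_act, hul])
  have hft : f ≫ t = 0 := by
    obtain h | h := hind π (hom_ext_comp fun x v => by
      rw [comp_comp, ← sub_eq_zero, ← map_sub]
      refine hπ₀ x _ ?_
      rw [map_sub, ← comp_comp π, hπ, sub_self])
    · rw [← hπ, h, Limits.zero_comp]
    · refine (hv₀ ?_).elim
      have h₁ := hπ₀ a₀ v₀ (by
        obtain ⟨u, hu, hu'⟩ := ht' a₀ v₀
        rw [hu', hq]
        exact le_genSub K ha₀ hu)
      rwa [h, comp_id] at h₁
  choose u l htu hm' using fun i => ht (a i) (m i)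
  have hpgen : ∀ i, comp p (a i) (piProj.gen a i) = m i := by
    intro i
    rw [comp_piProjDesc, Finset.sum_eq_single i]
    · change act M ((Pi.single i (𝟙 (a i)) : ∀ j, a j ⟶ a i) i) (m i) = _
      rw [Pi.single_eq_same, act_id]
    · intro j _ hj
      change act M ((Pi.single i (𝟙 (a i)) : ∀ j, a j ⟶ a i) j) (m j) = _
      rw [Pi.single_eq_of_ne hj, act_zero hM.1]
    · simp
  let F' := F ∪ Finset.univ.image a
  have hKgen : ∀ x, K x ≤ genSub K F' x := by
    rintro x κ ⟨l', hl'⟩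
    have h₁ : κ = ∑ i, act (piProj k a) (piProj.coord κ i) (piProj.gen a i - u i) +
        ∑ i, act (piProj k a) (piProj.coord κ i) (u i) := by
      simp only [map_sub, Finset.sum_sub_distrib, sub_add_cancel]
      exact piProj.eq_sum_gen κ
    rw [h₁]
    refine add_mem (sum_mem fun i _ => genSub_stable K F' _ (le_genSub K ?_ ?_)) ?_
    · exact Finset.mem_union_right _ (Finset.mem_image_of_mem a (Finset.mem_univ i))
    · refine ⟨l i, ?_⟩
      rw [map_sub, hpgen]
      exact eq_sub_of_add_eq' (hm' i).symm
    · refine genSub_mono K Finset.subset_union_left x ((hq x _).1 ?_)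
      have h₂ : comp t x (comp p x κ) = 0 := by
        rw [← hl', ← comp_comp, hft, comp_zero]
      rw [comp_piProjDesc, map_sum] at h₂
      rw [map_sum, ← h₂]
      exact Finset.sum_congr rfl fun i _ => by rw [comp_act, comp_act, htu]
  obtain ⟨s, c, κ, hκ, hgen⟩ := exists_generators hP K F'
  refine ⟨r, a, m, ?_, s, c, fun j i => piProj.coord (κ j) i, ?_, ?_⟩
  · intro x v
    obtain ⟨u, l, h⟩ := hsurj x v
    exact ⟨piProj.coord u, l, h⟩
  · intro j
    obtain ⟨l, hl⟩ := hκ j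
    exact ⟨l, hl.symm⟩
  · intro x φ l h
    obtain ⟨ψ, hψ⟩ := hgen x (piProj.mk φ) (hKgen x ⟨l, h.symm⟩)
    refine ⟨ψ, fun i => ?_⟩
    have := congrArg (fun v => piProj.coord v i) hψ
    rw [piProj.coord_sum] at this
    exact this

end Cokernel

section Biproducts

variable {k} {A : Type} [Category.{0} A] {X Y : A ⥤ ModuleCat.{0} k}

theorem comp_sum {ι : Type*} (s : Finset ι) (f : ι → (X ⟶ Y)) (a : A) (v : X.obj a) :
    comp (∑ i ∈ s, f i) a v = ∑ i ∈ s, comp (f i) a v := by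
  simp [comp]

theorem exists_kernel_elem (f : X ⟶ Y) (a : A) (v : X.obj a) (hv : comp f a v = 0) :
    ∃ w, comp (kernel.ι f) a w = v := by
  have hS : Stable fun a => LinearMap.ker (comp f a) := by
    intro a b φ v hv
    rw [LinearMap.mem_ker] at hv ⊢
    rw [comp_act, hv, map_zero]
  have h : subι _ hS ≫ f = 0 := hom_ext_comp fun a v => by
    rw [comp_comp, comp_zero]
    exact LinearMap.mem_ker.1 v.2
  refine ⟨comp (kernel.lift f _ h) a ⟨v, hv⟩, (comp_comp _ _ a _).symm.trans ?_⟩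
  rw [kernel.lift_ι]
  rfl

theorem exists_of_cokernel_eq_zero (f : X ⟶ Y) (a : A) (v : Y.obj a)
    (hv : comp (cokernel.π f) a v = 0) : ∃ w, comp f a w = v := by
  have hS : Stable fun a => LinearMap.range (comp f a) := by
    rintro a b φ _ ⟨w, rfl⟩
    exact ⟨act X φ w, comp_act f φ w⟩
  have h : f ≫ quotπ _ hS = 0 := hom_ext_comp fun a v => by
    rw [comp_comp, comp_zero]
    exact (comp_quotπ_eq_zero _ hS a _).2 ⟨v, rfl⟩
  refine (comp_quotπ_eq_zero _ hS a v).1 ?_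
  rw [← cokernel.π_desc f _ h, comp_comp, hv, map_zero]

variable {r : ℕ} (Z : Fin r → (A ⥤ ModuleCat.{0} k))

/-- An element of a biproduct, given by its components. -/
noncomputable def biproductMk {x : A} (v : ∀ i, (Z i).obj x) : (⨁ Z).obj x :=
  ∑ i, comp (biproduct.ι Z i) x (v i)

variable {Z}

theorem comp_biproductMk {x : A} (v : ∀ i, (Z i).obj x) (j : Fin r) :
    comp (biproduct.π Z j) x (biproductMk Z v) = v j := by
  rw [biproductMk, map_sum, Finset.sum_eq_single j]
  · rw [← comp_comp, biproduct.ι_π_self, comp_id]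
  · intro i _ hi
    rw [← comp_comp, biproduct.ι_π_ne Z hi, comp_zero]
  · simp

theorem biproduct_elem_ext {x : A} {z w : (⨁ Z).obj x}
    (h : ∀ i, comp (biproduct.π Z i) x z = comp (biproduct.π Z i) x w) : z = w := by
  have total : ∀ z : (⨁ Z).obj x,
      z = ∑ i, comp (biproduct.ι Z i) x (comp (biproduct.π Z i) x z) := by
    intro z
    have := congrArg (fun f => comp f x z) (biproduct.total (f := Z))
    simp only [comp_sum, comp_id, comp_comp] at this
    exact this.symm
  rw [total z, total w]
  exact Finset.sum_congr rfl fun i _ => by rw [h i]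

theorem comp_biproduct_desc (f : ∀ i, Z i ⟶ Y) {x : A} (z : (⨁ Z).obj x) :
    comp (biproduct.desc f) x z = ∑ i, comp (f i) x (comp (biproduct.π Z i) x z) := by
  rw [biproduct.desc_eq, comp_sum]
  exact Finset.sum_congr rfl fun i _ => comp_comp _ _ _ _

end Biproducts

section Presentation

variable {k} {A : Type} [Category.{0} A] [Preadditive A] [CategoryTheory.Linear k A]
  {X Y L M : A ⥤ ModuleCat.{0} k}

theorem IsMod.of_injective (hY : IsMod k Y) (f : X ⟶ Y)
    (h : ∀ a, Function.Injective (comp f a)) : IsMod k X := by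
  refine isMod_of_act (fun φ ψ v => h _ ?_) (fun c φ v => h _ ?_)
  · rw [map_add, comp_act, comp_act, comp_act, act_add hY]
  · rw [map_smul, comp_act, comp_act, act_smul hY]

theorem IsMod.of_surjective (hX : IsMod k X) (f : X ⟶ Y)
    (h : ∀ a, Function.Surjective (comp f a)) : IsMod k Y := by
  refine isMod_of_act (fun φ ψ v => ?_) (fun c φ v => ?_)
  · obtain ⟨v, rfl⟩ := h _ v
    rw [← comp_act, ← comp_act, ← comp_act, act_add hX, map_add]
  · obtain ⟨v, rfl⟩ := h _ v
    rw [← comp_act, ← comp_act, act_smul hX, map_smul]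

theorem IsMod.biproduct {r : ℕ} {Z : Fin r → (A ⥤ ModuleCat.{0} k)} (h : ∀ i, IsMod k (Z i)) :
    IsMod k (⨁ Z) := by
  refine isMod_of_act (fun φ ψ v => ?_) (fun c φ v => ?_) <;>
    refine biproduct_elem_ext fun i => ?_
  · rw [map_add, comp_act, comp_act, comp_act, act_add (h i)]
  · rw [map_smul, comp_act, comp_act, act_smul (h i)]

theorem isMod_projAt (a : A) : IsMod k (ProjAt k a) :=
  isMod_of_act (X := ProjAt k a) (fun φ ψ v => Preadditive.comp_add _ _ _ v φ ψ)
    (fun c φ v => Linear.comp_smul _ _ _ v c φ)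

theorem isMod_injAt (a : A) : IsMod k (InjAt k a) := by
  refine isMod_of_act (X := InjAt k a) (fun {x y} φ ψ v => ?_) (fun {x y} c φ v => ?_) <;>
    refine LinearMap.ext fun g => ?_ <;> let v' : Module.Dual k (x ⟶ a) := v
  · exact (congrArg v' (Preadditive.add_comp _ _ _ φ ψ g)).trans (map_add v' _ _)
  · exact (congrArg v' (Linear.smul_comp _ _ _ c φ g)).trans (map_smul v' _ _)

/-- The morphism from a sum of projectives given by a family of elements. -/
noncomputable def projDesc (hX : IsMod k X) {r : ℕ} (a : Fin r → A) (m : ∀ i, X.obj (a i)) :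
    (⨁ fun i => ProjAt k (a i)) ⟶ X :=
  biproduct.desc fun i => homMk (X := ProjAt k (a i))
    (fun x =>
      { toFun := fun φ : a i ⟶ x => act X φ (m i)
        map_add' := fun φ ψ => act_add hX φ ψ (m i)
        map_smul' := fun c φ => act_smul hX c φ (m i) })
    (fun φ ψ => act_comp ψ φ (m i))

/-- The component of an element of a sum of projectives. -/
noncomputable def projCoord {r : ℕ} {a : Fin r → A} {x : A}
    (z : (⨁ fun i => ProjAt k (a i)).obj x) (i : Fin r) : a i ⟶ x :=
  comp (biproduct.π (fun i => ProjAt k (a i)) i) x z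

theorem comp_projDesc (hX : IsMod k X) {r : ℕ} (a : Fin r → A) (m : ∀ i, X.obj (a i)) (x : A)
    (z : (⨁ fun i => ProjAt k (a i)).obj x) :
    comp (projDesc hX a m) x z = ∑ i, act X (projCoord z i) (m i) :=
  comp_biproduct_desc _ z

theorem projCoord_mk {r : ℕ} {a : Fin r → A} {x : A} (φ : ∀ i, a i ⟶ x) (i : Fin r) :
    projCoord (biproductMk (fun i => ProjAt k (a i)) φ) i = φ i :=
  comp_biproductMk (Z := fun i => ProjAt k (a i)) φ i

theorem isFG_of_generators (hX : IsMod k X) {r : ℕ} (a : Fin r → A) (m : ∀ i, X.obj (a i))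
    (h : ∀ x v, ∃ φ : ∀ i, a i ⟶ x, v = ∑ i, act X (φ i) (m i)) :
    Epi (projDesc hX a m) := by
  refine epi_of_surjective _ fun x v => ?_
  obtain ⟨φ, rfl⟩ := h x v
  refine ⟨biproductMk _ φ, ?_⟩
  rw [comp_projDesc]
  exact Finset.sum_congr rfl fun i _ => by rw [projCoord_mk]

theorem CokernelFP.isFP {f : L ⟶ M} (hM : IsMod k M) (h : CokernelFP f) :
    IsFP k (cokernel f) := by
  obtain ⟨r, a, m, hm, s, c, κ, hκ, hrel⟩ := h
  have hC : IsMod k (cokernel f) := hM.of_surjective (cokernel.π f) (surjective_of_epi _)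
  have hf : ∀ x l, comp (cokernel.π f) x (comp f x l) = 0 := fun x l => by
    rw [← comp_comp, cokernel.condition, comp_zero]
  let p := projDesc hC a fun i => comp (cokernel.π f) _ (m i)
  have hp : ∀ x z, comp p x z = comp (cokernel.π f) x (∑ i, act M (projCoord z i) (m i)) := by
    intro x z
    rw [comp_projDesc, map_sum]
    exact Finset.sum_congr rfl fun i _ => (comp_act _ _ _).symm
  refine ⟨r, a, p, isFG_of_generators hC a _ fun x v => ?_, ?_⟩
  · obtain ⟨v, rfl⟩ := surjective_of_epi (cokernel.π f) x v
    obtain ⟨φ, l, rfl⟩ := hm x v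
    refine ⟨φ, ?_⟩
    rw [map_add, hf, add_zero, map_sum]
    exact Finset.sum_congr rfl fun i _ => comp_act _ _ _
  · have hK : IsMod k (kernel p) :=
      (IsMod.biproduct fun i => isMod_projAt (a i)).of_injective (kernel.ι p)
        (injective_of_mono _)
    have hg : ∀ j, ∃ w, comp (kernel.ι p) (c j) w = biproductMk _ (κ j) := by
      intro j
      refine exists_kernel_elem p _ _ ?_
      obtain ⟨l, hl⟩ := hκ j
      simp only [hp, projCoord_mk]
      rw [hl, hf]
    choose w hw using hg
    refine ⟨s, c, projDesc hK c w, isFG_of_generators hK c w fun x v => ?_⟩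
    have hv : comp p x (comp (kernel.ι p) x v) = 0 := by
      rw [← comp_comp, kernel.condition, comp_zero]
    rw [hp] at hv
    obtain ⟨l, hl⟩ := exists_of_cokernel_eq_zero f x _ hv
    obtain ⟨ψ, hψ⟩ := hrel x _ l hl.symm
    refine ⟨ψ, injective_of_mono (kernel.ι p) x (biproduct_elem_ext fun i => ?_)⟩
    refine (hψ i).trans ?_
    rw [map_sum, map_sum]
    refine Finset.sum_congr rfl fun j _ => ?_
    rw [comp_act, comp_act, hw]
    exact congrArg (fun g => g ≫ ψ j) (projCoord_mk (k := k) (κ j) i).symm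

/-- The kernel of `f` is finitely co-presented, in terms of functionals: the dual statement
of `CokernelFP`. -/
def KernelFCP (f : L ⟶ M) : Prop :=
  ∃ (r : ℕ) (b : Fin r → A) (ξ : ∀ i, Module.Dual k (L.obj (b i))),
    (∀ x (θ : Module.Dual k (L.obj x)),
      ∃ (φ : ∀ i, x ⟶ b i) (η : Module.Dual k (M.obj x)),
        θ = ∑ i, ξ i ∘ₗ act L (φ i) + η ∘ₗ comp f x) ∧
    ∃ (s : ℕ) (c : Fin s → A) (κ : ∀ j i, c j ⟶ b i),
      (∀ j, ∃ η : Module.Dual k (M.obj (c j)), ∑ i, ξ i ∘ₗ act L (κ j i) = η ∘ₗ comp f (c j)) ∧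
      ∀ x (φ : ∀ i, x ⟶ b i) (η : Module.Dual k (M.obj x)),
        ∑ i, ξ i ∘ₗ act L (φ i) = η ∘ₗ comp f x →
        ∃ ψ : ∀ j, x ⟶ c j, ∀ i, φ i = ∑ j, ψ j ≫ κ j i

/-- The morphism to a sum of injectives given by a family of functionals. -/
noncomputable def injLift (hX : IsMod k X) {r : ℕ} (b : Fin r → A)
    (ξ : ∀ i, Module.Dual k (X.obj (b i))) : X ⟶ ⨁ fun i => InjAt k (b i) :=
  biproduct.lift fun i => homMk (Y := InjAt k (b i))
    (fun x =>
      { toFun := fun v =>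
          ({ toFun := fun φ => ξ i (act X φ v)
             map_add' := fun φ ψ => by rw [act_add hX, map_add]
             map_smul' := fun c φ => by rw [act_smul hX, map_smul, RingHom.id_apply] } :
            Module.Dual k (x ⟶ b i))
        map_add' := fun v w => LinearMap.ext fun φ => by
          change ξ i (act X φ (v + w)) = ξ i (act X φ v) + ξ i (act X φ w)
          rw [map_add, map_add]
        map_smul' := fun c v => LinearMap.ext fun φ => by
          change ξ i (act X φ (c • v)) = c • ξ i (act X φ v)
          rw [map_smul, map_smul] })
    (fun φ v => LinearMap.ext fun ψ => congrArg (ξ i) (act_comp φ ψ v).symm)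

/-- The component of an element of a sum of injectives. -/
noncomputable def injCoord {r : ℕ} {b : Fin r → A} {x : A}
    (z : (⨁ fun i => InjAt k (b i)).obj x) (i : Fin r) : Module.Dual k (x ⟶ b i) :=
  comp (biproduct.π (fun i => InjAt k (b i)) i) x z

theorem injCoord_act {r : ℕ} {b : Fin r → A} {x y : A} (φ : x ⟶ y)
    (z : (⨁ fun i => InjAt k (b i)).obj x) (i : Fin r) (ψ : y ⟶ b i) :
    injCoord (act (⨁ fun i => InjAt k (b i)) φ z) i ψ = injCoord z i (φ ≫ ψ) :=
  LinearMap.congr_fun (comp_act (biproduct.π (fun i => InjAt k (b i)) i) φ z) ψ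

theorem injCoord_injLift (hX : IsMod k X) {r : ℕ} (b : Fin r → A)
    (ξ : ∀ i, Module.Dual k (X.obj (b i))) (x : A) (v : X.obj x) (i : Fin r) (φ : x ⟶ b i) :
    injCoord (comp (injLift hX b ξ) x v) i φ = ξ i (act X φ v) := by
  rw [injCoord, ← comp_comp, injLift, biproduct.lift_π]
  rfl

theorem injCoord_ext {r : ℕ} {b : Fin r → A} {x : A}
    {z w : (⨁ fun i => InjAt k (b i)).obj x} (h : ∀ i φ, injCoord z i φ = injCoord w i φ) :
    z = w :=
  biproduct_elem_ext fun i => LinearMap.ext (h i)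

theorem KernelFCP.isFCP {f : L ⟶ M} (hL : IsLfdMod k L) (h : KernelFCP f) :
    IsFCP k (kernel f) := by
  obtain ⟨r, b, ξ, hξ, s, c, κ, hκ, hrel⟩ := h
  have hK : IsMod k (kernel f) := hL.1.of_injective (kernel.ι f) (injective_of_mono _)
  have hf : ∀ x v, comp f x (comp (kernel.ι f) x v) = 0 := fun x v => by
    rw [← comp_comp, kernel.condition, comp_zero]
  let g := injLift hK b fun i => ξ i ∘ₗ comp (kernel.ι f) (b i)
  have hg : ∀ x v i φ, injCoord (comp g x v) i φ = ξ i (act L φ (comp (kernel.ι f) x v)) := by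
    intro x v i φ
    rw [injCoord_injLift, LinearMap.comp_apply, comp_act]
  have hI : IsMod k (⨁ fun i => InjAt k (b i)) := IsMod.biproduct fun i => isMod_injAt (b i)
  let h := injLift hI c fun j =>
    { toFun := fun z => ∑ i, injCoord z i (κ j i)
      map_add' := fun z w => by
        rw [← Finset.sum_add_distrib]
        refine Finset.sum_congr rfl fun i _ => ?_
        rw [injCoord, map_add]
        rfl
      map_smul' := fun t z => by
        rw [RingHom.id_apply, Finset.smul_sum]
        refine Finset.sum_congr rfl fun i _ => ?_
        rw [injCoord, map_smul]
        rfl }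
  have hh : ∀ x z j ψ, injCoord (comp h x z) j ψ = ∑ i, injCoord z i (ψ ≫ κ j i) := by
    intro x z j ψ
    rw [injCoord_injLift]
    change ∑ i, injCoord (act (⨁ fun i => InjAt k (b i)) ψ z) i (κ j i) = _
    exact Finset.sum_congr rfl fun i _ => injCoord_act ψ z i (κ j i)
  have hgh : g ≫ h = 0 := hom_ext_comp fun x v => injCoord_ext fun j ψ => by
    rw [comp_comp, hh, comp_zero]
    obtain ⟨η, hη⟩ := hκ j
    have := LinearMap.congr_fun hη (act L ψ (comp (kernel.ι f) x v))
    rw [LinearMap.comp_apply, comp_act, hf, map_zero, map_zero, LinearMap.sum_apply] at this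
    refine Eq.trans (Finset.sum_congr rfl fun i _ => ?_) (this.trans ?_)
    · rw [hg, act_comp]
      rfl
    · rw [injCoord, map_zero]
      rfl
  refine ⟨r, b, g, mono_of_injective _ fun x => ?_, s, c, cokernel.desc g h hgh,
    mono_of_injective _ fun x => ?_⟩
  · refine (injective_iff_map_eq_zero _).2 fun v hv => ?_
    refine injective_of_mono (kernel.ι f) x ?_
    rw [map_zero]
    refine (Module.forall_dual_apply_eq_zero_iff k _).1 fun θ => ?_
    obtain ⟨φ, η, rfl⟩ := hξ x θ
    rw [LinearMap.add_apply, LinearMap.comp_apply, hf, map_zero, add_zero, LinearMap.sum_apply]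
    refine Finset.sum_eq_zero fun i _ => ?_
    rw [LinearMap.comp_apply, ← hg, hv, injCoord, map_zero]
    rfl
  · refine (injective_iff_map_eq_zero _).2 fun y hy => ?_
    obtain ⟨z, rfl⟩ := surjective_of_epi (cokernel.π g) x y
    rw [← comp_comp, cokernel.π_desc] at hy
    have := hL.2 x
    let V := LinearMap.ker (comp f x)
    let Φ : (∀ i, x ⟶ b i) →ₗ[k] Module.Dual k V :=
      { toFun := fun φ => (∑ i, ξ i ∘ₗ act L (φ i)) ∘ₗ V.subtype
        map_add' := fun φ ψ => LinearMap.ext fun v => by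
          simp [act_add hL.1, Finset.sum_add_distrib]
        map_smul' := fun t φ => LinearMap.ext fun v => by
          simp [act_smul hL.1, Finset.mul_sum] }
    obtain ⟨v, hv⟩ := exists_eval_of_ker_le Φ (∑ i, injCoord z i ∘ₗ LinearMap.proj i) (by
      intro φ hφ
      rw [LinearMap.mem_ker] at hφ ⊢
      obtain ⟨η, hη⟩ := exists_comp_eq_of_ker_le (comp f x) (∑ i, ξ i ∘ₗ act L (φ i)) (by
        intro v hv
        exact LinearMap.congr_fun hφ ⟨v, hv⟩)
      obtain ⟨ψ, hψ⟩ := hrel x φ η hη.symm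
      simp only [LinearMap.sum_apply, LinearMap.comp_apply, LinearMap.proj_apply, hψ, map_sum]
      rw [Finset.sum_comm]
      refine Finset.sum_eq_zero fun j _ => ?_
      rw [← hh, hy, injCoord, map_zero]
      rfl)
    obtain ⟨w, hw⟩ := exists_kernel_elem f x v.1 v.2
    have hz : z = comp g x w := injCoord_ext fun i φ => by
      classical
      rw [hg, hw]
      have := hv (Pi.single i φ)
      rw [LinearMap.sum_apply, Finset.sum_eq_single i] at this
      · rw [LinearMap.comp_apply, LinearMap.proj_apply, Pi.single_eq_same] at this
        refine this.trans ?_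
        change (∑ j, ξ j ∘ₗ act L ((Pi.single i φ : ∀ i, x ⟶ b i) j)) v.1 = _
        rw [LinearMap.sum_apply, Finset.sum_eq_single i]
        · rw [Pi.single_eq_same, LinearMap.comp_apply]
        · intro j _ hj
          rw [Pi.single_eq_of_ne hj, LinearMap.comp_apply, act_zero hL.1, map_zero]
        · simp
      · intro j _ hj
        rw [LinearMap.comp_apply, LinearMap.proj_apply, Pi.single_eq_of_ne hj, map_zero]
      · simp
    rw [hz, ← comp_comp, cokernel.condition, comp_zero]

end Presentation

section Duality

variable {k} {A : Type} [Category.{0} A]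

theorem exists_hom_of_bidual {X Y : A ⥤ ModuleCat.{0} k}
    (hY : ∀ a, FiniteDimensional k (Y.obj a))
    (T : ∀ a, X.obj a →ₗ[k] Module.Dual k (Module.Dual k (Y.obj a)))
    (hT : ∀ {a b} (φ : a ⟶ b) v ξ, T b (act X φ v) ξ = T a v (ξ ∘ₗ act Y φ)) :
    ∃ u : X ⟶ Y, ∀ a v (ξ : Module.Dual k (Y.obj a)), ξ (comp u a v) = T a v ξ := by
  let t (a : A) : X.obj a →ₗ[k] Y.obj a := (Module.evalEquiv k (Y.obj a)).symm.toLinearMap ∘ₗ T a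
  have ht : ∀ a v (ξ : Module.Dual k (Y.obj a)), ξ (t a v) = T a v ξ := fun a v ξ =>
    LinearMap.congr_fun ((Module.evalEquiv k (Y.obj a)).apply_symm_apply (T a v)) ξ
  refine ⟨homMk t fun {a b} φ v => ?_, ht⟩
  refine sub_eq_zero.1 ((Module.forall_dual_apply_eq_zero_iff k _).1 fun ξ => ?_)
  rw [map_sub, ht, hT, ← ht, sub_eq_zero]
  rfl

theorem hom_ext_dual {X Y : A ⥤ ModuleCat.{0} k} {f g : X ⟶ Y}
    (h : ∀ a v (ξ : Module.Dual k (Y.obj a)), ξ (comp f a v) = ξ (comp g a v)) : f = g :=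
  hom_ext_comp fun a v => sub_eq_zero.1 ((Module.forall_dual_apply_eq_zero_iff k _).1 fun ξ => by
    rw [map_sub, h, sub_self])

/-- The dual of a covariant functor to vector spaces. -/
noncomputable def dualTo (X : A ⥤ ModuleCat.{0} k) : Aᵒᵖ ⥤ ModuleCat.{0} k where
  obj a := ModuleCat.of k (Module.Dual k (X.obj a.unop))
  map φ := ModuleCat.ofHom (act X φ.unop).dualMap
  map_id a := ModuleCat.hom_ext (LinearMap.ext fun ξ => LinearMap.ext fun v =>
    congrArg (fun w => (ξ : Module.Dual k (X.obj a.unop)) w) (act_id a.unop v))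
  map_comp {a _ _} φ ψ := ModuleCat.hom_ext (LinearMap.ext fun ξ => LinearMap.ext fun v =>
    congrArg (fun w => (ξ : Module.Dual k (X.obj a.unop)) w) (act_comp ψ.unop φ.unop v))

/-- A functional, as an element of the dual functor. -/
def dualMk {X : A ⥤ ModuleCat.{0} k} {a : A} (ξ : Module.Dual k (X.obj a)) :
    (dualTo X).obj (Opposite.op a) := ξ

/-- The functional underlying an element of the dual functor. -/
def dualVal {X : A ⥤ ModuleCat.{0} k} {a : Aᵒᵖ} (ξ : (dualTo X).obj a) :
    Module.Dual k (X.obj a.unop) := ξ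

/-- The dual of a contravariant functor to vector spaces. -/
noncomputable def dualFrom (X : Aᵒᵖ ⥤ ModuleCat.{0} k) : A ⥤ ModuleCat.{0} k where
  obj a := ModuleCat.of k (Module.Dual k (X.obj (Opposite.op a)))
  map φ := ModuleCat.ofHom (act X φ.op).dualMap
  map_id a := ModuleCat.hom_ext (LinearMap.ext fun ξ => LinearMap.ext fun v =>
    congrArg (fun w => (ξ : Module.Dual k (X.obj (Opposite.op a))) w) (act_id (Opposite.op a) v))
  map_comp {a _ _} φ ψ := ModuleCat.hom_ext (LinearMap.ext fun ξ => LinearMap.ext fun v =>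
    congrArg (fun w => (ξ : Module.Dual k (X.obj (Opposite.op a))) w) (act_comp ψ.op φ.op v))

/-- The transpose of a morphism. -/
noncomputable def dualHom {X Y : A ⥤ ModuleCat.{0} k} (f : X ⟶ Y) : dualTo Y ⟶ dualTo X :=
  homMk (X := dualTo Y) (Y := dualTo X) (fun a => (comp f a.unop).dualMap)
    (fun φ ξ => LinearMap.ext fun v => congrArg (dualVal ξ) (comp_act f φ.unop v).symm)

theorem exists_undual {X Y : A ⥤ ModuleCat.{0} k} (hY : ∀ a, FiniteDimensional k (Y.obj a))
    (t : dualTo Y ⟶ dualTo X) :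
    ∃ u : X ⟶ Y, ∀ a v (ξ : Module.Dual k (Y.obj a)),
      ξ (comp u a v) = dualVal (comp t (Opposite.op a) (dualMk ξ)) v := by
  refine exists_hom_of_bidual hY
    (fun a => LinearMap.flip (comp t (Opposite.op a) :
      Module.Dual k (Y.obj a) →ₗ[k] Module.Dual k (X.obj a))) ?_
  intro a b φ v ξ
  exact (LinearMap.congr_fun (comp_act t φ.op (dualMk ξ)) v).symm

variable [Preadditive A]

theorem CokernelFP.kernelFCP {L M : A ⥤ ModuleCat.{0} k} {f : L ⟶ M} (h : CokernelFP (dualHom f)) : KernelFCP f := by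
  obtain ⟨r, a, m, hm, s, c, κ, hκ, hrel⟩ := h
  refine ⟨r, fun i => (a i).unop, fun i => dualVal (m i), fun x θ => ?_, s, fun j => (c j).unop,
    fun j i => (κ j i).unop, hκ, fun x φ η h => ?_⟩
  · obtain ⟨φ, η, h⟩ := hm (Opposite.op x) (dualMk θ)
    exact ⟨fun i => (φ i).unop, η, h⟩
  · obtain ⟨ψ, hψ⟩ := hrel (Opposite.op x) (fun i => (φ i).op) (dualMk η) h
    refine ⟨fun j => (ψ j).unop, fun i => ?_⟩
    have := congrArg Quiver.Hom.unop (hψ i)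
    rw [unop_sum] at this
    exact this

variable [CategoryTheory.Linear k A]

noncomputable instance oppositeLinear : CategoryTheory.Linear k Aᵒᵖ where
  homModule a b := Equiv.module k (opEquiv a b)
  smul_comp _ _ _ t f g := Quiver.Hom.unop_inj (Linear.comp_smul _ _ _ g.unop t f.unop)
  comp_smul _ _ _ f t g := Quiver.Hom.unop_inj (Linear.smul_comp _ _ _ t g.unop f.unop)

theorem isLfdMod_dualTo {X : A ⥤ ModuleCat.{0} k} (hX : IsLfdMod k X) :
    IsLfdMod k (dualTo X) := by
  have := hX.2
  refine ⟨isMod_of_act (X := dualTo X) (fun {a b} φ ψ ξ => LinearMap.ext fun v => ?_)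
    (fun {a b} c φ ξ => LinearMap.ext fun v => ?_), fun a => ?_⟩
  · exact (congrArg (dualVal ξ) (act_add hX.1 φ.unop ψ.unop v)).trans (map_add (dualVal ξ) _ _)
  · exact (congrArg (dualVal ξ) (act_smul hX.1 c φ.unop v)).trans (map_smul (dualVal ξ) _ _)
  · exact inferInstanceAs (FiniteDimensional k (Module.Dual k (X.obj a.unop)))

theorem isLfdMod_dualFrom {X : Aᵒᵖ ⥤ ModuleCat.{0} k} (hX : IsLfdMod k X) :
    IsLfdMod k (dualFrom X) := by
  have := hX.2
  refine ⟨isMod_of_act (X := dualFrom X) (fun {a b} φ ψ ξ => LinearMap.ext fun v => ?_)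
    (fun {a b} c φ ξ => LinearMap.ext fun v => ?_), fun a => ?_⟩
  · let ξ' : Module.Dual k (X.obj (Opposite.op a)) := ξ
    exact (congrArg ξ' (act_add hX.1 φ.op ψ.op v)).trans (map_add ξ' _ _)
  · let ξ' : Module.Dual k (X.obj (Opposite.op a)) := ξ
    exact (congrArg ξ' (act_smul hX.1 c φ.op v)).trans (map_smul ξ' _ _)
  · exact inferInstanceAs (FiniteDimensional k (Module.Dual k (X.obj (Opposite.op a))))

variable {L M : A ⥤ ModuleCat.{0} k}

theorem Irred.dual (hL : IsLfdMod k L) (hM : IsLfdMod k M) {f : L ⟶ M} (h : Irred k f) :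
    Irred k (dualHom f) := by
  refine ⟨?_, ?_, ?_⟩
  · rintro ⟨⟨r, hr⟩⟩
    obtain ⟨u, hu⟩ := exists_undual hL.2 r
    refine h.2.1 ⟨⟨u, hom_ext_dual fun a v ξ => ?_⟩⟩
    rw [comp_comp, comp_id]
    refine (hu a v (ξ ∘ₗ comp f a)).trans ?_
    have := congrArg (fun g => comp g (Opposite.op a) (dualMk ξ)) hr
    simp only [comp_comp, comp_id] at this
    exact LinearMap.congr_fun this v
  · rintro ⟨⟨s, hs⟩⟩
    obtain ⟨u, hu⟩ := exists_undual hL.2 s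
    refine h.1 ⟨⟨u, hom_ext_dual fun a v ξ => ?_⟩⟩
    rw [comp_comp, comp_id, hu]
    have := congrArg (fun g => comp g (Opposite.op a) (dualMk ξ)) hs
    simp only [comp_comp, comp_id] at this
    exact LinearMap.congr_fun this v
  · intro N hN g h' hgh
    let tr : L ⟶ dualFrom N := homMk (Y := dualFrom N)
      (fun a => LinearMap.flip (comp h' (Opposite.op a) :
        N.obj (Opposite.op a) →ₗ[k] Module.Dual k (L.obj a)))
      (fun φ v => LinearMap.ext fun n => (LinearMap.congr_fun (comp_act h' φ.op n) v).symm)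
    obtain ⟨u, hu⟩ := exists_hom_of_bidual (X := dualFrom N) hM.2
      (fun a => (comp g (Opposite.op a) :
        Module.Dual k (M.obj a) →ₗ[k] N.obj (Opposite.op a)).dualMap)
      (fun {a b} φ η ξ =>
        let η' : Module.Dual k (N.obj (Opposite.op a)) := η
        congrArg η' (comp_act g φ.op (dualMk ξ)).symm)
    obtain ⟨⟨r, hr⟩⟩ | ⟨⟨s, hs⟩⟩ := h.2.2 (isLfdMod_dualFrom hN) tr u
      (hom_ext_dual fun a v ξ => by
        rw [comp_comp, hu]
        have := congrArg (fun g => comp g (Opposite.op a) (dualMk ξ)) hgh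
        simp only [comp_comp] at this
        exact LinearMap.congr_fun this v)
    · refine Or.inr ?_
      obtain ⟨s, hs⟩ := exists_hom_of_bidual (X := dualTo L) (Y := N) hN.2
        (fun a => (comp r a.unop :
          Module.Dual k (N.obj a) →ₗ[k] L.obj a.unop).dualMap)
        (fun {a b} φ l ξ => congrArg (dualVal l)
          (comp_act r φ.unop (ξ : Module.Dual k (N.obj b))).symm)
      refine ⟨⟨s, hom_ext_comp fun a l => LinearMap.ext fun v => ?_⟩⟩
      rw [comp_comp, comp_id]
      refine (hs a l (comp tr a.unop v : Module.Dual k (N.obj a))).trans ?_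
      have := congrArg (fun g => comp g a.unop v) hr
      simp only [comp_comp, comp_id] at this
      exact congrArg (dualVal l) this
    · refine Or.inl ⟨⟨homMk (X := N) (Y := dualTo M)
        (fun a => LinearMap.flip (comp s a.unop :
          M.obj a.unop →ₗ[k] Module.Dual k (N.obj a)))
        (fun φ n => LinearMap.ext fun v =>
          (LinearMap.congr_fun (comp_act s φ.unop v) n).symm), ?_⟩⟩
      refine hom_ext_comp fun a ξ => LinearMap.ext fun v => ?_
      rw [comp_comp, comp_id]
      refine (hu a.unop (comp s a.unop v) (dualVal ξ)).symm.trans ?_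
      have := congrArg (fun g => comp g a.unop v) hs
      simp only [comp_comp, comp_id] at this
      exact congrArg (dualVal ξ) this

theorem idempotent_dualTo (hM : IsLfdMod k M)
    (h : ∀ π : M ⟶ M, π ≫ π = π → π = 0 ∨ π = 𝟙 M) (π : dualTo M ⟶ dualTo M)
    (hπ : π ≫ π = π) : π = 0 ∨ π = 𝟙 _ := by
  obtain ⟨u, hu⟩ := exists_undual hM.2 π
  obtain h | h := h u (hom_ext_dual fun a v ξ => by
    rw [comp_comp, hu]
    refine (hu a v (dualVal (comp π (Opposite.op a) (dualMk ξ)))).trans ?_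
    rw [hu]
    have := congrArg (fun g => comp g (Opposite.op a) (dualMk ξ)) hπ
    simp only [comp_comp] at this
    exact LinearMap.congr_fun this v)
  · refine Or.inl (hom_ext_comp fun a ξ => LinearMap.ext fun v => ?_)
    refine (hu a.unop v (dualVal ξ)).symm.trans ?_
    rw [h, comp_zero, comp_zero, map_zero]
    rfl
  · refine Or.inr (hom_ext_comp fun a ξ => LinearMap.ext fun v => ?_)
    refine (hu a.unop v (dualVal ξ)).symm.trans ?_
    rw [h, comp_id, comp_id]
    rfl

end Duality

section Indecomposable

variable {k} {A : Type} [Category.{0} A]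

theorem exists_ne_zero_of_not_isZero {L : A ⥤ ModuleCat.{0} k} (h : ¬ IsZero L) :
    ∃ a, ∃ v : L.obj a, v ≠ 0 := by
  by_contra! hcon
  refine h ((IsZero.iff_id_eq_zero L).2 (hom_ext_comp fun a v => ?_))
  rw [hcon a v, map_zero, map_zero]

theorem Indec.idempotent [Preadditive A] [CategoryTheory.Linear k A] {L : A ⥤ ModuleCat.{0} k}
    (hL : IsLfdMod k L) (h : Indec k L) (π : L ⟶ L) (hπ : π ≫ π = π) : π = 0 ∨ π = 𝟙 L := by
  have hR : Stable fun a => LinearMap.range (comp π a) := by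
    rintro a b φ _ ⟨w, rfl⟩
    exact ⟨act L φ w, comp_act π φ w⟩
  have hK : Stable fun a => LinearMap.ker (comp π a) := by
    intro a b φ v hv
    rw [LinearMap.mem_ker] at hv ⊢
    rw [comp_act, hv, map_zero]
  have := mono_of_injective (subι _ hR) fun a => Subtype.val_injective
  have := mono_of_injective (subι _ hK) fun a => Subtype.val_injective
  obtain ⟨p, hp⟩ := exists_subF_lift _ hR π fun a v => ⟨v, rfl⟩
  obtain ⟨q, hq⟩ := exists_subF_lift _ hK (𝟙 L - π) fun a v => by
    rw [LinearMap.mem_ker, ← comp_comp, Preadditive.sub_comp, hπ, Category.id_comp, sub_self,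
      comp_zero]
  have hRπ : subι _ hR ≫ π = subι _ hR := hom_ext_comp fun a v => by
    obtain ⟨_, ⟨w, rfl⟩⟩ := v
    exact congrArg (fun g => comp g a w) hπ
  have hKπ : subι _ hK ≫ π = 0 := hom_ext_comp fun a v => LinearMap.mem_ker.1 v.2
  obtain h | h := h.2 (hL.subF _ hR) (hL.subF _ hK)
    { hom := biprod.lift p q
      inv := biprod.desc (subι _ hR) (subι _ hK)
      hom_inv_id := by rw [biprod.lift_desc, hp, hq, add_sub_cancel]
      inv_hom_id := by
        refine biprod.hom_ext' _ _ (biprod.hom_ext _ _ ?_ ?_) (biprod.hom_ext _ _ ?_ ?_)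
        · simp [← cancel_mono (subι _ hR), hp, hRπ]
        · simp [← cancel_mono (subι _ hK), hq, hRπ]
        · simp [← cancel_mono (subι _ hR), hp, hKπ]
        · simp [← cancel_mono (subι _ hK), hq, hKπ] }
  · refine Or.inl ?_
    rw [← hp, h.eq_of_tgt p 0, Limits.zero_comp]
  · refine Or.inr (sub_eq_zero.1 ?_).symm
    rw [← hq, h.eq_of_tgt q 0, Limits.zero_comp]

end Indecomposable

section PathBasis

variable (A : Type) [Category.{0} A] [Preadditive A] [CategoryTheory.Linear k A]

/-- A system of arrows of a linear category, indexed by their targets, such that the paths they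
form are bases of the spaces of morphisms. -/
structure PathBasis where
  In : A → Type
  finite_in : ∀ x, Finite (In x)
  src : ∀ {x}, In x → A
  hom : ∀ {x} (α : In x), src α ⟶ x
  B : A → A → Type
  finite : ∀ a x, Finite (B a x)
  basis : ∀ a x, Module.Basis (B a x) k (a ⟶ x)
  snoc : ∀ {a x} (α : In x), B a (src α) → B a x
  basis_snoc : ∀ {a x} (α : In x) (p : B a (src α)),
    basis a x (snoc α p) = basis a (src α) p ≫ hom α
  snoc_inj : ∀ {a x} (α β : In x) (p : B a (src α)) (q : B a (src β)), snoc α p = snoc β q →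
    (⟨α, p⟩ : Σ α : In x, B a (src α)) = ⟨β, q⟩
  cases : ∀ {a x} (p : B a x),
    (∃ h : a = x, basis a x p = eqToHom h) ∨ ∃ α q, snoc α q = p
  length : ∀ {a x}, B a x → ℕ
  length_snoc : ∀ {a x} (α : In x) (p : B a (src α)), length (snoc α p) = length p + 1

attribute [instance] PathBasis.finite_in PathBasis.finite

variable {k A}

namespace PathBasis

variable (P : PathBasis k A)

theorem indep {a x : A} [Fintype (P.In x)] (g : ∀ α : P.In x, a ⟶ P.src α)
    (h : ∑ α, g α ≫ P.hom α = 0) (α : P.In x) : g α = 0 := by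
  have (α : P.In x) : Fintype (P.B a (P.src α)) := Fintype.ofFinite _
  have hli := (P.basis a x).linearIndependent.comp
    (fun s : Σ α : P.In x, P.B a (P.src α) => P.snoc s.1 s.2)
    (fun s t hst => P.snoc_inj s.1 t.1 s.2 t.2 hst)
  have hc := Fintype.linearIndependent_iff.1 hli
    (fun s => (P.basis a (P.src s.1)).repr (g s.1) s.2) (by
      rw [Fintype.sum_sigma, ← h]
      refine Finset.sum_congr rfl fun β _ => ?_
      refine Eq.trans ?_ (congrArg (· ≫ P.hom β) ((P.basis a (P.src β)).sum_repr (g β)))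
      rw [Preadditive.sum_comp]
      refine Finset.sum_congr rfl fun q _ => ?_
      rw [Linear.smul_comp, ← P.basis_snoc]
      rfl)
  refine (P.basis a (P.src α)).repr.map_eq_zero_iff.1 (Finsupp.ext fun p => ?_)
  exact hc ⟨α, p⟩

theorem decomp {a x : A} [Fintype (P.In x)] (φ : a ⟶ x) (hax : a ≠ x) :
    ∃ g : ∀ α : P.In x, a ⟶ P.src α, φ = ∑ α, g α ≫ P.hom α := by
  classical
  have hφ : φ ∈ Submodule.span k (Set.range (P.basis a x)) := by
    rw [Module.Basis.span_eq]
    exact Submodule.mem_top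
  induction hφ using Submodule.span_induction with
  | mem φ h =>
    obtain ⟨p, rfl⟩ := h
    obtain ⟨h, -⟩ | ⟨α, q, rfl⟩ := P.cases p
    · exact (hax h).elim
    · refine ⟨Pi.single α (P.basis a _ q), ?_⟩
      rw [P.basis_snoc, Finset.sum_eq_single α, Pi.single_eq_same]
      · intro β _ hβ
        rw [Pi.single_eq_of_ne hβ, Limits.zero_comp]
      · simp
  | zero => exact ⟨fun _ => 0, by simp⟩
  | add φ ψ _ _ h h' =>
    obtain ⟨g, rfl⟩ := h
    obtain ⟨g', rfl⟩ := h'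
    exact ⟨g + g', by simp [Finset.sum_add_distrib]⟩
  | smul c φ _ h =>
    obtain ⟨g, rfl⟩ := h
    exact ⟨c • g, by simp [Finset.smul_sum]⟩

theorem induction (C : ∀ {a x : A}, (a ⟶ x) → Prop) (h_id : ∀ a, C (𝟙 a))
    (h_hom : ∀ {x} (α : P.In x), C (P.hom α))
    (h_comp : ∀ {a b c} (φ : a ⟶ b) (ψ : b ⟶ c), C φ → C ψ → C (φ ≫ ψ))
    (h_zero : ∀ {a b}, C (0 : a ⟶ b))
    (h_add : ∀ {a b} (φ ψ : a ⟶ b), C φ → C ψ → C (φ + ψ))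
    (h_smul : ∀ {a b} (c : k) (φ : a ⟶ b), C φ → C (c • φ)) {a x : A} (φ : a ⟶ x) : C φ := by
  have hB : ∀ (n : ℕ) {x} (p : P.B a x), P.length p = n → C (P.basis a x p) := by
    intro n
    induction n with
    | zero =>
      intro x p hp
      obtain ⟨rfl, h⟩ | ⟨α, q, rfl⟩ := P.cases p
      · rw [h]
        exact h_id a
      · rw [P.length_snoc] at hp
        omega
    | succ n ih =>
      intro x p hp
      obtain ⟨rfl, h⟩ | ⟨α, q, rfl⟩ := P.cases p
      · rw [h]
        exact h_id a
      · rw [P.length_snoc] at hp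
        rw [P.basis_snoc]
        exact h_comp _ _ (ih q (by omega)) (h_hom α)
  have hφ : φ ∈ Submodule.span k (Set.range (P.basis a x)) := by
    rw [Module.Basis.span_eq]
    exact Submodule.mem_top
  induction hφ using Submodule.span_induction with
  | mem φ h =>
    obtain ⟨p, rfl⟩ := h
    exact hB _ p rfl
  | zero => exact h_zero
  | add φ ψ _ _ h h' => exact h_add φ ψ h h'
  | smul c φ _ h => exact h_smul c φ h

/-- The supremum of the numbers of vertices of the paths between two objects. -/
noncomputable def rank (a x : A) : ℕ := ⨆ p : P.B a x, (P.length p + 1)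

theorem length_lt_rank {a x : A} (p : P.B a x) : P.length p < P.rank a x :=
  Nat.lt_of_succ_le (le_ciSup (f := fun p : P.B a x => P.length p + 1)
    (Set.finite_range _).bddAbove p)

theorem rank_le (a : A) {x : A} (α : P.In x) : P.rank a (P.src α) ≤ P.rank a x := by
  refine ciSup_le' fun p => ?_
  have := P.length_lt_rank (P.snoc α p)
  rw [P.length_snoc] at this
  omega

theorem rank_lt {a x : A} (α : P.In x) (g : a ⟶ P.src α) (hg : g ≠ 0) :
    P.rank a (P.src α) < P.rank a x := by
  have : Nonempty (P.B a (P.src α)) := by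
    by_contra h
    rw [not_nonempty_iff] at h
    exact hg ((P.basis a (P.src α)).ext_elem fun p => h.elim p)
  refine Nat.lt_of_succ_le ?_
  obtain ⟨p, hp⟩ := exists_eq_ciSup_of_finite (f := fun p : P.B a (P.src α) => P.length p + 1)
  have := P.length_lt_rank (P.snoc α p)
  rw [P.length_snoc] at this
  rw [rank, ← hp]
  exact this

/-- The system of arrows underlying a basis of paths. -/
noncomputable def incomingArrows : IncomingArrows k A where
  In := P.In
  fintype _ := Fintype.ofFinite _
  src := P.src
  hom := P.hom
  homFinite a x := Module.Finite.of_basis (P.basis a x)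
  indep {_ x} g h := @PathBasis.indep k _ A _ _ _ P _ x (Fintype.ofFinite _) g h
  decomp {_ x} φ h := @PathBasis.decomp k _ A _ _ _ P _ x (Fintype.ofFinite _) φ h
  ind := P.induction
  rank := P.rank
  rank_le := P.rank_le
  rank_lt := P.rank_lt

end PathBasis

end PathBasis

section QuiverPaths

variable {Q : Type} [Quiver.{0} Q]

theorem toPath_comp_injective {a x y z : Q} (α : x ⟶ y) (β : x ⟶ z) (p : Quiver.Path y a)
    (q : Quiver.Path z a) (h : α.toPath.comp p = β.toPath.comp q) :
    (⟨⟨y, α⟩, p⟩ : Σ s : Σ y : Q, x ⟶ y, Quiver.Path s.1 a) = ⟨⟨z, β⟩, q⟩ := by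
  induction p with
  | nil =>
    cases q with
    | nil =>
      cases h
      rfl
    | cons q γ =>
      have := congrArg Quiver.Path.length h
      simp [Quiver.Hom.toPath] at this
  | cons p δ ih =>
    cases q with
    | nil =>
      have := congrArg Quiver.Path.length h
      simp [Quiver.Hom.toPath] at this
    | cons q γ =>
      rw [Quiver.Path.comp_cons, Quiver.Path.comp_cons] at h
      obtain rfl := Quiver.Path.obj_eq_of_cons_eq_cons h
      obtain rfl := eq_of_heq (Quiver.Path.hom_heq_of_cons_eq_cons h)
      have := ih q (eq_of_heq (Quiver.Path.heq_of_cons_eq_cons h))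
      cases this
      rfl

variable {k}

/-- The paths of a quiver, as a basis of its path category. -/
noncomputable def PathBasis.paths (hQ : StronglyLocallyFinite Q) : PathBasis k (PathCat k Q) where
  In x := Σ y : Q, @Quiver.Hom Q _ y x
  finite_in x := (hQ.1 x).2
  src α := α.1
  hom α := Finsupp.single (Quiver.Hom.toPath α.2) 1
  B a x := @Quiver.Path Q _ a x
  finite a x := hQ.2 a x
  basis a x := Module.Basis.ofRepr (LinearEquiv.refl k (@Quiver.Path Q _ a x →₀ k))
  snoc α p := p.cons α.2
  basis_snoc {a x} α p := by
    refine Eq.trans ?_ (Free.single_comp_single (C := Paths Q) k _ _ 1 1).symm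
    rw [one_mul]
    rfl
  snoc_inj {a x} α β p q h := by
    obtain ⟨y, α⟩ := α
    obtain ⟨z, β⟩ := β
    cases h
    rfl
  cases {a x} p := by
    cases p with
    | nil => exact Or.inl ⟨rfl, rfl⟩
    | cons p α => exact Or.inr ⟨⟨_, α⟩, p, rfl⟩
  length p := p.length
  length_snoc _ _ := rfl

/-- The paths of a quiver, as a basis of the opposite of its path category. -/
noncomputable def PathBasis.opPaths (hQ : StronglyLocallyFinite Q) :
    PathBasis k (PathCat k Q)ᵒᵖ where
  In x := Σ y : Q, @Quiver.Hom Q _ x.unop y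
  finite_in x := (hQ.1 x.unop).1
  src α := Opposite.op α.1
  hom {x} α := Quiver.Hom.op (X := x.unop) (Finsupp.single (Quiver.Hom.toPath α.2) 1)
  B a x := @Quiver.Path Q _ x.unop a.unop
  finite a x := hQ.2 x.unop a.unop
  basis a x := Module.Basis.ofRepr
    { toFun := fun φ => φ.unop
      invFun := fun φ => Quiver.Hom.op (X := x.unop) (Y := a.unop) φ
      map_add' := fun _ _ => rfl
      map_smul' := fun _ _ => rfl
      left_inv := fun _ => rfl
      right_inv := fun _ => rfl }
  snoc α p := α.2.toPath.comp p
  basis_snoc {a x} α p := by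
    refine Quiver.Hom.unop_inj ?_
    refine Eq.trans ?_ (Free.single_comp_single (C := Paths Q) k _ _ 1 1).symm
    rw [one_mul]
    rfl
  snoc_inj {a x} α β p q h := toPath_comp_injective α.2 β.2 p q h
  cases {a x} p := by
    obtain ⟨a⟩ := a
    obtain ⟨x⟩ := x
    cases h : p.length with
    | zero =>
      obtain rfl := Quiver.Path.eq_of_length_zero p h
      obtain rfl := Quiver.Path.eq_nil_of_length_zero p h
      exact Or.inl ⟨rfl, rfl⟩
    | succ n =>
      obtain ⟨y, α, q, -, rfl⟩ := Quiver.Path.eq_toPath_comp_of_length_eq_succ p h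
      exact Or.inr ⟨⟨y, α⟩, q, rfl⟩
  length p := p.length
  length_snoc α p := (Quiver.Path.length_comp α.2.toPath p).trans (add_comm 1 _)

end QuiverPaths

variable (k : Type) [Field k] [IsAlgClosed k]
variable (Q : Type) [Quiver.{0} Q]

/-- Let `f : L ⟶ M` be an irreducible morphism in `rep(Q)`. If `f` is a monomorphism and
`L` is indecomposable, then `coker f` is finitely presented. If `f` is an epimorphism and
`M` is indecomposable, then `ker f` is finitely co-presented. -/
theorem statement_13 (hQ : StronglyLocallyFinite Q)
    {L M : PathCat k Q ⥤ ModuleCat.{0} k}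
    (hL : IsLfdMod k L) (hM : IsLfdMod k M) (f : L ⟶ M) (hirr : Irred k f) :
    (Mono f → Indec k L → IsFP k (cokernel f)) ∧
      (Epi f → Indec k M → IsFCP k (kernel f)) := by
  refine ⟨fun _ hind => ?_, fun _ hind => ?_⟩
  · obtain ⟨a, v, hv⟩ := exists_ne_zero_of_not_isZero hind.1
    exact (hirr.cokernelFP (PathBasis.paths hQ).incomingArrows hL hM
      (hind.idempotent hL) hv).isFP hM.1
  · obtain ⟨a, v, hv⟩ := exists_ne_zero_of_not_isZero hind.1
    obtain ⟨ξ, hξ⟩ : ∃ ξ : Module.Dual k (M.obj a), ξ v ≠ 0 := by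
      by_contra! h
      exact hv ((Module.forall_dual_apply_eq_zero_iff k v).1 h)
    have hξ' : dualMk ξ ≠ 0 := fun h => hξ (congrArg (fun ζ => dualVal ζ v) h)
    exact ((hirr.dual hL hM).cokernelFP (PathBasis.opPaths hQ).incomingArrows
      (isLfdMod_dualTo hM) (isLfdMod_dualTo hL)
      (idempotent_dualTo hM (hind.idempotent hM)) hξ').kernelFCP.isFCP hL

end Paper
end
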